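/- arXiv:1806.02331 — 4 statements merged into one kernel-verified Lean document; each statement's English description precedes it below -/
import Mathlib

section
/- Let ι_{a1}, ι_{a2}, ι_{b1}, ι_{b2}, ι_{e1}, ι_{e2} be nonempty finite types with ι_{a1} = ι_{b1} and ι_{a2} = ι_{b2}, and let ρ be a pure density matrix on the product type ι_{a1} × ι_{a2} × ι_{b1} × ι_{b2} × ι_{e1} × ι_{e2}. Assume: (i) the reduced density matrix ρ^{a1 a2 b2} equals the tensor (Kronecker) product ρ^{a1 b2} ⊗ ρ^{a2} (after the obvious reindexing of product types); (ii) ρ^{a1 a2 b1 b2} is symmetric under exchanging the pair (a1, a2) with the pair (b1, b2), i.e. ρ^{a1 a2 b1 b2} ((x1,x2,y1,y2),(x1',x2',y1',y2')) = ρ^{a1 a2 b1 b2} ((y1,y2,x1,x2),(y1',y2',x1',x2')) for all indices; (iii) S(ρ^{b1}) ≤ S(ρ^{e1}); (iv) S(ρ^{a1 b2}) ≥ S(ρ^{b1 e1}). Then the coherent information toward B is nonpositive: S(ρ^{b1 b2}) − S(ρ^{a1 a2 b1 b2}) ≤ 0. -/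
open Matrix ComplexOrder

/-- Von Neumann entropy of a (Hermitian) matrix: `∑ i, negMulLog λᵢ` over its eigenvalues. -/
noncomputable def vnEntropy {ι : Type*} [Fintype ι] [DecidableEq ι] (M : Matrix ι ι ℂ) : ℝ :=
  if h : M.IsHermitian then ∑ i, Real.negMulLog (h.eigenvalues i) else 0

/-- A density matrix: positive semidefinite with unit trace. -/
def IsDensityMatrix {ι : Type*} [Fintype ι] (ρ : Matrix ι ι ℂ) : Prop :=
  ρ.PosSemidef ∧ ρ.trace = 1

/-- A pure density matrix: a density matrix of the form `|w⟩⟨w|` for a unit vector `w`. -/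
def IsPureDensityMatrix {ι : Type*} [Fintype ι] (ρ : Matrix ι ι ℂ) : Prop :=
  IsDensityMatrix ρ ∧ ∃ w : ι → ℂ, (∑ i, ‖w i‖ ^ 2 = 1) ∧ ρ = Matrix.vecMulVec w (star w)

section
/- Index types: positions are (a1, a2, b1, b2, e1, e2), with `ι_{a1} = ι_{b1} = ι1` and
`ι_{a2} = ι_{b2} = ι2`. -/
variable {ι1 ι2 ι5 ι6 : Type*} [Fintype ι1] [Fintype ι2] [Fintype ι5] [Fintype ι6]

/-- Reduced density matrix on (a1, a2, b1, b2). -/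
noncomputable def redA1A2B1B2
    (ρ : Matrix (ι1 × ι2 × ι1 × ι2 × ι5 × ι6) (ι1 × ι2 × ι1 × ι2 × ι5 × ι6) ℂ) :
    Matrix (ι1 × ι2 × ι1 × ι2) (ι1 × ι2 × ι1 × ι2) ℂ :=
  fun p q => ∑ x5 : ι5, ∑ x6 : ι6,
    ρ (p.1, p.2.1, p.2.2.1, p.2.2.2, x5, x6) (q.1, q.2.1, q.2.2.1, q.2.2.2, x5, x6)

/-- Reduced density matrix on (a1, a2, b2). -/
noncomputable def redA1A2B2
    (ρ : Matrix (ι1 × ι2 × ι1 × ι2 × ι5 × ι6) (ι1 × ι2 × ι1 × ι2 × ι5 × ι6) ℂ) :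
    Matrix (ι1 × ι2 × ι2) (ι1 × ι2 × ι2) ℂ :=
  fun p q => ∑ x3 : ι1, ∑ x5 : ι5, ∑ x6 : ι6,
    ρ (p.1, p.2.1, x3, p.2.2, x5, x6) (q.1, q.2.1, x3, q.2.2, x5, x6)

/-- Reduced density matrix on (a1, b2). -/
noncomputable def redA1B2
    (ρ : Matrix (ι1 × ι2 × ι1 × ι2 × ι5 × ι6) (ι1 × ι2 × ι1 × ι2 × ι5 × ι6) ℂ) :
    Matrix (ι1 × ι2) (ι1 × ι2) ℂ :=
  fun p q => ∑ x2 : ι2, ∑ x3 : ι1, ∑ x5 : ι5, ∑ x6 : ι6,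
    ρ (p.1, x2, x3, p.2, x5, x6) (q.1, x2, x3, q.2, x5, x6)

/-- Reduced density matrix on (a2). -/
noncomputable def redA2
    (ρ : Matrix (ι1 × ι2 × ι1 × ι2 × ι5 × ι6) (ι1 × ι2 × ι1 × ι2 × ι5 × ι6) ℂ) :
    Matrix ι2 ι2 ℂ :=
  fun p q => ∑ x1 : ι1, ∑ x3 : ι1, ∑ x4 : ι2, ∑ x5 : ι5, ∑ x6 : ι6,
    ρ (x1, p, x3, x4, x5, x6) (x1, q, x3, x4, x5, x6)

/-- Reduced density matrix on (b1). -/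
noncomputable def redB1
    (ρ : Matrix (ι1 × ι2 × ι1 × ι2 × ι5 × ι6) (ι1 × ι2 × ι1 × ι2 × ι5 × ι6) ℂ) :
    Matrix ι1 ι1 ℂ :=
  fun p q => ∑ x1 : ι1, ∑ x2 : ι2, ∑ x4 : ι2, ∑ x5 : ι5, ∑ x6 : ι6,
    ρ (x1, x2, p, x4, x5, x6) (x1, x2, q, x4, x5, x6)

/-- Reduced density matrix on (e1). -/
noncomputable def redE1
    (ρ : Matrix (ι1 × ι2 × ι1 × ι2 × ι5 × ι6) (ι1 × ι2 × ι1 × ι2 × ι5 × ι6) ℂ) :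
    Matrix ι5 ι5 ℂ :=
  fun p q => ∑ x1 : ι1, ∑ x2 : ι2, ∑ x3 : ι1, ∑ x4 : ι2, ∑ x6 : ι6,
    ρ (x1, x2, x3, x4, p, x6) (x1, x2, x3, x4, q, x6)

/-- Reduced density matrix on (b1, e1). -/
noncomputable def redB1E1
    (ρ : Matrix (ι1 × ι2 × ι1 × ι2 × ι5 × ι6) (ι1 × ι2 × ι1 × ι2 × ι5 × ι6) ℂ) :
    Matrix (ι1 × ι5) (ι1 × ι5) ℂ :=
  fun p q => ∑ x1 : ι1, ∑ x2 : ι2, ∑ x4 : ι2, ∑ x6 : ι6,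
    ρ (x1, x2, p.1, x4, p.2, x6) (x1, x2, q.1, x4, q.2, x6)

/-- Reduced density matrix on (b1, b2). -/
noncomputable def redB1B2
    (ρ : Matrix (ι1 × ι2 × ι1 × ι2 × ι5 × ι6) (ι1 × ι2 × ι1 × ι2 × ι5 × ι6) ℂ) :
    Matrix (ι1 × ι2) (ι1 × ι2) ℂ :=
  fun p q => ∑ x1 : ι1, ∑ x2 : ι2, ∑ x5 : ι5, ∑ x6 : ι6,
    ρ (x1, x2, p.1, p.2, x5, x6) (x1, x2, q.1, q.2, x5, x6)

end

/-! ### Scalar part: from resolvent inequalities to logarithms -/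

lemma aux_logsum_tendsto {I : Type*} [Fintype I] (w p q : I → ℝ)
    (hp : ∀ k, 0 ≤ p k) (h1 : ∑ k, w k * p k = 1) :
    Filter.Tendsto (fun t : ℝ => (∑ k, w k * p k * Real.log (t * p k + q k)) - Real.log t)
      Filter.atTop (nhds (∑ k, w k * p k * Real.log (p k))) := by
  have h2 : ∀ t : ℝ, (∑ k, w k * p k * Real.log (t * p k + q k)) - Real.log t
      = ∑ k, w k * p k * (Real.log (t * p k + q k) - Real.log t) := by
    intro t
    simp only [mul_sub, Finset.sum_sub_distrib, ← Finset.sum_mul, h1, one_mul]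
  simp only [h2]
  apply tendsto_finsetSum
  intro k _
  rcases (hp k).eq_or_lt with h0 | hpos
  · simp [← h0]
  · apply Filter.Tendsto.const_mul
    have h3 : Filter.Tendsto (fun t : ℝ => Real.log (p k + q k * t⁻¹)) Filter.atTop
        (nhds (Real.log (p k))) := by
      have h4 : Filter.Tendsto (fun t : ℝ => p k + q k * t⁻¹) Filter.atTop
          (nhds (p k + q k * 0)) :=
        tendsto_const_nhds.add (tendsto_inv_atTop_zero.const_mul _)
      rw [mul_zero, add_zero] at h4
      exact h4.log hpos.ne'
    refine h3.congr' ?_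
    have h5 : Filter.Tendsto (fun t : ℝ => t * p k + q k) Filter.atTop Filter.atTop :=
      Filter.tendsto_atTop_add_const_right _ _ (Filter.tendsto_id.atTop_mul_const hpos)
    filter_upwards [Filter.eventually_gt_atTop 0, h5.eventually_gt_atTop 0] with t ht ht2
    rw [← Real.log_div ht2.ne' ht.ne']
    congr 1
    field_simp

lemma aux_logsum_cont {I : Type*} [Fintype I] (w p q : I → ℝ)
    (hp : ∀ k, 0 ≤ p k) (hs : ∀ k, w k * p k = 0 ∨ 0 < q k) :
    ContinuousOn (fun t : ℝ => ∑ k, w k * p k * Real.log (t * p k + q k)) (Set.Ici 0) := by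
  apply continuousOn_finsetSum
  intro k _
  rcases hs k with h | h
  · simp only [h, zero_mul]; exact continuousOn_const
  · apply ContinuousOn.mul continuousOn_const
    apply ContinuousOn.log (by fun_prop)
    intro t ht
    have := mul_nonneg (Set.mem_Ici.1 ht) (hp k)
    positivity

lemma aux_logsum_deriv {I : Type*} [Fintype I] (w p q : I → ℝ)
    (hp : ∀ k, 0 ≤ p k) (hq : ∀ k, 0 ≤ q k) (t : ℝ) (ht : 0 < t) :
    HasDerivAt (fun t : ℝ => ∑ k, w k * p k * Real.log (t * p k + q k))
      (∑ k, w k * p k ^ 2 / (t * p k + q k)) t := by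
  apply HasDerivAt.fun_sum
  intro k _
  rcases (hp k).eq_or_lt with h0 | hpos
  · simp [← h0, hasDerivAt_const]
  · have h1 : HasDerivAt (fun t : ℝ => t * p k + q k) (p k) t := by
      simpa using ((hasDerivAt_id t).mul_const (p k)).add_const (q k)
    have h2 : t * p k + q k ≠ 0 := by
      have := mul_pos ht hpos
      have := hq k
      positivity
    refine ((h1.log h2).const_mul (w k * p k)).congr_deriv ?_
    rw [pow_two, mul_div_assoc, mul_div_assoc, mul_assoc]

lemma aux_scalar_mono {I J : Type*} [Fintype I] [Fintype J]
    (w p q : I → ℝ) (w' p' q' : J → ℝ)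
    (hp : ∀ k, 0 ≤ p k) (hq : ∀ k, 0 ≤ q k) (hs : ∀ k, w k * p k = 0 ∨ 0 < q k)
    (h1 : ∑ k, w k * p k = 1)
    (hp' : ∀ k, 0 ≤ p' k) (hq' : ∀ k, 0 ≤ q' k) (hs' : ∀ k, w' k * p' k = 0 ∨ 0 < q' k)
    (h1' : ∑ k, w' k * p' k = 1)
    (hle : ∀ t : ℝ, 0 < t → ∑ k, w' k * p' k ^ 2 / (t * p' k + q' k)
      ≤ ∑ k, w k * p k ^ 2 / (t * p k + q k)) :
    ∑ k, w' k * p' k * Real.log (p' k) - ∑ k, w' k * p' k * Real.log (q' k)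
      ≤ ∑ k, w k * p k * Real.log (p k) - ∑ k, w k * p k * Real.log (q k) := by
  set G : ℝ → ℝ := fun t => (∑ k, w k * p k * Real.log (t * p k + q k))
    - ∑ k, w' k * p' k * Real.log (t * p' k + q' k) with hG
  have hd : ∀ t : ℝ, 0 < t → HasDerivAt G ((∑ k, w k * p k ^ 2 / (t * p k + q k))
      - ∑ k, w' k * p' k ^ 2 / (t * p' k + q' k)) t := fun t ht =>
    (aux_logsum_deriv w p q hp hq t ht).sub (aux_logsum_deriv w' p' q' hp' hq' t ht)
  have hm : MonotoneOn G (Set.Ici 0) := by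
    apply monotoneOn_of_deriv_nonneg (convex_Ici 0)
    · exact (aux_logsum_cont w p q hp hs).sub (aux_logsum_cont w' p' q' hp' hs')
    · intro t ht
      rw [interior_Ici] at ht
      exact (hd t ht).differentiableAt.differentiableWithinAt
    · intro t ht
      rw [interior_Ici] at ht
      rw [(hd t ht).deriv]
      exact sub_nonneg.2 (hle t ht)
  have hlim : Filter.Tendsto G Filter.atTop (nhds ((∑ k, w k * p k * Real.log (p k))
      - ∑ k, w' k * p' k * Real.log (p' k))) := by
    have := (aux_logsum_tendsto w p q hp h1).sub (aux_logsum_tendsto w' p' q' hp' h1')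
    refine this.congr ?_
    intro t
    simp only [hG]
    ring
  have h0 : G 0 ≤ (∑ k, w k * p k * Real.log (p k)) - ∑ k, w' k * p' k * Real.log (p' k) := by
    apply ge_of_tendsto hlim
    filter_upwards [Filter.eventually_ge_atTop 0] with t ht
    exact hm (Set.mem_Ici.2 le_rfl) (Set.mem_Ici.2 ht) ht
  simp only [hG, zero_mul, zero_add] at h0
  linarith

/-! ### Entropy via the characteristic polynomial -/

/-- `M = W diag(p) Wᴴ` with `W` unitary. -/
def AuxDiag {n : Type*} [Fintype n] [DecidableEq n] (M W : Matrix n n ℂ) (p : n → ℝ) : Prop :=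
  Wᴴ * W = 1 ∧ W * Wᴴ = 1 ∧ M = W * diagonal (fun i => (p i : ℂ)) * Wᴴ

lemma auxDiag_exists {n : Type*} [Fintype n] [DecidableEq n] {M : Matrix n n ℂ}
    (h : M.IsHermitian) :
    AuxDiag M (h.eigenvectorUnitary : Matrix n n ℂ) h.eigenvalues := by
  refine ⟨?_, ?_, ?_⟩
  · exact Unitary.coe_star_mul_self h.eigenvectorUnitary
  · exact Unitary.coe_mul_star_self h.eigenvectorUnitary
  · exact h.spectral_theorem

lemma aux_entropy_roots {n : Type*} [Fintype n] [DecidableEq n] {M : Matrix n n ℂ}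
    (h : M.IsHermitian) :
    vnEntropy M = (M.charpoly.roots.map (fun z : ℂ => Real.negMulLog z.re)).sum := by
  rw [vnEntropy, dif_pos h, h.roots_charpoly_eq_eigenvalues, Multiset.map_map]
  rfl

lemma auxDiag_entropy {n : Type*} [Fintype n] [DecidableEq n] {M W : Matrix n n ℂ} {p : n → ℝ}
    (h : AuxDiag M W p) : vnEntropy M = ∑ i, Real.negMulLog (p i) := by
  obtain ⟨h1, h2, h3⟩ := h
  have hM : M.IsHermitian := by
    rw [h3]
    apply isHermitian_mul_mul_conjTranspose
    rw [isHermitian_diagonal_iff]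
    intro i
    exact Complex.conj_ofReal _
  rw [aux_entropy_roots hM]
  have : M.charpoly = (diagonal (fun i => (p i : ℂ))).charpoly := by
    rw [h3, charpoly_mul_comm, ← mul_assoc, h1, one_mul]
  rw [this, charpoly_diagonal, Polynomial.roots_prod]
  · simp
  · simp [Finset.prod_ne_zero_iff, Polynomial.X_sub_C_ne_zero]

lemma aux_entropy_submatrix {n m : Type*} [Fintype n] [DecidableEq n] [Fintype m] [DecidableEq m]
    {M : Matrix n n ℂ} (h : M.IsHermitian) (e : m ≃ n) :
    vnEntropy (M.submatrix e e) = vnEntropy M := by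
  rw [aux_entropy_roots h, aux_entropy_roots (h.submatrix e)]
  have := charpoly_reindex e.symm M
  rw [reindex_apply, Equiv.symm_symm] at this
  rw [this]

lemma aux_entropy_transpose {n : Type*} [Fintype n] [DecidableEq n]
    {M : Matrix n n ℂ} (h : M.IsHermitian) :
    vnEntropy Mᵀ = vnEntropy M := by
  rw [aux_entropy_roots h, aux_entropy_roots h.transpose, charpoly_transpose]

lemma aux_entropy_gram {n m : Type*} [Fintype n] [DecidableEq n] [Fintype m] [DecidableEq m]
    (K : Matrix n m ℂ) : vnEntropy (K * Kᴴ) = vnEntropy (Kᴴ * K) := by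
  rw [aux_entropy_roots (isHermitian_mul_conjTranspose_self K),
    aux_entropy_roots (isHermitian_conjTranspose_mul_self K)]
  have h := charpoly_mul_comm' K Kᴴ
  have h2 := congrArg (fun P : Polynomial ℂ =>
    (P.roots.map (fun z : ℂ => Real.negMulLog z.re)).sum) h
  have h3 : ∀ (k : ℕ) (P : Polynomial ℂ), P ≠ 0 →
      (((Polynomial.X ^ k * P).roots).map (fun z : ℂ => Real.negMulLog z.re)).sum
        = (P.roots.map (fun z : ℂ => Real.negMulLog z.re)).sum := by
    intro k P hP
    rw [Polynomial.roots_mul (mul_ne_zero (pow_ne_zero _ Polynomial.X_ne_zero) hP)]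
    simp [Multiset.map_nsmul, Multiset.sum_nsmul]
  rwa [h3 _ _ (charpoly_monic _).ne_zero, h3 _ _ (charpoly_monic _).ne_zero] at h2

lemma auxDiag_kronecker {n m : Type*} [Fintype n] [DecidableEq n] [Fintype m] [DecidableEq m]
    {M W : Matrix n n ℂ} {p : n → ℝ} {N V : Matrix m m ℂ} {q : m → ℝ}
    (h : AuxDiag M W p) (h' : AuxDiag N V q) :
    AuxDiag (kroneckerMap (· * ·) M N) (kroneckerMap (· * ·) W V) (fun k => p k.1 * q k.2) := by
  obtain ⟨h1, h2, h3⟩ := h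
  obtain ⟨h1', h2', h3'⟩ := h'
  refine ⟨?_, ?_, ?_⟩
  · rw [conjTranspose_kronecker, ← mul_kronecker_mul, h1, h1', one_kronecker_one]
  · rw [conjTranspose_kronecker, ← mul_kronecker_mul, h2, h2', one_kronecker_one]
  · rw [h3, h3', mul_kronecker_mul, mul_kronecker_mul, conjTranspose_kronecker,
      diagonal_kronecker_diagonal]
    simp

lemma auxDiag_trace {n : Type*} [Fintype n] [DecidableEq n] {M W : Matrix n n ℂ} {p : n → ℝ}
    (h : AuxDiag M W p) : M.trace = ((∑ i, p i : ℝ) : ℂ) := by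
  obtain ⟨h1, h2, h3⟩ := h
  rw [h3, trace_mul_comm, ← mul_assoc, h1, one_mul, trace_diagonal]
  simp

lemma aux_entropy_kronecker {n m : Type*} [Fintype n] [DecidableEq n] [Fintype m] [DecidableEq m]
    {M : Matrix n n ℂ} {N : Matrix m m ℂ} (hM : M.IsHermitian) (hN : N.IsHermitian)
    (tM : M.trace = 1) (tN : N.trace = 1) :
    vnEntropy (kroneckerMap (· * ·) M N) = vnEntropy M + vnEntropy N := by
  have dM := auxDiag_exists hM
  have dN := auxDiag_exists hN
  have sM : ∑ i, hM.eigenvalues i = 1 := by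
    have := auxDiag_trace dM
    rw [tM] at this
    exact_mod_cast this.symm
  have sN : ∑ i, hN.eigenvalues i = 1 := by
    have := auxDiag_trace dN
    rw [tN] at this
    exact_mod_cast this.symm
  rw [auxDiag_entropy (auxDiag_kronecker dM dN), auxDiag_entropy dM, auxDiag_entropy dN]
  simp only [Real.negMulLog_mul, Finset.sum_add_distrib, Fintype.sum_prod_type]
  simp only [← Finset.sum_mul, ← Finset.mul_sum, sM, sN, one_mul]

/-! ### Variational formula -/

/-- Variational functional. -/
noncomputable def auxJ {n : Type*} [Fintype n] (t : ℝ) (ρ σ X : Matrix n n ℂ) : ℝ :=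
  2 * (Xᴴ * ρ).trace.re - t * (Xᴴ * X * ρ).trace.re - (X * Xᴴ * σ).trace.re

lemma auxJ_eq {n : Type*} [Fintype n] [DecidableEq n] {ρ W σ V : Matrix n n ℂ} {p q : n → ℝ}
    (hρ : AuxDiag ρ W p) (hσ : AuxDiag σ V q) (t : ℝ) (Y : Matrix n n ℂ) :
    auxJ t ρ σ (V * Y * Wᴴ) = ∑ i, ∑ j,
      (2 * (star (Y j i) * (Vᴴ * W) j i).re * p i - (t * p i + q j) * Complex.normSq (Y j i)) := by
  obtain ⟨h1, h2, h3⟩ := hρ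
  obtain ⟨h1', h2', h3'⟩ := hσ
  have e1 : ((V * Y * Wᴴ)ᴴ * ρ).trace
      = (Yᴴ * (Vᴴ * W) * diagonal (fun i => (p i : ℂ))).trace := by
    rw [h3]
    simp only [conjTranspose_mul, conjTranspose_conjTranspose]
    rw [← mul_assoc, trace_mul_comm]
    simp only [← mul_assoc, h1, one_mul]
  have e2 : ((V * Y * Wᴴ)ᴴ * (V * Y * Wᴴ) * ρ).trace
      = (Yᴴ * Y * diagonal (fun i => (p i : ℂ))).trace := by
    rw [h3]
    simp only [conjTranspose_mul, conjTranspose_conjTranspose]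
    rw [← mul_assoc, trace_mul_comm]
    have : Wᴴ * (W * (Yᴴ * Vᴴ) * (V * Y * Wᴴ) * (W * diagonal fun i => (p i : ℂ)))
      = (Wᴴ * W) * Yᴴ * (Vᴴ * V) * Y * (Wᴴ * W) * diagonal (fun i => (p i : ℂ)) := by
        simp only [mul_assoc]
    rw [this, h1, h1']
    simp
  have e3 : ((V * Y * Wᴴ) * (V * Y * Wᴴ)ᴴ * σ).trace
      = (Y * Yᴴ * diagonal (fun i => (q i : ℂ))).trace := by
    rw [h3']
    simp only [conjTranspose_mul, conjTranspose_conjTranspose]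
    rw [← mul_assoc, trace_mul_comm]
    have : Vᴴ * (V * Y * Wᴴ * (W * (Yᴴ * Vᴴ)) * (V * diagonal fun i => (q i : ℂ)))
      = (Vᴴ * V) * Y * (Wᴴ * W) * Yᴴ * (Vᴴ * V) * diagonal (fun i => (q i : ℂ)) := by
        simp only [mul_assoc]
    rw [this, h1, h1']
    simp
  rw [auxJ, e1, e2, e3]
  simp only [trace, diag_apply, mul_diagonal]
  simp only [mul_apply (M := Yᴴ), mul_apply (M := Y), conjTranspose_apply, Complex.re_sum,
    Finset.sum_mul]
  simp only [Complex.re_mul_ofReal, Finset.mul_sum]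
  rw [Finset.sum_comm (f := fun x i => ((Y x i * star (Y x i)).re * q x))]
  simp only [← Finset.sum_sub_distrib]
  refine Finset.sum_congr rfl fun i _ => Finset.sum_congr rfl fun j _ => ?_
  have e4 : (star (Y j i) * Y j i).re = Complex.normSq (Y j i) := by
    simp [Complex.normSq_apply]
  rw [mul_comm (Y j i) (star (Y j i)), e4]
  ring

/-- The resolvent sum. -/
noncomputable def auxQ {n : Type*} [Fintype n] (W V : Matrix n n ℂ) (p q : n → ℝ) (t : ℝ) : ℝ :=
  ∑ k : n × n, Complex.normSq ((Vᴴ * W) k.2 k.1) * p k.1 ^ 2 / (t * p k.1 + q k.2)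

lemma auxJ_le {n : Type*} [Fintype n] [DecidableEq n] {ρ W σ V : Matrix n n ℂ} {p q : n → ℝ}
    (hρ : AuxDiag ρ W p) (hσ : AuxDiag σ V q) (hp : ∀ i, 0 ≤ p i) (hq : ∀ i, 0 ≤ q i)
    (t : ℝ) (ht : 0 < t) (X : Matrix n n ℂ) : auxJ t ρ σ X ≤ auxQ W V p q t := by
  have hX : X = V * (Vᴴ * X * W) * Wᴴ := by
    have : V * (Vᴴ * X * W) * Wᴴ = (V * Vᴴ) * X * (W * Wᴴ) := by simp only [mul_assoc]
    rw [this, hρ.2.1, hσ.2.1]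
    simp
  rw [hX, auxJ_eq hρ hσ, auxQ, Fintype.sum_prod_type]
  refine Finset.sum_le_sum fun i _ => Finset.sum_le_sum fun j _ => ?_
  generalize (Vᴴ * X * W) j i = y
  generalize (Vᴴ * W) j i = u
  simp only
  have hpi := hp i
  have hqj := hq j
  rcases hpi.eq_or_lt with h0 | hpos
  · rw [← h0]
    simp only [mul_zero, zero_add, zero_sub]
    have := Complex.normSq_nonneg y
    have : 0 ≤ q j * Complex.normSq y := mul_nonneg hqj this
    simp; linarith
  · have hd : 0 < t * p i + q j := by positivity
    rw [le_div_iff₀ hd]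
    generalize t * p i + q j = d at hd
    have h4 : (star y * u).re = y.re * u.re + y.im * u.im := by
      simp
    rw [h4, Complex.normSq_apply, Complex.normSq_apply]
    nlinarith [sq_nonneg (p i * u.re - d * y.re), sq_nonneg (p i * u.im - d * y.im)]

lemma auxJ_attained {n : Type*} [Fintype n] [DecidableEq n] {ρ W σ V : Matrix n n ℂ} {p q : n → ℝ}
    (hρ : AuxDiag ρ W p) (hσ : AuxDiag σ V q) (hp : ∀ i, 0 ≤ p i) (hq : ∀ i, 0 ≤ q i)
    (t : ℝ) (ht : 0 < t) : ∃ X : Matrix n n ℂ, auxJ t ρ σ X = auxQ W V p q t := by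
  refine ⟨V * (Matrix.of fun j i => ((p i / (t * p i + q j) : ℝ) : ℂ) * (Vᴴ * W) j i) * Wᴴ, ?_⟩
  rw [auxJ_eq hρ hσ, auxQ, Fintype.sum_prod_type]
  refine Finset.sum_congr rfl fun i _ => Finset.sum_congr rfl fun j _ => ?_
  simp only [of_apply]
  generalize (Vᴴ * W) j i = u
  have hpi := hp i
  have hqj := hq j
  rcases hpi.eq_or_lt with h0 | hpos
  · rw [← h0]; simp
  · have hd : 0 < t * p i + q j := by positivity
    generalize t * p i + q j = d at hd
    have h4 : (star (((p i / d : ℝ) : ℂ) * u) * u).re = (p i / d) * Complex.normSq u := by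
      simp only [star_mul', RCLike.star_def, Complex.conj_ofReal, mul_assoc, Complex.re_ofReal_mul]
      simp [Complex.normSq_apply]
    rw [h4, Complex.normSq_mul, Complex.normSq_ofReal]
    field_simp
    ring

lemma auxQ_mono {n m : Type*} [Fintype n] [DecidableEq n] [Fintype m] [DecidableEq m]
    {ρ W σ V : Matrix n n ℂ} {p q : n → ℝ} {ρ' W' σ' V' : Matrix m m ℂ} {p' q' : m → ℝ}
    (hρ : AuxDiag ρ W p) (hσ : AuxDiag σ V q) (hp : ∀ i, 0 ≤ p i) (hq : ∀ i, 0 ≤ q i)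
    (hρ' : AuxDiag ρ' W' p') (hσ' : AuxDiag σ' V' q') (hp' : ∀ i, 0 ≤ p' i) (hq' : ∀ i, 0 ≤ q' i)
    (Φ : Matrix m m ℂ → Matrix n n ℂ) (hstar : ∀ X, Φ Xᴴ = (Φ X)ᴴ)
    (hmul : ∀ X Y, Φ (X * Y) = Φ X * Φ Y)
    (htρ : ∀ X, (Φ X * ρ).trace = (X * ρ').trace)
    (htσ : ∀ X, (Φ X * σ).trace = (X * σ').trace) (t : ℝ) (ht : 0 < t) :
    auxQ W' V' p' q' t ≤ auxQ W V p q t := by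
  obtain ⟨X, hX⟩ := auxJ_attained hρ' hσ' hp' hq' t ht
  rw [← hX]
  refine le_trans (le_of_eq ?_) (auxJ_le hρ hσ hp hq t ht (Φ X))
  simp only [auxJ, ← hstar, ← hmul, htρ, htσ]

lemma aux_w_col {n : Type*} [Fintype n] [DecidableEq n] {W V : Matrix n n ℂ}
    (hW : Wᴴ * W = 1) (hV : V * Vᴴ = 1) (i : n) :
    ∑ j, Complex.normSq ((Vᴴ * W) j i) = 1 := by
  have h : ((Vᴴ * W)ᴴ * (Vᴴ * W)) i i = 1 := by
    have : (Vᴴ * W)ᴴ * (Vᴴ * W) = Wᴴ * (V * Vᴴ) * W := by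
      simp only [conjTranspose_mul, conjTranspose_conjTranspose, mul_assoc]
    rw [this, hV, mul_one, hW, one_apply_eq]
  rw [mul_apply] at h
  have h2 : ((∑ j, Complex.normSq ((Vᴴ * W) j i) : ℝ) : ℂ) = 1 := by
    rw [← h]
    push_cast
    refine Finset.sum_congr rfl fun j _ => ?_
    rw [Complex.normSq_eq_conj_mul_self]
    rfl
  exact_mod_cast h2

lemma aux_w_row {n : Type*} [Fintype n] [DecidableEq n] {ρ W V : Matrix n n ℂ} {p : n → ℝ}
    (hρ : AuxDiag ρ W p) (j : n) :
    ((∑ i, Complex.normSq ((Vᴴ * W) j i) * p i : ℝ) : ℂ) = (Vᴴ * ρ * V) j j := by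
  have h : Vᴴ * ρ * V = (Vᴴ * W) * diagonal (fun i => (p i : ℂ)) * (Vᴴ * W)ᴴ := by
    rw [hρ.2.2]
    simp only [conjTranspose_mul, conjTranspose_conjTranspose, mul_assoc]
  rw [h, mul_apply]
  push_cast
  refine Finset.sum_congr rfl fun i _ => ?_
  rw [mul_diagonal, conjTranspose_apply, ← Complex.mul_conj]
  simp only [RCLike.star_def]
  ring

/-- Partial trace over the first factor. -/
def auxTr {α κ : Type*} [Fintype α] (N : Matrix (α × κ) (α × κ) ℂ) : Matrix κ κ ℂ :=
  fun x y => ∑ a, N (a, x) (a, y)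

lemma auxTr_mul {α κ : Type*} [Fintype α] [DecidableEq α] [Fintype κ]
    (N : Matrix (α × κ) (α × κ) ℂ) (B : Matrix κ κ ℂ) :
    auxTr (N * kroneckerMap (· * ·) (1 : Matrix α α ℂ) B) = auxTr N * B := by
  ext x y
  simp only [auxTr, mul_apply, Fintype.sum_prod_type, kroneckerMap_apply, one_apply,
    Finset.sum_mul]
  rw [Finset.sum_comm]
  rw [Finset.sum_comm (γ := κ)]
  refine Finset.sum_congr rfl fun a _ => ?_
  rw [Finset.sum_comm]
  refine Finset.sum_congr rfl fun k _ => ?_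
  simp

lemma auxTr_mul' {α κ : Type*} [Fintype α] [DecidableEq α] [Fintype κ]
    (N : Matrix (α × κ) (α × κ) ℂ) (B : Matrix κ κ ℂ) :
    auxTr (kroneckerMap (· * ·) (1 : Matrix α α ℂ) B * N) = B * auxTr N := by
  ext x y
  simp only [auxTr, mul_apply, Fintype.sum_prod_type, kroneckerMap_apply, one_apply,
    Finset.mul_sum]
  rw [Finset.sum_comm]
  rw [Finset.sum_comm (γ := κ)]
  refine Finset.sum_congr rfl fun a _ => ?_
  rw [Finset.sum_comm]
  refine Finset.sum_congr rfl fun k _ => ?_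
  simp

lemma auxTr_posSemidef {α κ : Type*} [Fintype α] [Fintype κ]
    {N : Matrix (α × κ) (α × κ) ℂ} (hN : N.PosSemidef) : (auxTr N).PosSemidef := by
  have : auxTr N = ∑ a, N.submatrix (fun x => (a, x)) (fun x => (a, x)) := by
    ext x y
    simp [auxTr, Matrix.sum_apply]
  rw [this]
  exact posSemidef_sum _ fun a _ => hN.submatrix _

lemma auxTr_facts {α κ : Type*} [Fintype α] [DecidableEq α] [Fintype κ] [DecidableEq κ]
    {N W : Matrix (α × κ) (α × κ) ℂ} {p : α × κ → ℝ} {V : Matrix κ κ ℂ} {q : κ → ℝ}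
    (hN : AuxDiag N W p) (hp : ∀ i, 0 ≤ p i) (hq : ∀ i, 0 ≤ q i)
    (hV : AuxDiag (auxTr N) V q) (V₁ : Matrix (α × κ) (α × κ) ℂ)
    (hV₁ : V₁ = kroneckerMap (· * ·) (1 : Matrix α α ℂ) V) :
    (∑ k : (α × κ) × (α × κ), Complex.normSq ((V₁ᴴ * W) k.2 k.1) * p k.1 = ∑ i, p i) ∧
    (∑ k : (α × κ) × (α × κ), Complex.normSq ((V₁ᴴ * W) k.2 k.1) * p k.1 * Real.log (p k.1)
      = - vnEntropy N) ∧
    (∑ k : (α × κ) × (α × κ), Complex.normSq ((V₁ᴴ * W) k.2 k.1) * p k.1 * Real.log (q k.2.2)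
      = - vnEntropy (auxTr N)) ∧
    (∀ k : (α × κ) × (α × κ), Complex.normSq ((V₁ᴴ * W) k.2 k.1) * p k.1 = 0 ∨ 0 < q k.2.2) := by
  have hVV : V₁ * V₁ᴴ = 1 := by
    rw [hV₁, conjTranspose_kronecker, ← mul_kronecker_mul, hV.2.1]
    simp
  have key : ∀ x : κ, ∑ a : α, ∑ i, Complex.normSq ((V₁ᴴ * W) (a, x) i) * p i = q x := by
    intro x
    have h1 : auxTr (V₁ᴴ * N * V₁) = diagonal (fun i => (q i : ℂ)) := by
      rw [hV₁, auxTr_mul, conjTranspose_kronecker, conjTranspose_one, auxTr_mul', hV.2.2]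
      have : Vᴴ * (V * diagonal (fun i => (q i : ℂ)) * Vᴴ) * V
        = (Vᴴ * V) * diagonal (fun i => (q i : ℂ)) * (Vᴴ * V) := by simp only [mul_assoc]
      rw [this, hV.1, one_mul, mul_one]
    have h2 : auxTr (V₁ᴴ * N * V₁) x x = (q x : ℂ) := by rw [h1, diagonal_apply_eq]
    rw [auxTr] at h2
    simp only [← aux_w_row hN] at h2
    exact_mod_cast h2
  refine ⟨?_, ?_, ?_, ?_⟩
  · rw [Fintype.sum_prod_type]
    refine Finset.sum_congr rfl fun i _ => ?_
    simp only
    rw [← Finset.sum_mul, aux_w_col hN.1 hVV, one_mul]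
  · rw [auxDiag_entropy hN, Fintype.sum_prod_type, ← Finset.sum_neg_distrib]
    refine Finset.sum_congr rfl fun i _ => ?_
    simp only
    rw [← Finset.sum_mul, ← Finset.sum_mul, aux_w_col hN.1 hVV, one_mul, Real.negMulLog]
    ring
  · rw [auxDiag_entropy hV, Fintype.sum_prod_type, Finset.sum_comm, Fintype.sum_prod_type,
      Finset.sum_comm, ← Finset.sum_neg_distrib]
    refine Finset.sum_congr rfl fun x _ => ?_
    simp only
    simp only [← Finset.sum_mul]
    rw [key x, Real.negMulLog]
    ring
  · rintro ⟨i, a, x⟩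
    simp only
    rcases (hq x).eq_or_lt with h0 | h0
    · left
      have h1 := key x
      rw [← h0] at h1
      have h2 : ∀ a : α, ∀ i, 0 ≤ Complex.normSq ((V₁ᴴ * W) (a, x) i) * p i := fun a i =>
        mul_nonneg (Complex.normSq_nonneg _) (hp i)
      rw [Finset.sum_eq_zero_iff_of_nonneg
        (fun a _ => Finset.sum_nonneg fun i _ => h2 a i)] at h1
      have h3 := h1 a (Finset.mem_univ _)
      rw [Finset.sum_eq_zero_iff_of_nonneg (fun i _ => h2 a i)] at h3
      exact h3 i (Finset.mem_univ _)
    · exact Or.inr h0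

/-- Partial trace over the last of three factors. -/
def auxAB {α β γ : Type*} [Fintype γ] (M : Matrix (α × β × γ) (α × β × γ) ℂ) :
    Matrix (α × β) (α × β) ℂ :=
  fun x y => ∑ c, M (x.1, x.2, c) (y.1, y.2, c)

lemma auxAB_posSemidef {α β γ : Type*} [Fintype α] [Fintype β] [Fintype γ]
    {M : Matrix (α × β × γ) (α × β × γ) ℂ} (hM : M.PosSemidef) : (auxAB M).PosSemidef := by
  have : auxAB M = ∑ c, M.submatrix (fun x : α × β => (x.1, x.2, c))
      (fun x : α × β => (x.1, x.2, c)) := by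
    ext x y
    simp [auxAB, Matrix.sum_apply]
  rw [this]
  exact posSemidef_sum _ fun a _ => hM.submatrix _

/-- Ampliation by the identity on the last factor. -/
def auxPhi {α β γ : Type*} [DecidableEq γ] (X : Matrix (α × β) (α × β) ℂ) :
    Matrix (α × β × γ) (α × β × γ) ℂ :=
  (kroneckerMap (· * ·) X (1 : Matrix γ γ ℂ)).submatrix (Equiv.prodAssoc α β γ).symm
    (Equiv.prodAssoc α β γ).symm

lemma auxPhi_trace {α β γ : Type*} [Fintype α] [Fintype β] [Fintype γ] [DecidableEq γ]
    (X : Matrix (α × β) (α × β) ℂ) (M : Matrix (α × β × γ) (α × β × γ) ℂ) :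
    (auxPhi X * M).trace = (X * auxAB M).trace := by
  simp only [trace, diag_apply, mul_apply, Fintype.sum_prod_type, auxPhi, auxAB, submatrix_apply,
    Equiv.prodAssoc_symm_apply, kroneckerMap_apply, one_apply, Finset.mul_sum]
  refine Finset.sum_congr rfl fun a _ => Finset.sum_congr rfl fun b _ => ?_
  rw [Finset.sum_comm]
  refine Finset.sum_congr rfl fun a' _ => ?_
  rw [Finset.sum_comm]
  refine Finset.sum_congr rfl fun b' _ => ?_
  refine Finset.sum_congr rfl fun c _ => ?_
  simp

lemma auxDiag_psd {n : Type*} [Fintype n] [DecidableEq n] {M : Matrix n n ℂ}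
    (h : M.PosSemidef) : ∃ W p, AuxDiag M W p ∧ ∀ i, 0 ≤ p i :=
  ⟨_, _, auxDiag_exists h.1, h.eigenvalues_nonneg⟩

lemma auxDiag_sum {n : Type*} [Fintype n] [DecidableEq n] {M W : Matrix n n ℂ} {p : n → ℝ}
    (h : AuxDiag M W p) (hM : M.trace = 1) : ∑ i, p i = 1 := by
  have := auxDiag_trace h
  rw [hM] at this
  exact_mod_cast this.symm

lemma aux_ssa {α β γ : Type*} [Fintype α] [Fintype β] [Fintype γ]
    [DecidableEq α] [DecidableEq β] [DecidableEq γ]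
    {M : Matrix (α × β × γ) (α × β × γ) ℂ} (hM : M.PosSemidef) (tM : M.trace = 1) :
    vnEntropy M + vnEntropy (auxTr (auxAB M)) ≤ vnEntropy (auxAB M) + vnEntropy (auxTr M) := by
  have hAB := auxAB_posSemidef hM
  have hBC := auxTr_posSemidef hM
  have hB := auxTr_posSemidef hAB
  have tAB : (auxAB M).trace = 1 := by
    rw [← tM]
    simp [trace, auxAB, Fintype.sum_prod_type]
  obtain ⟨W, p, dM, hp⟩ := auxDiag_psd hM
  obtain ⟨W', p', dAB, hp'⟩ := auxDiag_psd hAB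
  obtain ⟨V, q, dBC, hq⟩ := auxDiag_psd hBC
  obtain ⟨V', q', dB, hq'⟩ := auxDiag_psd hB
  have d1 : AuxDiag (1 : Matrix α α ℂ) 1 (fun _ => 1) := ⟨by simp, by simp, by simp⟩
  have k1 := auxDiag_kronecker d1 dBC
  have k2 := auxDiag_kronecker d1 dB
  simp only [one_mul] at k1 k2
  have f1 := auxTr_facts dM hp hq dBC _ rfl
  have f2 := auxTr_facts dAB hp' hq' dB _ rfl
  have hσ : auxAB (kroneckerMap (· * ·) (1 : Matrix α α ℂ) (auxTr M))
      = kroneckerMap (· * ·) (1 : Matrix α α ℂ) (auxTr (auxAB M)) := by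
    ext x y
    simp only [auxAB, auxTr, kroneckerMap_apply]
    rw [Finset.sum_comm, Finset.mul_sum]
  generalize kroneckerMap (· * ·) (1 : Matrix α α ℂ) V = V₁ at *
  generalize kroneckerMap (· * ·) (1 : Matrix α α ℂ) V' = V₂ at *
  have hle : ∀ t : ℝ, 0 < t → auxQ W' V₂ p' (fun k => q' k.2) t ≤ auxQ W V₁ p (fun k => q k.2) t :=
    fun t ht => auxQ_mono dM k1 hp (fun k => hq k.2) dAB k2 hp' (fun k => hq' k.2)
      auxPhi
      (fun X => by simp [auxPhi, conjTranspose_submatrix, conjTranspose_kronecker])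
      (fun X Y => by
        rw [auxPhi, auxPhi, auxPhi, submatrix_mul_equiv, ← mul_kronecker_mul, one_mul])
      (fun X => auxPhi_trace X M)
      (fun X => by rw [auxPhi_trace, hσ]) t ht
  unfold auxQ at hle
  have hmain := aux_scalar_mono
    (fun k : (α × β × γ) × (α × β × γ) => Complex.normSq ((V₁ᴴ * W) k.2 k.1))
    (fun k => p k.1) (fun k => q k.2.2)
    (fun k : (α × β) × (α × β) => Complex.normSq ((V₂ᴴ * W') k.2 k.1))
    (fun k => p' k.1) (fun k => q' k.2.2)
    (fun k => hp k.1) (fun k => hq k.2.2) f1.2.2.2 (f1.1.trans (auxDiag_sum dM tM))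
    (fun k => hp' k.1) (fun k => hq' k.2.2) f2.2.2.2 (f2.1.trans (auxDiag_sum dAB tAB)) hle
  rw [f1.2.1, f1.2.2.1, f2.2.1, f2.2.2.1] at hmain
  linarith

lemma aux_subadd {α γ : Type*} [Fintype α] [Fintype γ] [DecidableEq α] [DecidableEq γ]
    {N : Matrix (α × γ) (α × γ) ℂ} (hN : N.PosSemidef) (tN : N.trace = 1) :
    vnEntropy N ≤ vnEntropy (fun x y => ∑ c, N (x, c) (y, c) : Matrix α α ℂ)
      + vnEntropy (auxTr N) := by
  let e : α × Unit × γ ≃ α × γ := Equiv.prodCongr (Equiv.refl α) (Equiv.punitProd γ)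
  have hM : (N.submatrix e e).PosSemidef := hN.submatrix e
  have tM : (N.submatrix e e).trace = 1 := by
    rw [← tN]
    simp [trace, e, Fintype.sum_prod_type]
  have h := aux_ssa hM tM
  rw [aux_entropy_submatrix hN.1] at h
  have hA : vnEntropy (auxAB (N.submatrix e e))
      = vnEntropy (fun x y => ∑ c, N (x, c) (y, c) : Matrix α α ℂ) := by
    have h1 := aux_entropy_submatrix (auxAB_posSemidef hM).1 (Equiv.prodPUnit.{0} α).symm
    rw [← h1]
    rfl
  have hC : vnEntropy (auxTr (N.submatrix e e)) = vnEntropy (auxTr N) := by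
    rw [← aux_entropy_submatrix (auxTr_posSemidef hN).1 (Equiv.punitProd.{0} γ)]
    rfl
  have hB : vnEntropy (auxTr (auxAB (N.submatrix e e))) = 0 := by
    have : auxTr (auxAB (N.submatrix e e)) = 1 := by
      ext x y
      have h0 : (1 : Matrix Unit Unit ℂ) x y = N.trace := by rw [tN]; rfl
      rw [h0]
      simp [auxTr, auxAB, e, trace, Fintype.sum_prod_type]
    rw [this]
    have d1 : AuxDiag (1 : Matrix Unit Unit ℂ) 1 (fun _ => 1) := ⟨by simp, by simp, by simp⟩
    rw [auxDiag_entropy d1]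
    simp
  rw [hA, hC, hB] at h
  linarith

/-- **Theorem 2 of the paper.** For a pure density matrix `ρ` on `a1 × a2 × b1 × b2 × e1 × e2`
purifying a process matrix `W^{AB} = ρ^{a1 a2 b1 b2}` that (i) satisfies the normalization
constraint `ρ^{a1 a2 b2} = ρ^{a1 b2} ⊗ ρ^{a2}`, (ii) is symmetric in the parties `A` and `B`,
and whose environment subsystem `e1` satisfies (iii) `S(ρ^{b1}) ≤ S(ρ^{e1})` and
(iv) `S(ρ^{a1 b2}) ≥ S(ρ^{b1 e1})`, the coherent information toward `B` is nonpositive: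
`S(ρ^{b1 b2}) − S(ρ^{a1 a2 b1 b2}) ≤ 0`. -/
theorem coherent_info_nonpos_of_indefinite_causal_structure
    {ι1 ι2 ι5 ι6 : Type*} [Fintype ι1] [Fintype ι2] [Fintype ι5] [Fintype ι6]
    [DecidableEq ι1] [DecidableEq ι2] [DecidableEq ι5] [DecidableEq ι6]
    [Nonempty ι1] [Nonempty ι2] [Nonempty ι5] [Nonempty ι6]
    (ρ : Matrix (ι1 × ι2 × ι1 × ι2 × ι5 × ι6) (ι1 × ι2 × ι1 × ι2 × ι5 × ι6) ℂ)
    (hpure : IsPureDensityMatrix ρ)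
    (hfact : ∀ (x1 y1 : ι1) (x2 y2 x4 y4 : ι2),
      redA1A2B2 ρ (x1, x2, x4) (y1, y2, y4)
        = redA1B2 ρ (x1, x4) (y1, y4) * redA2 ρ x2 y2)
    (hsymm : ∀ (x1 x3 x1' x3' : ι1) (x2 x4 x2' x4' : ι2),
      redA1A2B1B2 ρ (x1, x2, x3, x4) (x1', x2', x3', x4')
        = redA1A2B1B2 ρ (x3, x4, x1, x2) (x3', x4', x1', x2'))
    (hb1e1 : vnEntropy (redB1 ρ) ≤ vnEntropy (redE1 ρ))
    (ha1b2 : vnEntropy (redB1E1 ρ) ≤ vnEntropy (redA1B2 ρ)) :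
    vnEntropy (redB1B2 ρ) - vnEntropy (redA1A2B1B2 ρ) ≤ 0 := by
  obtain ⟨⟨hpsd, htr⟩, w, -, hw⟩ := hpure
  have hρ : ∀ x y, ρ x y = w x * star (w y) := fun x y => by rw [hw]; rfl
  have hherm : ∀ x y, star (ρ y x) = ρ x y := fun x y => hpsd.1.apply x y
  have htr' : ∑ x1, ∑ x2, ∑ x3, ∑ x4, ∑ x5, ∑ x6,
      ρ (x1, x2, x3, x4, x5, x6) (x1, x2, x3, x4, x5, x6) = 1 := by
    rw [← htr]
    simp only [trace, diag_apply, Fintype.sum_prod_type]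
  -- the complementary marginal on (b1, e1, e2)
  let M : Matrix (ι1 × ι5 × ι6) (ι1 × ι5 × ι6) ℂ := fun x y => ∑ a1, ∑ a2, ∑ b2,
    ρ (a1, a2, x.1, b2, x.2.1, x.2.2) (a1, a2, y.1, b2, y.2.1, y.2.2)
  let K₁ : Matrix (ι1 × ι2 × ι2) (ι1 × ι5 × ι6) ℂ := fun x y =>
    w (x.1, x.2.1, y.1, x.2.2, y.2.1, y.2.2)
  let K₂ : Matrix (ι1 × ι2 × ι1 × ι2) (ι5 × ι6) ℂ := fun x y =>
    w (x.1, x.2.1, x.2.2.1, x.2.2.2, y.1, y.2)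
  have eM : M = (K₁ᴴ * K₁)ᵀ := by
    ext x y
    simp only [transpose_apply, mul_apply, conjTranspose_apply, Fintype.sum_prod_type]
    simp only [M, K₁, hρ]
    refine Finset.sum_congr rfl fun a1 _ => Finset.sum_congr rfl fun a2 _ =>
      Finset.sum_congr rfl fun b2 _ => ?_
    ring
  have eA1A2B2 : redA1A2B2 ρ = K₁ * K₁ᴴ := by
    ext x y
    simp only [mul_apply, conjTranspose_apply, Fintype.sum_prod_type]
    simp only [redA1A2B2, K₁, hρ]
  have eW : redA1A2B1B2 ρ = K₂ * K₂ᴴ := by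
    ext x y
    simp only [mul_apply, conjTranspose_apply, Fintype.sum_prod_type]
    simp only [redA1A2B1B2, K₂, hρ]
  have eE : auxTr M = (K₂ᴴ * K₂)ᵀ := by
    ext x y
    simp only [transpose_apply, mul_apply, conjTranspose_apply, Fintype.sum_prod_type]
    simp only [auxTr, M, K₂, hρ]
    rw [Finset.sum_comm]
    refine Finset.sum_congr rfl fun a1 _ => ?_
    rw [Finset.sum_comm]
    refine Finset.sum_congr rfl fun a2 _ => Finset.sum_congr rfl fun b1 _ =>
      Finset.sum_congr rfl fun b2 _ => ?_
    ring
  have eB1E1 : auxAB M = redB1E1 ρ := by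
    ext x y
    simp only [auxAB, M, redB1E1]
    rw [Finset.sum_comm]
    refine Finset.sum_congr rfl fun a1 _ => ?_
    rw [Finset.sum_comm]
    refine Finset.sum_congr rfl fun a2 _ => ?_
    rw [Finset.sum_comm]
  have eE1 : auxTr (redB1E1 ρ) = redE1 ρ := by
    ext x y
    simp only [auxTr, redB1E1, redE1]
    rw [Finset.sum_comm]
    refine Finset.sum_congr rfl fun a1 _ => ?_
    rw [Finset.sum_comm]
  have pM : M.PosSemidef := by
    rw [eM]
    exact (posSemidef_conjTranspose_mul_self K₁).transpose
  have tM : M.trace = 1 := by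
    rw [eM, trace_transpose, trace_mul_comm, ← eA1A2B2, ← htr']
    simp only [trace, diag_apply, redA1A2B2, Fintype.sum_prod_type]
    refine Finset.sum_congr rfl fun a1 _ => Finset.sum_congr rfl fun a2 _ => ?_
    rw [Finset.sum_comm]
  have ssa := aux_ssa pM tM
  rw [eB1E1, eE1, eE] at ssa
  -- purity
  have S1 : vnEntropy M = vnEntropy (redA1A2B2 ρ) := by
    rw [eM, eA1A2B2, aux_entropy_transpose (isHermitian_conjTranspose_mul_self K₁),
      aux_entropy_gram]
  have S2 : vnEntropy (K₂ᴴ * K₂)ᵀ = vnEntropy (redA1A2B1B2 ρ) := by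
    rw [eW, aux_entropy_transpose (isHermitian_conjTranspose_mul_self K₂), aux_entropy_gram]
  -- factorization
  have hA1B2 : (redA1B2 ρ).IsHermitian := by
    ext x y
    simp only [conjTranspose_apply, redA1B2, star_sum, hherm]
  have hA2 : (redA2 ρ).IsHermitian := by
    ext x y
    simp only [conjTranspose_apply, redA2, star_sum, hherm]
  have tA1B2 : (redA1B2 ρ).trace = 1 := by
    rw [← htr']
    simp only [trace, diag_apply, redA1B2, Fintype.sum_prod_type]
    refine Finset.sum_congr rfl fun a1 _ => ?_
    rw [Finset.sum_comm]
    refine Finset.sum_congr rfl fun a2 _ => ?_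
    rw [Finset.sum_comm]
  have tA2 : (redA2 ρ).trace = 1 := by
    rw [← htr']
    simp only [trace, diag_apply, redA2]
    rw [Finset.sum_comm]
  have S3 : vnEntropy (redA1A2B2 ρ) = vnEntropy (redA1B2 ρ) + vnEntropy (redA2 ρ) := by
    rw [← aux_entropy_kronecker hA1B2 hA2 tA1B2 tA2]
    let e : ι1 × ι2 × ι2 ≃ (ι1 × ι2) × ι2 :=
      ⟨fun x => ((x.1, x.2.2), x.2.1), fun x => (x.1.1, x.2, x.1.2), fun _ => rfl, fun _ => rfl⟩
    have hk : (kroneckerMap (· * ·) (redA1B2 ρ) (redA2 ρ)).IsHermitian := by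
      rw [IsHermitian, conjTranspose_kronecker, hA1B2.eq, hA2.eq]
    rw [← aux_entropy_submatrix hk e]
    congr 1
    ext x y
    exact hfact _ _ _ _ _ _
  -- subadditivity
  have eB1B2 : redB1B2 ρ = auxTr ((redA1A2B1B2 ρ).submatrix (Equiv.prodAssoc ι1 ι2 (ι1 × ι2))
      (Equiv.prodAssoc ι1 ι2 (ι1 × ι2))) := by
    ext x y
    simp only [redB1B2, auxTr, redA1A2B1B2, submatrix_apply, Equiv.prodAssoc_apply,
      Fintype.sum_prod_type]
  have pB1B2 : (redB1B2 ρ).PosSemidef := by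
    rw [eB1B2]
    apply auxTr_posSemidef
    apply PosSemidef.submatrix
    rw [eW]
    exact posSemidef_self_mul_conjTranspose K₂
  have tB1B2 : (redB1B2 ρ).trace = 1 := by
    rw [eB1B2, ← htr']
    simp only [trace, diag_apply, auxTr]
    rw [Finset.sum_comm]
    simp only [redA1A2B1B2, submatrix_apply, Equiv.prodAssoc_apply, Fintype.sum_prod_type]
  have eB2 : auxTr (redB1B2 ρ) = redA2 ρ := by
    ext x y
    have h1 : auxTr (redB1B2 ρ) x y = ∑ b1, ∑ a1, ∑ a2,
        redA1A2B1B2 ρ (a1, a2, b1, x) (a1, a2, b1, y) := rfl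
    rw [h1]
    simp only [fun a1 a2 b1 => hsymm a1 b1 a1 b1 a2 x a2 y]
    rfl
  have eB1 : (fun x y => ∑ c, redB1B2 ρ (x, c) (y, c) : Matrix ι1 ι1 ℂ) = redB1 ρ := by
    ext x y
    simp only [redB1B2, redB1]
    rw [Finset.sum_comm]
    refine Finset.sum_congr rfl fun a1 _ => ?_
    rw [Finset.sum_comm]
  have sub := aux_subadd pB1B2 tB1B2
  rw [eB2, eB1] at sub
  rw [S1, S2, S3] at ssa
  linarith
end

section
/- Let ι_a, ι_b, ι_{e0}, ι_f be nonempty finite types with ι_b = ι_{e0}, and let ρ be a pure density matrix on the product type ι_a × ι_b × ι_{e0} × ι_f. Assume that the reduced density matrix on the factors (a, b) equals the reduced density matrix on the factors (a, e0), i.e. ρ^{a b} = ρ^{a e0} as matrices indexed by ι_a × ι_b. Then S(ρ^{b}) ≤ S(ρ^{a b}); equivalently, the coherent information I^{b}(ρ^{ab}) := S(ρ^{b}) − S(ρ^{ab}) is nonpositive. -/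
open Matrix ComplexOrder

section
/- Index types: positions are (a, b, e0, f), with `ι_b = ι_{e0} = ιb`. -/
variable {ιa ιb ιf : Type*} [Fintype ιa] [Fintype ιb] [Fintype ιf]

/-- Reduced density matrix on (a, b). -/
noncomputable def redAB (ρ : Matrix (ιa × ιb × ιb × ιf) (ιa × ιb × ιb × ιf) ℂ) :
    Matrix (ιa × ιb) (ιa × ιb) ℂ :=
  fun p q => ∑ x3 : ιb, ∑ x4 : ιf, ρ (p.1, p.2, x3, x4) (q.1, q.2, x3, x4)

/-- Reduced density matrix on (a, e0). -/
noncomputable def redAE0 (ρ : Matrix (ιa × ιb × ιb × ιf) (ιa × ιb × ιb × ιf) ℂ) :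
    Matrix (ιa × ιb) (ιa × ιb) ℂ :=
  fun p q => ∑ x2 : ιb, ∑ x4 : ιf, ρ (p.1, x2, p.2, x4) (q.1, x2, q.2, x4)

/-- Reduced density matrix on (b). -/
noncomputable def redB (ρ : Matrix (ιa × ιb × ιb × ιf) (ιa × ιb × ιb × ιf) ℂ) :
    Matrix ιb ιb ℂ :=
  fun p q => ∑ x1 : ιa, ∑ x3 : ιb, ∑ x4 : ιf, ρ (x1, p, x3, x4) (x1, q, x3, x4)

end


namespace SSA

set_option linter.unusedSectionVars false

/-- partial trace over the second factor -/
noncomputable def ptr {m k : Type*} [Fintype k] (M : Matrix (m × k) (m × k) ℂ) : Matrix m m ℂ :=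
  fun i j => ∑ x, M (i, x) (j, x)

/-- the quadratic functional -/
noncomputable def quad {n : Type*} [Fintype n] (ρ σ : Matrix n n ℂ) (t : ℝ) (X : Matrix n n ℂ) : ℝ :=
  2 * (Xᴴ * ρ).trace.re - (X * Xᴴ * σ).trace.re - t * (Xᴴ * X * ρ).trace.re

lemma trace_kron_ptr {m k : Type*} [Fintype m] [Fintype k] [DecidableEq k]
    (A : Matrix m m ℂ) (M : Matrix (m × k) (m × k) ℂ) :
    (Matrix.kroneckerMap (· * ·) A (1 : Matrix k k ℂ) * M).trace = (A * ptr M).trace := by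
  simp only [Matrix.trace, Matrix.diag, Matrix.mul_apply, Fintype.sum_prod_type, ptr,
    Matrix.kroneckerMap_apply, Matrix.one_apply, Finset.mul_sum]
  refine Finset.sum_congr rfl fun i _ => ?_
  rw [Finset.sum_comm]
  refine Finset.sum_congr rfl fun j _ => ?_
  refine Finset.sum_congr rfl fun x _ => ?_
  simp

lemma quad_ptr {m k : Type*} [Fintype m] [Fintype k] [DecidableEq k]
    (ρ σ : Matrix (m × k) (m × k) ℂ) (t : ℝ) (X : Matrix m m ℂ) :
    quad (ptr ρ) (ptr σ) t X =
      quad ρ σ t (Matrix.kroneckerMap (· * ·) X (1 : Matrix k k ℂ)) := by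
  unfold quad
  have h1 : (Matrix.kroneckerMap (· * ·) X (1 : Matrix k k ℂ))ᴴ =
      Matrix.kroneckerMap (· * ·) Xᴴ (1 : Matrix k k ℂ) := by
    rw [Matrix.conjTranspose_kronecker]; simp
  rw [h1, ← Matrix.mul_kronecker_mul, ← Matrix.mul_kronecker_mul]
  simp only [mul_one, trace_kron_ptr]

lemma scalar_bound (y c : ℂ) (p s : ℝ) (hs : 0 < s) :
    2 * (star y * c).re * p - ‖y‖ ^ 2 * s ≤ ‖c‖ ^ 2 * (p * (p / s)) := by
  rw [← Complex.normSq_eq_norm_sq, ← Complex.normSq_eq_norm_sq, Complex.normSq_apply,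
    Complex.normSq_apply]
  simp only [Complex.star_def, Complex.mul_re, Complex.conj_re, Complex.conj_im]
  have h : p = s * (p / s) := by field_simp
  set r := p / s
  rw [h]
  nlinarith [mul_nonneg hs.le (sq_nonneg (y.re - c.re * r)),
    mul_nonneg hs.le (sq_nonneg (y.im - c.im * r))]

lemma scalar_eq (c : ℂ) (p s : ℝ) (hs : 0 < s) :
    2 * (star (c * ((p / s : ℝ) : ℂ)) * c).re * p - ‖c * ((p / s : ℝ) : ℂ)‖ ^ 2 * s
      = ‖c‖ ^ 2 * (p * (p / s)) := by
  rw [← Complex.normSq_eq_norm_sq, ← Complex.normSq_eq_norm_sq, Complex.normSq_apply,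
    Complex.normSq_apply]
  have h : p = s * (p / s) := by field_simp
  generalize hr : p / s = r at *
  subst h
  simp [Complex.mul_re, Complex.mul_im]
  ring

/-- diagonalization data -/
structure IsDiag {n l : Type*} [Fintype n] [Fintype l] [DecidableEq n] [DecidableEq l]
    (M : Matrix n n ℂ) (U : Matrix n l ℂ) (p : l → ℝ) : Prop where
  left : Uᴴ * U = 1
  right : U * Uᴴ = 1
  eq : M = U * Matrix.diagonal (fun i => (p i : ℂ)) * Uᴴ

section
variable {n l l' : Type*} [Fintype n] [Fintype l] [DecidableEq n] [DecidableEq l]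
    [Fintype l'] [DecidableEq l']

lemma quad_expand {ρ σ : Matrix n n ℂ} {U : Matrix n l ℂ} {V : Matrix n l' ℂ} {p : l → ℝ}
    {q : l' → ℝ} (hρ : IsDiag ρ U p) (hσ : IsDiag σ V q) (t : ℝ) (Y : Matrix l' l ℂ) :
    quad ρ σ t (V * Y * Uᴴ) = ∑ j, ∑ i, (2 * (star (Y j i) * (Vᴴ * U) j i).re * p i
      - ‖Y j i‖ ^ 2 * (q j + t * p i)) := by
  have e1 : ((V * Y * Uᴴ)ᴴ * ρ).trace = ∑ j, ∑ i, star (Y j i) * (Vᴴ * U) j i * p i := by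
    have : ((V * Y * Uᴴ)ᴴ * ρ).trace
        = (Yᴴ * (Vᴴ * U * Matrix.diagonal (fun i => (p i : ℂ)))).trace := by
      rw [hρ.eq, Matrix.conjTranspose_mul, Matrix.conjTranspose_mul,
        Matrix.conjTranspose_conjTranspose, Matrix.mul_assoc, Matrix.trace_mul_comm]
      simp only [Matrix.mul_assoc, hρ.left, Matrix.mul_one]
    rw [this, Finset.sum_comm]
    simp only [Matrix.trace, Matrix.diag]
    refine Finset.sum_congr rfl fun i _ => ?_
    rw [Matrix.mul_apply]
    refine Finset.sum_congr rfl fun j _ => ?_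
    rw [Matrix.mul_diagonal, Matrix.conjTranspose_apply, mul_assoc]
  have e2 : ((V * Y * Uᴴ) * (V * Y * Uᴴ)ᴴ * σ).trace
      = ∑ j, ∑ i, Y j i * star (Y j i) * q j := by
    have : ((V * Y * Uᴴ) * (V * Y * Uᴴ)ᴴ * σ).trace
        = (Y * Yᴴ * Matrix.diagonal (fun i => (q i : ℂ))).trace := by
      rw [hσ.eq, Matrix.conjTranspose_mul, Matrix.conjTranspose_mul,
        Matrix.conjTranspose_conjTranspose]
      have : V * Y * Uᴴ * (U * (Yᴴ * Vᴴ)) * (V * Matrix.diagonal (fun i => (q i : ℂ)) * Vᴴ)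
        = V * (Y * (Uᴴ * U) * Yᴴ * (Vᴴ * V) * Matrix.diagonal (fun i => (q i : ℂ)) * Vᴴ) := by
        simp only [Matrix.mul_assoc]
      rw [this, hρ.left, hσ.left, Matrix.trace_mul_comm]
      simp only [Matrix.mul_assoc, hσ.left, Matrix.mul_one]
    rw [this]
    simp only [Matrix.trace, Matrix.diag]
    refine Finset.sum_congr rfl fun i _ => ?_
    rw [Matrix.mul_diagonal, Matrix.mul_apply, Finset.sum_mul]
    rfl
  have e3 : ((V * Y * Uᴴ)ᴴ * (V * Y * Uᴴ) * ρ).trace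
      = ∑ j, ∑ i, star (Y j i) * Y j i * p i := by
    have : ((V * Y * Uᴴ)ᴴ * (V * Y * Uᴴ) * ρ).trace
        = (Yᴴ * Y * Matrix.diagonal (fun i => (p i : ℂ))).trace := by
      rw [hρ.eq, Matrix.conjTranspose_mul, Matrix.conjTranspose_mul,
        Matrix.conjTranspose_conjTranspose]
      have : U * (Yᴴ * Vᴴ) * (V * Y * Uᴴ) * (U * Matrix.diagonal (fun i => (p i : ℂ)) * Uᴴ)
        = U * (Yᴴ * (Vᴴ * V) * Y * (Uᴴ * U) * Matrix.diagonal (fun i => (p i : ℂ)) * Uᴴ) := by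
        simp only [Matrix.mul_assoc]
      rw [this, hρ.left, hσ.left, Matrix.trace_mul_comm]
      simp only [Matrix.mul_assoc, hρ.left, Matrix.mul_one, Matrix.one_mul]
    rw [this, Finset.sum_comm]
    simp only [Matrix.trace, Matrix.diag]
    refine Finset.sum_congr rfl fun i _ => ?_
    rw [Matrix.mul_diagonal, Matrix.mul_apply, Finset.sum_mul]
    rfl
  unfold quad
  rw [e1, e2, e3]
  simp only [Complex.re_sum, Finset.mul_sum, ← Finset.sum_sub_distrib]
  refine Finset.sum_congr rfl fun j _ => Finset.sum_congr rfl fun i _ => ?_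
  rw [← Complex.normSq_eq_norm_sq, Complex.normSq_apply]
  simp only [Complex.star_def, Complex.mul_re, Complex.mul_im, Complex.conj_re, Complex.conj_im,
    Complex.ofReal_re, Complex.ofReal_im]
  ring

noncomputable def G (U : Matrix n l ℂ) (V : Matrix n l' ℂ) (p : l → ℝ) (q : l' → ℝ) (t : ℝ) : ℝ :=
  ∑ j, ∑ i, ‖(Vᴴ * U) j i‖ ^ 2 * (p i * (p i / (q j + t * p i)))

lemma quad_le {ρ σ : Matrix n n ℂ} {U : Matrix n l ℂ} {V : Matrix n l' ℂ} {p : l → ℝ}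
    {q : l' → ℝ} (hρ : IsDiag ρ U p) (hσ : IsDiag σ V q) (hp : ∀ i, 0 ≤ p i) (hq : ∀ i, 0 < q i)
    {t : ℝ} (ht : 0 ≤ t) (X : Matrix n n ℂ) : quad ρ σ t X ≤ G U V p q t := by
  have hX : X = V * (Vᴴ * X * U) * Uᴴ := by
    have : V * (Vᴴ * X * U) * Uᴴ = (V * Vᴴ) * X * (U * Uᴴ) := by simp only [Matrix.mul_assoc]
    rw [this, hρ.right, hσ.right]; simp
  rw [hX, quad_expand hρ hσ]
  refine Finset.sum_le_sum fun j _ => Finset.sum_le_sum fun i _ => ?_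
  exact scalar_bound _ _ _ _ (add_pos_of_pos_of_nonneg (hq j) (mul_nonneg ht (hp i)))

lemma quad_attained {ρ σ : Matrix n n ℂ} {U : Matrix n l ℂ} {V : Matrix n l' ℂ} {p : l → ℝ}
    {q : l' → ℝ} (hρ : IsDiag ρ U p) (hσ : IsDiag σ V q) (hp : ∀ i, 0 ≤ p i) (hq : ∀ i, 0 < q i)
    {t : ℝ} (ht : 0 ≤ t) : ∃ X : Matrix n n ℂ, quad ρ σ t X = G U V p q t := by
  refine ⟨V * (Matrix.of fun j i => (Vᴴ * U) j i * ((p i / (q j + t * p i) : ℝ) : ℂ)) * Uᴴ, ?_⟩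
  rw [quad_expand hρ hσ]
  refine Finset.sum_congr rfl fun j _ => Finset.sum_congr rfl fun i _ => ?_
  exact scalar_eq _ _ _ (add_pos_of_pos_of_nonneg (hq j) (mul_nonneg ht (hp i)))

noncomputable def F (U : Matrix n l ℂ) (V : Matrix n l' ℂ) (p : l → ℝ) (q : l' → ℝ) (t : ℝ) : ℝ :=
  ∑ j, ∑ i, ‖(Vᴴ * U) j i‖ ^ 2 * (p i * (Real.log (q j + t * p i) - Real.log (q j)))

lemma F_zero (U : Matrix n l ℂ) (V : Matrix n l' ℂ) (p : l → ℝ) (q : l' → ℝ) :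
    F U V p q 0 = 0 := by simp [F]

lemma F_deriv (U : Matrix n l ℂ) (V : Matrix n l' ℂ) {p : l → ℝ} {q : l' → ℝ}
    (hp : ∀ i, 0 ≤ p i) (hq : ∀ i, 0 < q i) {t : ℝ} (ht : 0 ≤ t) :
    HasDerivAt (F U V p q) (G U V p q t) t := by
  unfold F G
  refine HasDerivAt.fun_sum fun j _ => HasDerivAt.fun_sum fun i _ => ?_
  refine HasDerivAt.const_mul _ (HasDerivAt.const_mul _ ?_)
  refine HasDerivAt.sub_const _ ?_
  have h : HasDerivAt (fun t => q j + t * p i) (p i) t := by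
    simpa using ((hasDerivAt_id t).mul_const (p i)).const_add (q j)
  exact h.log (add_pos_of_pos_of_nonneg (hq j) (mul_nonneg ht (hp i))).ne'

lemma tendsto_log (p q : ℝ) :
    Filter.Tendsto (fun s : ℝ => p * Real.log (p + s * q)) (nhdsWithin 0 (Set.Ioi 0))
      (nhds (p * Real.log p)) := by
  refine Filter.Tendsto.mono_left ?_ nhdsWithin_le_nhds
  by_cases hp : p = 0
  · simp [hp]
  · have : ContinuousAt (fun s : ℝ => p * Real.log (p + s * q)) 0 := by
      refine ContinuousAt.mul continuousAt_const (ContinuousAt.log (by fun_prop) (by simpa using hp))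
    simpa [ContinuousAt] using this

lemma col_sum {ρ σ : Matrix n n ℂ} {U : Matrix n l ℂ} {V : Matrix n l' ℂ} {p : l → ℝ}
    {q : l' → ℝ} (hρ : IsDiag ρ U p) (hσ : IsDiag σ V q) (i : l) :
    ∑ j, ‖(Vᴴ * U) j i‖ ^ 2 = 1 := by
  have h : ((Vᴴ * U)ᴴ * (Vᴴ * U)) = 1 := by
    have : (Vᴴ * U)ᴴ * (Vᴴ * U) = Uᴴ * (V * Vᴴ) * U := by
      rw [Matrix.conjTranspose_mul, Matrix.conjTranspose_conjTranspose]
      simp only [Matrix.mul_assoc]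
    rw [this, hσ.right, Matrix.mul_one, hρ.left]
  have h2 := congrFun (congrFun h i) i
  rw [Matrix.mul_apply, Matrix.one_apply_eq] at h2
  have h3 : ((∑ j, ‖(Vᴴ * U) j i‖ ^ 2 : ℝ) : ℂ) = 1 := by
    rw [← h2]
    push_cast
    refine Finset.sum_congr rfl fun j _ => ?_
    rw [Matrix.conjTranspose_apply, Complex.star_def, Complex.conj_mul']
  exact_mod_cast h3

lemma row_sum {ρ : Matrix n n ℂ} {U : Matrix n l ℂ} (V : Matrix n l' ℂ) {p : l → ℝ}
    (hρ : IsDiag ρ U p) (j : l') :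
    ∑ i, ‖(Vᴴ * U) j i‖ ^ 2 * p i = ((Vᴴ * ρ * V) j j).re := by
  have h : Vᴴ * ρ * V = (Vᴴ * U) * Matrix.diagonal (fun i => (p i : ℂ)) * (Vᴴ * U)ᴴ := by
    rw [hρ.eq, Matrix.conjTranspose_mul, Matrix.conjTranspose_conjTranspose]
    simp only [Matrix.mul_assoc]
  rw [h, Matrix.mul_apply, Complex.re_sum]
  refine Finset.sum_congr rfl fun i _ => ?_
  rw [Matrix.mul_diagonal, Matrix.conjTranspose_apply, ← Complex.normSq_eq_norm_sq,
    Complex.normSq_apply]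
  simp only [Complex.star_def, Complex.mul_re, Complex.mul_im, Complex.conj_re, Complex.conj_im,
    Complex.ofReal_re, Complex.ofReal_im]
  ring

/-- relative entropy in terms of diagonalization -/
noncomputable def relE (ρ : Matrix n n ℂ) (V : Matrix n l' ℂ) (p : l → ℝ) (q : l' → ℝ) : ℝ :=
  ∑ i, p i * Real.log (p i) - ∑ j, ((Vᴴ * ρ * V) j j).re * Real.log (q j)

lemma F_tendsto {ρ σ : Matrix n n ℂ} {U : Matrix n l ℂ} {V : Matrix n l' ℂ} {p : l → ℝ}
    {q : l' → ℝ} (hρ : IsDiag ρ U p) (hσ : IsDiag σ V q) (hp : ∀ i, 0 ≤ p i)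
    (hq : ∀ i, 0 < q i) :
    Filter.Tendsto (fun s : ℝ => F U V p q s⁻¹ + Real.log s * ρ.trace.re)
      (nhdsWithin 0 (Set.Ioi 0)) (nhds (relE ρ V p q)) := by
  have htr : ρ.trace.re = ∑ j, ∑ i, ‖(Vᴴ * U) j i‖ ^ 2 * p i := by
    rw [Finset.sum_comm]
    simp only [← Finset.sum_mul, col_sum hρ hσ, one_mul]
    rw [hρ.eq, Matrix.trace_mul_comm, ← Matrix.mul_assoc, hρ.left, Matrix.one_mul,
      Matrix.trace_diagonal, Complex.re_sum]
    simp
  have hlim : relE ρ V p q = ∑ j, ∑ i, ‖(Vᴴ * U) j i‖ ^ 2 *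
      (p i * Real.log (p i) - p i * Real.log (q j)) := by
    unfold relE
    simp only [mul_sub, Finset.sum_sub_distrib]
    congr 1
    · rw [Finset.sum_comm]
      simp only [← Finset.sum_mul, col_sum hρ hσ, one_mul]
    · refine Finset.sum_congr rfl fun j _ => ?_
      rw [← row_sum V hρ, Finset.sum_mul]
      exact Finset.sum_congr rfl fun i _ => by ring
  rw [hlim]
  have : Filter.Tendsto (fun s : ℝ => ∑ j, ∑ i, ‖(Vᴴ * U) j i‖ ^ 2 *
      (p i * Real.log (p i + s * q j) - p i * Real.log (q j))) (nhdsWithin 0 (Set.Ioi 0))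
      (nhds (∑ j, ∑ i, ‖(Vᴴ * U) j i‖ ^ 2 *
      (p i * Real.log (p i) - p i * Real.log (q j)))) := by
    refine tendsto_finsetSum _ fun j _ => tendsto_finsetSum _ fun i _ => ?_
    exact ((tendsto_log (p i) (q j)).sub_const _).const_mul _
  refine this.congr' ?_
  filter_upwards [self_mem_nhdsWithin] with s hs
  have hs : 0 < s := hs
  rw [htr, F, Finset.mul_sum, ← Finset.sum_add_distrib]
  refine Finset.sum_congr rfl fun j _ => ?_
  rw [Finset.mul_sum, ← Finset.sum_add_distrib]
  refine Finset.sum_congr rfl fun i _ => ?_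
  have h1 : p i + s * q j = s * (q j + s⁻¹ * p i) := by field_simp; ring
  have h2 : 0 < q j + s⁻¹ * p i :=
    add_pos_of_pos_of_nonneg (hq j) (mul_nonneg (inv_pos.2 hs).le (hp i))
  rw [h1, Real.log_mul hs.ne' h2.ne']
  ring
end

section
variable {m k l l' r r' : Type*} [Fintype m] [Fintype k] [DecidableEq m] [DecidableEq k]
  [Fintype l] [DecidableEq l] [Fintype l'] [DecidableEq l']
  [Fintype r] [DecidableEq r] [Fintype r'] [DecidableEq r']

lemma trace_ptr (M : Matrix (m × k) (m × k) ℂ) : (ptr M).trace = M.trace := by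
  simp [Matrix.trace, ptr, Fintype.sum_prod_type]

/-- monotonicity of the relative entropy under partial trace -/
theorem relE_mono {ρ σ : Matrix (m × k) (m × k) ℂ}
    {U : Matrix (m × k) l ℂ} {V : Matrix (m × k) l' ℂ} {p : l → ℝ} {q : l' → ℝ}
    {U' : Matrix m r ℂ} {V' : Matrix m r' ℂ} {p' : r → ℝ} {q' : r' → ℝ}
    (hρ : IsDiag ρ U p) (hσ : IsDiag σ V q) (hp : ∀ i, 0 ≤ p i) (hq : ∀ i, 0 < q i)
    (hρ' : IsDiag (ptr ρ) U' p') (hσ' : IsDiag (ptr σ) V' q') (hp' : ∀ i, 0 ≤ p' i)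
    (hq' : ∀ i, 0 < q' i) :
    relE (ptr ρ) V' p' q' ≤ relE ρ V p q := by
  have hG : ∀ t : ℝ, 0 ≤ t → G U' V' p' q' t ≤ G U V p q t := by
    intro t ht
    obtain ⟨X, hX⟩ := quad_attained hρ' hσ' hp' hq' ht
    rw [← hX, quad_ptr]
    exact quad_le hρ hσ hp hq ht _
  have hF : ∀ t : ℝ, 0 ≤ t → F U' V' p' q' t ≤ F U V p q t := by
    intro t ht
    have hd : ∀ t : ℝ, 0 ≤ t → HasDerivAt (fun t => F U V p q t - F U' V' p' q' t)
        (G U V p q t - G U' V' p' q' t) t := fun t ht =>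
      (F_deriv U V hp hq ht).sub (F_deriv U' V' hp' hq' ht)
    have hm : MonotoneOn (fun t => F U V p q t - F U' V' p' q' t) (Set.Ici 0) := by
      refine monotoneOn_of_deriv_nonneg (convex_Ici 0) ?_ ?_ ?_
      · exact fun t ht => (hd t ht).continuousAt.continuousWithinAt
      · intro t ht
        rw [interior_Ici] at ht
        exact (hd t (le_of_lt ht)).differentiableAt.differentiableWithinAt
      · intro t ht
        rw [interior_Ici] at ht
        rw [(hd t (le_of_lt ht)).deriv]
        exact sub_nonneg.2 (hG t (le_of_lt ht))
    have := hm (Set.mem_Ici.2 le_rfl) (Set.mem_Ici.2 ht) ht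
    simp only [F_zero] at this
    linarith
  refine le_of_tendsto_of_tendsto (F_tendsto hρ' hσ' hp' hq') (F_tendsto hρ hσ hp hq) ?_
  filter_upwards [self_mem_nhdsWithin] with s hs
  have hs : 0 < s := hs
  rw [trace_ptr]
  linarith [hF s⁻¹ (inv_pos.2 hs).le]

end

lemma isDiag_of_herm {n : Type*} [Fintype n] [DecidableEq n] {M : Matrix n n ℂ}
    (h : M.IsHermitian) : IsDiag M (h.eigenvectorUnitary : Matrix n n ℂ) h.eigenvalues := by
  refine ⟨?_, ?_, ?_⟩
  · exact Unitary.coe_star_mul_self h.eigenvectorUnitary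
  · exact Unitary.coe_mul_star_self h.eigenvectorUnitary
  · conv_lhs => rw [h.spectral_theorem, Unitary.conjStarAlgAut_apply]
    rfl

lemma IsDiag.add_smul {n l : Type*} [Fintype n] [DecidableEq n] [Fintype l] [DecidableEq l]
    {M : Matrix n n ℂ} {U : Matrix n l ℂ} {p : l → ℝ} (h : IsDiag M U p) (c : ℝ) :
    IsDiag (M + (c : ℂ) • (1 : Matrix n n ℂ)) U (fun i => p i + c) := by
  refine ⟨h.left, h.right, ?_⟩
  have : Matrix.diagonal (fun i => ((p i + c : ℝ) : ℂ))
      = Matrix.diagonal (fun i => (p i : ℂ)) + (c : ℂ) • (1 : Matrix l l ℂ) := by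
    rw [Matrix.smul_one_eq_diagonal, Matrix.diagonal_add]; simp
  rw [this, Matrix.mul_add, Matrix.add_mul, ← h.eq, Matrix.mul_smul, Matrix.smul_mul,
    Matrix.mul_one, h.right]

lemma IsDiag.one_kron {α n l : Type*} [Fintype n] [DecidableEq n] [Fintype l] [DecidableEq l]
    [Fintype α] [DecidableEq α]
    {M : Matrix n n ℂ} {U : Matrix n l ℂ} {p : l → ℝ} (h : IsDiag M U p) :
    IsDiag (Matrix.kroneckerMap (· * ·) (1 : Matrix α α ℂ) M)
      (Matrix.kroneckerMap (· * ·) (1 : Matrix α α ℂ) U) (fun i => p i.2) := by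
  have hc : (Matrix.kroneckerMap (· * ·) (1 : Matrix α α ℂ) U)ᴴ =
      Matrix.kroneckerMap (· * ·) (1 : Matrix α α ℂ) Uᴴ := by
    rw [Matrix.conjTranspose_kronecker]; simp
  refine ⟨?_, ?_, ?_⟩
  · rw [hc, ← Matrix.mul_kronecker_mul, h.left]; simp
  · rw [hc, ← Matrix.mul_kronecker_mul, h.right]; simp
  · have : Matrix.diagonal (fun i : α × l => (p i.2 : ℂ)) =
      Matrix.kroneckerMap (· * ·) (1 : Matrix α α ℂ) (Matrix.diagonal (fun i => (p i : ℂ))) := by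
      rw [← Matrix.diagonal_one, Matrix.diagonal_kronecker_diagonal]; simp
    rw [this, hc, ← Matrix.mul_kronecker_mul, ← Matrix.mul_kronecker_mul, ← h.eq]; simp

lemma IsDiag.reindex {n n' l : Type*} [Fintype n] [DecidableEq n] [Fintype l] [DecidableEq l]
    [Fintype n'] [DecidableEq n'] (e : n' ≃ n)
    {M : Matrix n n ℂ} {U : Matrix n l ℂ} {p : l → ℝ} (h : IsDiag M U p) :
    IsDiag (M.submatrix e e) (U.submatrix e id) p := by
  refine ⟨?_, ?_, ?_⟩
  · rw [Matrix.conjTranspose_submatrix, Matrix.submatrix_mul_equiv, h.left]; simp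
  · rw [Matrix.conjTranspose_submatrix]
    rw [← Matrix.submatrix_mul _ _ _ _ _ Function.bijective_id, h.right]; simp
  · conv_lhs => rw [h.eq]
    ext i j
    simp [Matrix.mul_apply, Matrix.diagonal]

/-- sum of diagonal entries over the first factor -/
lemma diag_one_kron {α n l : Type*} [Fintype n] [Fintype l]
    [Fintype α] [DecidableEq α] (R : Matrix (α × n) (α × n) ℂ) (W : Matrix n l ℂ) (x : l) :
    ∑ a : α, ((Matrix.kroneckerMap (· * ·) (1 : Matrix α α ℂ) W)ᴴ * R *
      Matrix.kroneckerMap (· * ·) (1 : Matrix α α ℂ) W) (a, x) (a, x)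
    = (Wᴴ * (Matrix.of fun i j => ∑ a, R (a, i) (a, j)) * W) x x := by
  simp only [Matrix.mul_apply, Fintype.sum_prod_type, Matrix.conjTranspose_apply,
    Matrix.kroneckerMap_apply, Matrix.one_apply, Matrix.of_apply]
  simp [Finset.sum_mul, Finset.mul_sum, apply_ite]
  rw [Finset.sum_comm]
  refine Finset.sum_congr rfl fun i _ => ?_
  rw [Finset.sum_comm]

lemma sum_relE {α n l : Type*} [Fintype n] [DecidableEq n] [Fintype l] [DecidableEq l]
    [Fintype α] [DecidableEq α] (R : Matrix (α × n) (α × n) ℂ) {τ : Matrix n n ℂ}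
    {W : Matrix n l ℂ} {d : l → ℝ} (hτ : IsDiag τ W d)
    (hR : τ = Matrix.of fun i j => ∑ a, R (a, i) (a, j)) (f : l → ℝ) :
    ∑ j : α × l, (((Matrix.kroneckerMap (· * ·) (1 : Matrix α α ℂ) W)ᴴ * R *
      Matrix.kroneckerMap (· * ·) (1 : Matrix α α ℂ) W) j j).re * f j.2 = ∑ x, d x * f x := by
  rw [Fintype.sum_prod_type, Finset.sum_comm]
  refine Finset.sum_congr rfl fun x _ => ?_
  simp only
  rw [← Finset.sum_mul, ← Complex.re_sum, diag_one_kron, ← hR, hτ.eq]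
  have : Wᴴ * (W * Matrix.diagonal (fun i => (d i : ℂ)) * Wᴴ) * W =
    (Wᴴ * W) * Matrix.diagonal (fun i => (d i : ℂ)) * (Wᴴ * W) := by simp only [Matrix.mul_assoc]
  rw [this, hτ.left]; simp

lemma vn_eq {n : Type*} [Fintype n] [DecidableEq n] {M : Matrix n n ℂ}
    (h : M.IsHermitian) : vnEntropy M = - ∑ i, h.eigenvalues i * Real.log (h.eigenvalues i) := by
  rw [vnEntropy, dif_pos h, ← Finset.sum_neg_distrib]
  simp [Real.negMulLog]

/-- strong subadditivity -/
theorem ssa {α β γ : Type*} [Fintype α] [Fintype β] [Fintype γ] [DecidableEq α] [DecidableEq β]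
    [DecidableEq γ] [Nonempty γ] {ρ : Matrix ((α × β) × γ) ((α × β) × γ) ℂ}
    {τ : Matrix (β × γ) (β × γ) ℂ}
    (hτ : τ = Matrix.of fun i j => ∑ a, ρ ((a, i.1), i.2) ((a, j.1), j.2))
    (h1 : ρ.PosSemidef) (h2 : τ.PosSemidef) (h3 : (ptr ρ).PosSemidef) (h4 : (ptr τ).PosSemidef) :
    vnEntropy ρ + vnEntropy (ptr τ) ≤ vnEntropy (ptr ρ) + vnEntropy τ := by
  rw [vn_eq h1.isHermitian, vn_eq h2.isHermitian, vn_eq h3.isHermitian, vn_eq h4.isHermitian]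
  have D1 := isDiag_of_herm h1.isHermitian
  have D2 := isDiag_of_herm h2.isHermitian
  have D3 := isDiag_of_herm h3.isHermitian
  have D4 := isDiag_of_herm h4.isHermitian
  have n1 := h1.eigenvalues_nonneg
  have n2 := h2.eigenvalues_nonneg
  have n3 := h3.eigenvalues_nonneg
  have n4 := h4.eigenvalues_nonneg
  set W2 : Matrix (β × γ) (β × γ) ℂ := (h2.isHermitian.eigenvectorUnitary : Matrix (β × γ) (β × γ) ℂ)
  set W4 : Matrix β β ℂ := (h4.isHermitian.eigenvectorUnitary : Matrix β β ℂ)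
  set d2 := h2.isHermitian.eigenvalues
  set d4 := h4.isHermitian.eigenvalues
  set c : ℝ := (Fintype.card γ : ℝ)
  have hc : 0 < c := by simp only [c]; exact_mod_cast Fintype.card_pos
  have key : ∀ ε : ℝ, 0 < ε →
      ∑ i, h3.isHermitian.eigenvalues i * Real.log (h3.isHermitian.eigenvalues i)
        - ∑ y, d4 y * Real.log (d4 y + ε * c) ≤
      ∑ i, h1.isHermitian.eigenvalues i * Real.log (h1.isHermitian.eigenvalues i)
        - ∑ x, d2 x * Real.log (d2 x + ε * 1) := by
    intro ε hε
    have Dσ := ((D2.add_smul (ε * 1)).one_kron (α := α)).reindex (Equiv.prodAssoc α β γ)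
    have Dσ' := (D4.add_smul (ε * c)).one_kron (α := α)
    have hptr : Matrix.kroneckerMap (· * ·) (1 : Matrix α α ℂ)
        (ptr τ + ((ε * c : ℝ) : ℂ) • (1 : Matrix β β ℂ)) =
        ptr ((Matrix.kroneckerMap (· * ·) (1 : Matrix α α ℂ)
        (τ + ((ε * 1 : ℝ) : ℂ) • (1 : Matrix (β × γ) (β × γ) ℂ))).submatrix
          (Equiv.prodAssoc α β γ) (Equiv.prodAssoc α β γ)) := by
      ext ⟨a, b⟩ ⟨a', b'⟩
      change (1 : Matrix α α ℂ) a a' * (∑ x, τ (b, x) (b', x) +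
          ((ε * c : ℝ) : ℂ) * (1 : Matrix β β ℂ) b b') =
        ∑ x, (1 : Matrix α α ℂ) a a' * (τ (b, x) (b', x) +
          ((ε * 1 : ℝ) : ℂ) * (1 : Matrix (β × γ) (β × γ) ℂ) (b, x) (b', x))
      rw [← Finset.mul_sum, Finset.sum_add_distrib]
      congr 2
      by_cases hb : b = b'
      · subst hb; simp [c, mul_comm]
      · simp [hb, Matrix.one_apply]
    rw [hptr] at Dσ'
    have := relE_mono D1 Dσ n1 (fun i => add_pos_of_nonneg_of_pos (n2 _) (by positivity))
      D3 Dσ' n3 (fun i => add_pos_of_nonneg_of_pos (n4 _) (by positivity))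
    unfold relE at this
    rw [sum_relE (ptr ρ) D4 ?_ (fun x => Real.log (d4 x + ε * c))] at this
    · have e := sum_relE (ρ.submatrix (Equiv.prodAssoc α β γ).symm (Equiv.prodAssoc α β γ).symm)
        D2 (by rw [hτ]; rfl) (fun x => Real.log (d2 x + ε * 1))
      have hV : ((Matrix.kroneckerMap (· * ·) (1 : Matrix α α ℂ) W2).submatrix
          (Equiv.prodAssoc α β γ) id)ᴴ * ρ * (Matrix.kroneckerMap (· * ·) (1 : Matrix α α ℂ)
          W2).submatrix (Equiv.prodAssoc α β γ) id =
          (Matrix.kroneckerMap (· * ·) (1 : Matrix α α ℂ) W2)ᴴ *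
          ρ.submatrix (Equiv.prodAssoc α β γ).symm (Equiv.prodAssoc α β γ).symm *
          Matrix.kroneckerMap (· * ·) (1 : Matrix α α ℂ) W2 := by
        have hr : ρ = (ρ.submatrix (Equiv.prodAssoc α β γ).symm
          (Equiv.prodAssoc α β γ).symm).submatrix (Equiv.prodAssoc α β γ)
            (Equiv.prodAssoc α β γ) := by ext i j; simp
        conv_lhs => rw [hr]
        rw [Matrix.conjTranspose_submatrix, Matrix.submatrix_mul_equiv,
          Matrix.submatrix_mul_equiv, Matrix.submatrix_id_id]
      rw [← e, ← hV]
      exact this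
    · ext i j
      rw [hτ]
      simp only [ptr, Matrix.of_apply]
      rw [Finset.sum_comm]
  have l4 : Filter.Tendsto (fun ε : ℝ => ∑ y, d4 y * Real.log (d4 y + ε * c))
      (nhdsWithin 0 (Set.Ioi 0)) (nhds (∑ y, d4 y * Real.log (d4 y))) :=
    tendsto_finsetSum Finset.univ fun y _ => tendsto_log (d4 y) c
  have l2 : Filter.Tendsto (fun ε : ℝ => ∑ y, d2 y * Real.log (d2 y + ε * 1))
      (nhdsWithin 0 (Set.Ioi 0)) (nhds (∑ y, d2 y * Real.log (d2 y))) :=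
    tendsto_finsetSum Finset.univ fun y _ => tendsto_log (d2 y) 1
  have lim := le_of_tendsto_of_tendsto
    (l4.const_sub (∑ i, h3.isHermitian.eigenvalues i * Real.log (h3.isHermitian.eigenvalues i)))
    (l2.const_sub (∑ i, h1.isHermitian.eigenvalues i * Real.log (h1.isHermitian.eigenvalues i)))
    (Filter.eventually_of_mem self_mem_nhdsWithin fun ε hε => key ε hε)
  linarith

lemma vn_charpoly {n : Type*} [Fintype n] [DecidableEq n] {M : Matrix n n ℂ}
    (h : M.IsHermitian) : vnEntropy M =
      (M.charpoly.roots.map (fun z => Real.negMulLog z.re)).sum := by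
  rw [vnEntropy, dif_pos h, h.roots_charpoly_eq_eigenvalues, Multiset.map_map]
  rfl

/-- Schmidt -/
lemma vn_schmidt {m n : Type*} [Fintype n] [DecidableEq n] [Fintype m] [DecidableEq m]
    (K : Matrix m n ℂ) : vnEntropy (K * Kᴴ) = vnEntropy (Kᴴ * K)ᵀ := by
  rw [vn_charpoly (Matrix.isHermitian_mul_conjTranspose_self K),
    vn_charpoly (Matrix.isHermitian_conjTranspose_mul_self K).transpose,
    Matrix.charpoly_transpose]
  have h := Matrix.charpoly_mul_comm' K Kᴴ
  have h' := congrArg (fun P => (P.roots.map (fun z : ℂ => Real.negMulLog z.re)).sum) h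
  rw [Polynomial.roots_mul, Polynomial.roots_mul] at h'
  · simpa [Multiset.map_nsmul, Multiset.sum_nsmul] using h'
  all_goals
    exact mul_ne_zero (pow_ne_zero _ Polynomial.X_ne_zero) (Matrix.charpoly_monic _).ne_zero

end SSA


/-- **Core lemma of Theorem 1 of the paper.** For a pure density matrix `ρ` on
`a × b × e0 × f` such that the environment subsystem `e0` shares correlations with `a`
exactly as `b` does, i.e. `ρ^{a b} = ρ^{a e0}`, the coherent information toward `b`
is nonpositive: `S(ρ^{b}) ≤ S(ρ^{a b})`. -/
theorem coherent_info_nonpos_of_env_mirror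
    {ιa ιb ιf : Type*} [Fintype ιa] [Fintype ιb] [Fintype ιf]
    [DecidableEq ιa] [DecidableEq ιb] [DecidableEq ιf]
    [Nonempty ιa] [Nonempty ιb] [Nonempty ιf]
    (ρ : Matrix (ιa × ιb × ιb × ιf) (ιa × ιb × ιb × ιf) ℂ)
    (hpure : IsPureDensityMatrix ρ)
    (hmirror : redAB ρ = redAE0 ρ) :
    vnEntropy (redB ρ) ≤ vnEntropy (redAB ρ) := by
  obtain ⟨-, w, -, rfl⟩ := hpure
  -- matrices of the pure state
  let K1 : Matrix ((ιa × ιb) × ιf) ιb ℂ := Matrix.of fun x e => w (x.1.1, x.1.2, e, x.2)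
  let K2 : Matrix (ιb × ιf) (ιa × ιb) ℂ := Matrix.of fun x y => w (y.1, x.1, y.2, x.2)
  let K3 : Matrix (ιa × ιb) (ιb × ιf) ℂ := Matrix.of fun x y => w (x.1, x.2, y.1, y.2)
  let K4 : Matrix ιb (ιa × ιb × ιf) ℂ := Matrix.of fun x y => w (y.1, x, y.2.1, y.2.2)
  have hAB : redAB (vecMulVec w (star w)) = K3 * K3ᴴ := by
    ext i j
    simp [redAB, K3, Matrix.of_apply, Matrix.mul_apply, Fintype.sum_prod_type, vecMulVec_apply]
  have hB : redB (vecMulVec w (star w)) = K4 * K4ᴴ := by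
    ext i j
    simp [redB, K4, Matrix.of_apply, Matrix.mul_apply, Fintype.sum_prod_type, vecMulVec_apply]
  have hAE : redAE0 (vecMulVec w (star w)) = (K2ᴴ * K2)ᵀ := by
    ext i j
    simp [redAE0, K2, Matrix.of_apply, Matrix.mul_apply, Fintype.sum_prod_type, vecMulVec_apply, mul_comm]
  have hE : redB (vecMulVec w (star w)) = (K1ᴴ * K1)ᵀ := by
    have h0 : redB (vecMulVec w (star w)) =
        fun i j => ∑ a, redAB (vecMulVec w (star w)) (a, i) (a, j) := by
      ext i j; simp [redB, redAB]
    rw [h0, hmirror]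
    ext i j
    simp [redAE0, K1, Matrix.of_apply, Matrix.mul_apply, Fintype.sum_prod_type, vecMulVec_apply, mul_comm]
  have p1 : SSA.ptr (K1 * K1ᴴ) = K3 * K3ᴴ := by
    ext i j
    simp only [SSA.ptr, K1, K3, Matrix.of_apply, Matrix.mul_apply, Fintype.sum_prod_type, Matrix.conjTranspose_apply]
    rw [Finset.sum_comm]
  have p2 : SSA.ptr (K2 * K2ᴴ) = K4 * K4ᴴ := by
    ext i j
    simp only [SSA.ptr, K2, K4, Matrix.of_apply, Matrix.mul_apply, Fintype.sum_prod_type, Matrix.conjTranspose_apply]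
    rw [Finset.sum_comm]
    refine Finset.sum_congr rfl fun a _ => ?_
    rw [Finset.sum_comm]
  have hτ : K2 * K2ᴴ = Matrix.of fun i j => ∑ a, (K1 * K1ᴴ) ((a, i.1), i.2) ((a, j.1), j.2) := by
    ext i j
    simp only [K1, K2, Matrix.of_apply, Matrix.mul_apply, Fintype.sum_prod_type, Matrix.conjTranspose_apply,
      Matrix.of_apply]
  have key := SSA.ssa hτ (posSemidef_self_mul_conjTranspose K1) (posSemidef_self_mul_conjTranspose K2)
    (by rw [p1]; exact posSemidef_self_mul_conjTranspose K3)
    (by rw [p2]; exact posSemidef_self_mul_conjTranspose K4)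
  rw [p1, p2, ← hAB, ← hB, SSA.vn_schmidt K1, SSA.vn_schmidt K2, ← hE, ← hAE, ← hmirror] at key
  linarith
end

section
/- Let ι_a, ι_b, ι_{e0}, ι_f, ι_{a'}, ι_{b'} be nonempty finite types with ι_b = ι_{e0}, and let ρ be a pure density matrix on the product type ι_a × ι_b × ι_{e0} × ι_f with ρ^{a b} = ρ^{a e0} as matrices indexed by ι_a × ι_b. Let M be a quantum channel from ι_a to ι_{a'} given by a finite family of Kraus operators K_i : Matrix ι_{a'} ι_a ℂ with ∑_i K_iᴴ K_i = 1, and let N be a quantum channel from ι_b to ι_{b'} given by Kraus operators L_j : Matrix ι_{b'} ι_b ℂ with ∑_j L_jᴴ L_j = 1. Define σ := ∑_{i,j} (K_i ⊗ L_j) ρ^{a b} (K_i ⊗ L_j)ᴴ, a density matrix on ι_{a'} × ι_{b'} (where ⊗ is the Kronecker product). Then S(σ^{b'}) ≤ S(σ); equivalently, the coherent information I^{b'}(σ) := S(σ^{b'}) − S(σ) is nonpositive. -/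
open Matrix ComplexOrder

open Kronecker

/-- Output of the product channel `M ⊗ N` (in Kraus form `K`, `L`) on a bipartite state. -/
noncomputable def channelOut {ιa ιb ιa' ιb' : Type*}
    [Fintype ιa] [Fintype ιb] [Fintype ιa'] [Fintype ιb']
    {n m : ℕ} (K : Fin n → Matrix ιa' ιa ℂ) (L : Fin m → Matrix ιb' ιb ℂ)
    (ρab : Matrix (ιa × ιb) (ιa × ιb) ℂ) : Matrix (ιa' × ιb') (ιa' × ιb') ℂ :=
  ∑ i : Fin n, ∑ j : Fin m, (K i ⊗ₖ L j) * ρab * (K i ⊗ₖ L j)ᴴ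

/-- Partial trace over the first tensor factor. -/
noncomputable def redSnd {ι κ : Type*} [Fintype ι]
    (M : Matrix (ι × κ) (ι × κ) ℂ) : Matrix κ κ ℂ :=
  fun p q => ∑ x : ι, M (x, p) (x, q)


set_option linter.unusedSectionVars false
set_option linter.unusedVariables false
set_option linter.unusedSimpArgs false

namespace CohInfo


/-- Entire and bounded on the strip `|Re z| ≤ 1`. -/
def Good (f : ℂ → ℂ) : Prop :=
  Differentiable ℂ f ∧ ∃ C : ℝ, ∀ z : ℂ, |z.re| ≤ 1 → ‖f z‖ ≤ C

theorem Good.const (c : ℂ) : Good (fun _ => c) :=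
  ⟨differentiable_const c, ‖c‖, fun _ _ => le_rfl⟩

theorem Good.add {f g : ℂ → ℂ} (hf : Good f) (hg : Good g) : Good (fun z => f z + g z) := by
  obtain ⟨df, C, hC⟩ := hf
  obtain ⟨dg, D, hD⟩ := hg
  exact ⟨df.add dg, C + D, fun z hz => (norm_add_le _ _).trans (add_le_add (hC z hz) (hD z hz))⟩

theorem Good.mul {f g : ℂ → ℂ} (hf : Good f) (hg : Good g) : Good (fun z => f z * g z) := by
  obtain ⟨df, C, hC⟩ := hf
  obtain ⟨dg, D, hD⟩ := hg
  refine ⟨df.mul dg, C * D, fun z hz => ?_⟩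
  rw [norm_mul]
  exact mul_le_mul (hC z hz) (hD z hz) (norm_nonneg _) ((norm_nonneg _).trans (hC z hz))

theorem Good.sum {ι : Type*} (s : Finset ι) {f : ι → ℂ → ℂ} (hf : ∀ i, Good (f i)) :
    Good (fun z => ∑ i ∈ s, f i z) := by
  classical
  induction s using Finset.induction_on with
  | empty => simpa using Good.const 0
  | insert a s ha ih =>
    simp only [Finset.sum_insert ha]
    exact (hf a).add ih

theorem Good.neg_arg {f : ℂ → ℂ} (hf : Good f) : Good (fun z => f (-z)) := by
  obtain ⟨df, C, hC⟩ := hf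
  exact ⟨df.comp differentiable_neg, C, fun z hz => hC _ (by simpa using hz)⟩

theorem Good.exp (r : ℝ) : Good (fun z => Complex.exp (z * r)) := by
  refine ⟨by fun_prop, Real.exp |r|, fun z hz => ?_⟩
  rw [Complex.norm_exp]
  apply Real.exp_le_exp.2
  simp only [Complex.mul_re, Complex.ofReal_re, Complex.ofReal_im, mul_zero, sub_zero]
  calc z.re * r ≤ |z.re * r| := le_abs_self _
    _ = |z.re| * |r| := abs_mul _ _
    _ ≤ 1 * |r| := mul_le_mul_of_nonneg_right hz (abs_nonneg _)
    _ = |r| := one_mul _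

section
variable {n : Type*} [Fintype n] [DecidableEq n]

def MGood (f : ℂ → Matrix n n ℂ) : Prop := ∀ i j, Good (fun z => f z i j)

def MDeriv (f : ℂ → Matrix n n ℂ) (f' : Matrix n n ℂ) : Prop :=
  ∀ i j, HasDerivAt (fun z => f z i j) (f' i j) 0

theorem MGood.mul {f g : ℂ → Matrix n n ℂ} (hf : MGood f) (hg : MGood g) :
    MGood (fun z => f z * g z) := by
  intro i j
  simp only [Matrix.mul_apply]
  exact Good.sum _ fun k => (hf i k).mul (hg k j)

theorem MGood.const (A : Matrix n n ℂ) : MGood (fun _ => A) := fun i j => Good.const _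

theorem MGood.neg_arg {f : ℂ → Matrix n n ℂ} (hf : MGood f) : MGood (fun z => f (-z)) :=
  fun i j => (hf i j).neg_arg

theorem MGood.trace {f : ℂ → Matrix n n ℂ} (hf : MGood f) : Good (fun z => (f z).trace) := by
  simp only [Matrix.trace, Matrix.diag]
  exact Good.sum _ fun i => hf i i

theorem MDeriv.mul {f g : ℂ → Matrix n n ℂ} {f' g' : Matrix n n ℂ}
    (hf : MDeriv f f') (hg : MDeriv g g') :
    MDeriv (fun z => f z * g z) (f' * g 0 + f 0 * g') := by
  intro i j
  simp only [Matrix.mul_apply, Matrix.add_apply, ← Finset.sum_add_distrib]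
  exact HasDerivAt.fun_sum fun k _ => (hf i k).mul (hg k j)

theorem MDeriv.const (A : Matrix n n ℂ) : MDeriv (fun _ => A) 0 :=
  fun i j => hasDerivAt_const _ _

theorem MDeriv.neg_arg {f : ℂ → Matrix n n ℂ} {f' : Matrix n n ℂ} (hf : MDeriv f f') :
    MDeriv (fun z => f (-z)) (-f') := by
  intro i j
  have h1 : HasDerivAt (fun z => f z i j) (f' i j) (-0) := by simpa using hf i j
  have h2 := HasDerivAt.comp (0 : ℂ) h1 (hasDerivAt_neg (0 : ℂ))
  simpa [Function.comp_def] using h2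

theorem MDeriv.trace {f : ℂ → Matrix n n ℂ} {f' : Matrix n n ℂ} (hf : MDeriv f f') :
    HasDerivAt (fun z => (f z).trace) f'.trace 0 := by
  simp only [Matrix.trace, Matrix.diag]
  exact HasDerivAt.fun_sum fun k _ => hf k k

/-- One-parameter family of complex powers. -/
structure PowFam (p : ℂ → Matrix n n ℂ) (L : Matrix n n ℂ) : Prop where
  good : MGood p
  deriv : MDeriv p L
  zero : p 0 = 1
  add : ∀ z w, p z * p w = p (z + w)
  conj : ∀ z, (p z)ᴴ = p (star z)

/-- Hilbert–Schmidt Cauchy–Schwarz. -/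
theorem norm_trace_mul_le (A B : Matrix n n ℂ) {t : ℝ} (ht : 0 ≤ t)
    (hA : (A * Aᴴ).trace = t) (hB : (Bᴴ * B).trace = t) : ‖(A * B).trace‖ ≤ t := by
  have h1 : ∑ x : n × n, ‖A x.1 x.2‖ ^ 2 = t := by
    have : ((∑ x : n × n, ‖A x.1 x.2‖ ^ 2 : ℝ) : ℂ) = t := by
      rw [← hA, Fintype.sum_prod_type]
      simp [Matrix.trace, Matrix.mul_apply, Complex.mul_conj']
    exact_mod_cast this
  have h2 : ∑ x : n × n, ‖B x.2 x.1‖ ^ 2 = t := by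
    have : ((∑ x : n × n, ‖B x.2 x.1‖ ^ 2 : ℝ) : ℂ) = t := by
      rw [← hB, Fintype.sum_prod_type]
      simp [Matrix.trace, Matrix.mul_apply, Complex.conj_mul']
    exact_mod_cast this
  have h3 : ‖(A * B).trace‖ ≤ ∑ x : n × n, ‖A x.1 x.2‖ * ‖B x.2 x.1‖ := by
    rw [Fintype.sum_prod_type]
    simp only [Matrix.trace, Matrix.diag, Matrix.mul_apply]
    refine (norm_sum_le _ _).trans (Finset.sum_le_sum fun i _ => ?_)
    refine (norm_sum_le _ _).trans (Finset.sum_le_sum fun j _ => ?_)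
    rw [norm_mul]
  have h4 := Finset.sum_mul_sq_le_sq_mul_sq (Finset.univ : Finset (n × n))
    (fun x => ‖A x.1 x.2‖) (fun x => ‖B x.2 x.1‖)
  rw [h1, h2] at h4
  refine h3.trans ?_
  exact abs_le_of_sq_le_sq' (by nlinarith) ht |>.2

theorem deriv_nonpos_of_max {g : ℝ → ℝ} {g' : ℝ} (h : HasDerivAt g g' 0)
    (hmax : ∀ t, 0 ≤ t → t ≤ 1 / 2 → g t ≤ g 0) : g' ≤ 0 := by
  have h1 := (hasDerivWithinAt_iff_tendsto_slope' (s := Set.Ioi (0 : ℝ)) (by simp)).1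
    (h.hasDerivWithinAt (s := Set.Ioi (0 : ℝ)))
  refine le_of_tendsto h1 ?_
  have : Set.Ioo (0 : ℝ) (1 / 2) ∈ nhdsWithin (0 : ℝ) (Set.Ioi 0) :=
    Ioo_mem_nhdsGT (by norm_num)
  filter_upwards [this] with t ht
  rw [slope_def_field]
  exact div_nonpos_of_nonpos_of_nonneg (by linarith [hmax t ht.1.le ht.2.le]) (by linarith [ht.1])

theorem core {p0 p1 p2 p3 : ℂ → Matrix n n ℂ} {L0 L1 L2 L3 : Matrix n n ℂ}
    (h0 : PowFam p0 L0) (h1 : PowFam p1 L1) (h2 : PowFam p2 L2) (h3 : PowFam p3 L3)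
    {t : ℝ} (ht : 0 < t) (htr : (p0 1).trace = t)
    (hsand : ∀ z : ℂ, z + star z = 1 →
      (p1 1 * (p2 (-z) * p3 1 * p2 (-star z))).trace = t) :
    ((p0 1 * (-L0 + L1 - L2 + L3)).trace).re ≤ 0 := by
  set G : ℂ → Matrix n n ℂ := fun z => p0 1 * (p0 (-z) * (p1 z * (p2 (-z) * p3 z))) with hG
  have hgood : Good (fun z => (G z).trace) :=
    MGood.trace ((MGood.const _).mul (h0.good.neg_arg.mul (h1.good.mul
      (h2.good.neg_arg.mul h3.good))))
  have hder : HasDerivAt (fun z => (G z).trace) ((p0 1 * (-L0 + L1 - L2 + L3)).trace) 0 := by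
    have := MDeriv.trace ((MDeriv.const (p0 1)).mul (h0.deriv.neg_arg.mul (h1.deriv.mul
      (h2.deriv.neg_arg.mul h3.deriv))))
    convert this using 2
    simp only [neg_zero, h0.zero, h1.zero, h2.zero, h3.zero, mul_one, one_mul, zero_mul, zero_add]
    congr 1
    abel
  have hG0 : (G 0).trace = t := by
    simp [hG, h0.zero, h1.zero, h2.zero, h3.zero, htr]
  have hb : ∀ z : ℂ, z.re = 0 ∨ z.re = 1 / 2 → ‖(G z).trace‖ ≤ t := by
    rintro z (hz | hz)
    · have hzz : star z = -z := by
        apply Complex.ext <;> simp [hz]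
      have e : G z = p0 (1 / 2) * (p0 (1 / 2) * (p0 (-z) * (p1 z * (p2 (-z) * p3 z)))) := by
        rw [← mul_assoc (p0 (1/2)) (p0 (1/2)), h0.add]; norm_num [hG]
      rw [e]
      apply norm_trace_mul_le _ _ ht.le
      · rw [h0.conj, h0.add, ← htr]
        congr 2
        apply Complex.ext <;> norm_num
      · rw [Matrix.trace_mul_comm]
        have u : ∀ {p : ℂ → Matrix n n ℂ} {L : Matrix n n ℂ}, PowFam p L → ∀ X,
            p z * (X * (p (-z))) = p z * X * (p z)ᴴ := by
          intro p L hp X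
          rw [hp.conj, hzz, mul_assoc]
        have c3 : p3 z * (p3 z)ᴴ = 1 := by
          rw [h3.conj, hzz, h3.add]; simp [h3.zero]
        have c1 : p1 z * (p1 z)ᴴ = 1 := by
          rw [h1.conj, hzz, h1.add]; simp [h1.zero]
        have c2 : p2 (-z) * (p2 (-z))ᴴ = 1 := by
          rw [h2.conj, star_neg, hzz, h2.add]; simp [h2.zero]
        have c0 : p0 (-z) * (p0 (-z))ᴴ = 1 := by
          rw [h0.conj, star_neg, hzz, h0.add]; simp [h0.zero]
        have : ∀ A B C D E : Matrix n n ℂ, B * Bᴴ = 1 → C * Cᴴ = 1 → D * Dᴴ = 1 → E * Eᴴ = 1 →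
            (A * (B * (C * (D * E)))) * (A * (B * (C * (D * E))))ᴴ = A * Aᴴ := by
          intro A B C D E hB hC hD hE
          simp only [Matrix.conjTranspose_mul]
          calc _ = A * (B * (C * (D * (E * Eᴴ) * Dᴴ) * Cᴴ) * Bᴴ) * Aᴴ := by
                simp only [mul_assoc]
            _ = _ := by simp [hB, hC, hD, hE]
        rw [this _ _ _ _ _ c0 c1 c2 c3, h0.conj, h0.add, ← htr]
        congr 2
        apply Complex.ext <;> norm_num
    · have hzz : z + star z = 1 := by
        apply Complex.ext <;> simp [hz]; norm_num
      have e : G z = p0 (1 - z) * (p1 z * (p2 (-z) * p3 z)) := by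
        simp only [hG]
        rw [← mul_assoc, h0.add]; rfl
      rw [e]
      apply norm_trace_mul_le _ _ ht.le
      · rw [h0.conj, h0.add, ← htr]
        congr 2
        rw [star_sub, star_one]; linear_combination -hzz
      · rw [← hsand z hzz]
        simp only [Matrix.conjTranspose_mul, h1.conj, h2.conj, h3.conj]
        rw [star_neg]
        calc _ = ((p3 (star z) * (p2 (-star z) * (p1 (star z) * p1 z) * p2 (-z))) * p3 z).trace := by
              simp only [mul_assoc]
          _ = ((p3 z * p3 (star z)) * (p2 (-star z) * (p1 (star z) * p1 z) * p2 (-z))).trace := by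
              rw [Matrix.trace_mul_comm]; simp only [mul_assoc]
          _ = (((p3 1 * p2 (-star z)) * p1 1) * p2 (-z)).trace := by
              rw [h3.add, h1.add, hzz, add_comm, hzz]
              simp only [mul_assoc]
          _ = _ := by
              rw [Matrix.trace_mul_comm, ← mul_assoc, Matrix.trace_mul_comm, mul_assoc]
  have hstrip : ∀ s : ℝ, 0 ≤ s → s ≤ 1 / 2 → ‖(G s).trace‖ ≤ t := by
    intro s hs0 hs1
    have hsub : ∀ z : ℂ, z ∈ Complex.HadamardThreeLines.verticalClosedStrip 0 (1 / 2) →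
        |z.re| ≤ 1 := by
      intro z hz
      have : z.re ∈ Set.Icc (0 : ℝ) (1 / 2) := hz
      rw [abs_of_nonneg this.1]; linarith [this.2]
    have := Complex.HadamardThreeLines.norm_le_interp_of_mem_verticalClosedStrip'
      (f := fun z => (G z).trace) (z := (s : ℂ)) (a := t) (b := t) (l := 0) (u := 1 / 2)
      (by norm_num) (by
        change ((s : ℂ)).re ∈ Set.Icc (0 : ℝ) (1 / 2)
        simpa using ⟨hs0, by linarith⟩) hgood.1.diffContOnCl
      (by
        obtain ⟨C, hC⟩ := hgood.2
        refine ⟨C, ?_⟩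
        rintro _ ⟨z, hz, rfl⟩
        exact hC z (hsub z hz))
      (fun z hz => hb z (Or.inl hz)) (fun z hz => hb z (Or.inr hz))
    refine this.trans (le_of_eq ?_)
    rw [← Real.rpow_add ht]
    simp
  have hre : HasDerivAt (fun s : ℝ => ((G s).trace).re)
      (((p0 1 * (-L0 + L1 - L2 + L3)).trace).re) 0 := by
    have : HasDerivAt (fun z => (G z).trace) ((p0 1 * (-L0 + L1 - L2 + L3)).trace) ((0 : ℝ) : ℂ) := by
      simpa using hder
    exact this.real_of_complex
  refine deriv_nonpos_of_max hre fun s hs0 hs1 => ?_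
  calc ((G s).trace).re ≤ ‖(G s).trace‖ := Complex.re_le_norm _
    _ ≤ t := hstrip s hs0 hs1
    _ = _ := by simp [hG0]

end
end CohInfo

namespace CohInfo
section
variable {n : Type*} [Fintype n] [DecidableEq n]

theorem vnEntropy_eq_roots {M : Matrix n n ℂ} (h : M.IsHermitian) :
    vnEntropy M = (M.charpoly.roots.map (fun z : ℂ => Real.negMulLog z.re)).sum := by
  rw [vnEntropy, dif_pos h, h.roots_charpoly_eq_eigenvalues, Multiset.map_map]
  rfl

theorem vnEntropy_of_diag {M U V : Matrix n n ℂ} (d : n → ℝ) (hM : M.IsHermitian)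
    (hVU : V * U = 1)
    (h : M = U * Matrix.diagonal (fun i => (d i : ℂ)) * V) :
    vnEntropy M = ∑ i, Real.negMulLog (d i) := by
  have hc : M.charpoly = (Matrix.diagonal (fun i => (d i : ℂ))).charpoly := by
    rw [h, Matrix.charpoly_mul_comm, ← mul_assoc, hVU, one_mul]
  rw [vnEntropy_eq_roots hM, hc, Matrix.charpoly_diagonal, Polynomial.roots_prod _ _
    (Finset.prod_ne_zero_iff.2 fun i _ => Polynomial.X_sub_C_ne_zero _)]
  simp [Multiset.bind_singleton]

theorem vnEntropy_mul_conjTranspose {m : Type*} [Fintype m] [DecidableEq m] (W : Matrix m n ℂ) :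
    vnEntropy (W * Wᴴ) = vnEntropy (Wᵀ * (Wᵀ)ᴴ) := by
  have h1 := (Matrix.posSemidef_self_mul_conjTranspose W).isHermitian
  have h2 := (Matrix.posSemidef_self_mul_conjTranspose Wᵀ).isHermitian
  have e : (Wᵀ * (Wᵀ)ᴴ).charpoly = (Wᴴ * W).charpoly := by
    rw [← Matrix.charpoly_transpose (Wᴴ * W), Matrix.transpose_mul]
    congr 1
  rw [vnEntropy_eq_roots h1, vnEntropy_eq_roots h2, e]
  have hc := congrArg (fun p => (p.roots.map (fun z : ℂ => Real.negMulLog z.re)).sum)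
    (Matrix.charpoly_mul_comm' W Wᴴ)
  rw [Polynomial.roots_mul, Polynomial.roots_mul] at hc
  · simpa [Multiset.map_nsmul, Multiset.sum_nsmul] using hc
  · exact mul_ne_zero (pow_ne_zero _ Polynomial.X_ne_zero) (Matrix.charpoly_monic _).ne_zero
  · exact mul_ne_zero (pow_ne_zero _ Polynomial.X_ne_zero) (Matrix.charpoly_monic _).ne_zero

theorem spectral {M : Matrix n n ℂ} (h : M.IsHermitian) :
    ∃ U : Matrix n n ℂ, U * Uᴴ = 1 ∧ Uᴴ * U = 1 ∧
      M = U * Matrix.diagonal (fun i => (h.eigenvalues i : ℂ)) * Uᴴ := by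
  refine ⟨h.eigenvectorUnitary, ?_, ?_, ?_⟩
  · exact Unitary.coe_mul_star_self h.eigenvectorUnitary
  · exact Unitary.coe_star_mul_self h.eigenvectorUnitary
  · have := h.spectral_theorem
    rw [Unitary.conjStarAlgAut_apply] at this
    exact this

theorem vnEntropy_add_smul {M : Matrix n n ℂ} (h : M.IsHermitian) (c : ℝ) :
    vnEntropy (M + (c : ℂ) • (1 : Matrix n n ℂ)) = ∑ i, Real.negMulLog (h.eigenvalues i + c) := by
  obtain ⟨U, hU1, hU2, hM⟩ := spectral h
  refine vnEntropy_of_diag (U := U) (V := Uᴴ) _ ?_ hU2 ?_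
  · refine h.add ?_
    rw [Matrix.IsHermitian, Matrix.conjTranspose_smul]; simp
  · have : Matrix.diagonal (fun i => ((h.eigenvalues i + c : ℝ) : ℂ)) =
        Matrix.diagonal (fun i => (h.eigenvalues i : ℂ)) + (c : ℂ) • 1 := by
      ext i j
      by_cases hij : i = j
      · subst hij; simp
      · simp [hij]
    rw [this, mul_add, add_mul, ← hM]
    simp [hU1]

theorem tendsto_entropy {M : Matrix n n ℂ} (h : M.IsHermitian) (k : ℝ) :
    Filter.Tendsto (fun ε : ℝ => vnEntropy (M + ((ε * k : ℝ) : ℂ) • (1 : Matrix n n ℂ)))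
      (nhdsWithin 0 (Set.Ioi 0)) (nhds (vnEntropy M)) := by
  have h0 : vnEntropy M = ∑ i, Real.negMulLog (h.eigenvalues i + 0 * k) := by
    rw [vnEntropy, dif_pos h]; simp
  rw [h0]
  simp only [vnEntropy_add_smul h]
  refine Filter.Tendsto.mono_left ?_ nhdsWithin_le_nhds
  have : Continuous (fun ε : ℝ => ∑ i, Real.negMulLog (h.eigenvalues i + ε * k)) := by
    refine continuous_finsetSum _ fun i _ => ?_
    exact Real.continuous_negMulLog.comp (by fun_prop)
  exact this.tendsto 0

theorem exists_pow {X : Matrix n n ℂ} (hX : X.PosDef) :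
    ∃ p L, PowFam p L ∧ p 1 = X ∧ ((X * L).trace).re = - vnEntropy X := by
  have h := hX.isHermitian
  obtain ⟨U, hU1, hU2, hM⟩ := spectral h
  set l : n → ℝ := fun i => Real.log (h.eigenvalues i) with hl
  have hpos := hX.eigenvalues_pos
  have hexp : ∀ i, Complex.exp (l i) = h.eigenvalues i := by
    intro i
    rw [← Complex.ofReal_exp, hl, Real.exp_log (hpos i)]
  refine ⟨fun z => U * Matrix.diagonal (fun i => Complex.exp (z * l i)) * Uᴴ,
    U * Matrix.diagonal (fun i => (l i : ℂ)) * Uᴴ, ⟨?_, ?_, ?_, ?_, ?_⟩, ?_, ?_⟩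
  · refine ((MGood.const U).mul ?_).mul (MGood.const Uᴴ)
    intro i j
    by_cases hij : i = j
    · subst hij; simpa using Good.exp (l i)
    · simpa [hij] using Good.const 0
  · have hd : MDeriv (fun z => Matrix.diagonal (fun i => Complex.exp (z * l i)))
        (Matrix.diagonal (fun i => (l i : ℂ))) := by
      intro i j
      by_cases hij : i = j
      · subst hij
        have := ((hasDerivAt_id (0 : ℂ)).mul_const (l i : ℂ)).cexp
        simpa using this
      · simpa [hij] using hasDerivAt_const (0 : ℂ) (0 : ℂ)
    have := ((MDeriv.const U).mul hd).mul (MDeriv.const Uᴴ)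
    simpa using this
  · simp [hU1]
  · intro z w
    calc _ = U * (Matrix.diagonal (fun i => Complex.exp (z * l i)) * (Uᴴ * U) *
          Matrix.diagonal (fun i => Complex.exp (w * l i))) * Uᴴ := by simp only [mul_assoc]
      _ = _ := by
        rw [hU2, mul_one, Matrix.diagonal_mul_diagonal]
        simp only [← Complex.exp_add, add_mul]
  · intro z
    simp only [Matrix.conjTranspose_mul, Matrix.conjTranspose_conjTranspose,
      Matrix.diagonal_conjTranspose, mul_assoc]
    congr 3
    ext i
    simp [← Complex.exp_conj]
  · simp only [one_mul, hexp]
    exact hM.symm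
  · have : (X * (U * Matrix.diagonal (fun i => (l i : ℂ)) * Uᴴ)).trace =
        ∑ i, (h.eigenvalues i : ℂ) * l i := by
      calc _ = (U * (Matrix.diagonal (fun i => (h.eigenvalues i : ℂ)) * (Uᴴ * U) *
            Matrix.diagonal (fun i => (l i : ℂ))) * Uᴴ).trace := by
            conv_lhs => rw [hM]
            simp only [mul_assoc]
        _ = _ := by
          rw [hU2, mul_one, Matrix.diagonal_mul_diagonal, Matrix.trace_mul_comm, ← mul_assoc, hU2,
            one_mul, Matrix.trace_diagonal]
    rw [this, vnEntropy, dif_pos h, ← Finset.sum_neg_distrib, Complex.re_sum]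
    refine Finset.sum_congr rfl fun i _ => ?_
    rw [← Complex.ofReal_mul, Complex.ofReal_re, Real.negMulLog, hl]
    ring

theorem PowFam.kron_one {m : Type*} [Fintype m] [DecidableEq m] {p L}
    (h : PowFam (n := n) p L) :
    PowFam (fun z => p z ⊗ₖ (1 : Matrix m m ℂ)) (L ⊗ₖ (1 : Matrix m m ℂ)) where
  good i j := (h.good i.1 j.1).mul (Good.const _)
  deriv i j := (h.deriv i.1 j.1).mul_const _
  zero := by simp [h.zero]
  add z w := by rw [← Matrix.mul_kronecker_mul, h.add, mul_one]
  conj z := by rw [Matrix.conjTranspose_kronecker, h.conj, Matrix.conjTranspose_one]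

theorem PowFam.one_kron {m : Type*} [Fintype m] [DecidableEq m] {p L}
    (h : PowFam (n := n) p L) :
    PowFam (fun z => (1 : Matrix m m ℂ) ⊗ₖ p z) ((1 : Matrix m m ℂ) ⊗ₖ L) where
  good i j := (Good.const _).mul (h.good i.2 j.2)
  deriv i j := (h.deriv i.2 j.2).const_mul _
  zero := by simp [h.zero]
  add z w := by rw [← Matrix.mul_kronecker_mul, h.add, mul_one]
  conj z := by rw [Matrix.conjTranspose_kronecker, h.conj, Matrix.conjTranspose_one]

theorem PowFam.submatrix {m : Type*} [Fintype m] [DecidableEq m] {p L}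
    (h : PowFam (n := n) p L) (e : m ≃ n) :
    PowFam (fun z => (p z).submatrix e e) (L.submatrix e e) where
  good i j := h.good (e i) (e j)
  deriv i j := h.deriv (e i) (e j)
  zero := by simp [h.zero]
  add z w := by rw [Matrix.submatrix_mul_equiv, h.add]
  conj z := by rw [Matrix.conjTranspose_submatrix, h.conj]

end

section
variable {A B C : Type*} [Fintype A] [Fintype B] [Fintype C]
  [DecidableEq A] [DecidableEq B] [DecidableEq C]

/-- Partial trace over the last factor of a triple. -/
def trC (ρ : Matrix (A × B × C) (A × B × C) ℂ) : Matrix (A × B) (A × B) ℂ :=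
  ∑ c, ρ.submatrix (fun x : A × B => (x.1, x.2, c)) (fun x : A × B => (x.1, x.2, c))

/-- Partial trace over the first factor. -/
def trA {A D : Type*} [Fintype A] (ρ : Matrix (A × D) (A × D) ℂ) : Matrix D D ℂ :=
  ∑ a, ρ.submatrix (fun x : D => (a, x)) (fun x : D => (a, x))

def embAB (X : Matrix (A × B) (A × B) ℂ) : Matrix (A × B × C) (A × B × C) ℂ :=
  (X ⊗ₖ (1 : Matrix C C ℂ)).submatrix (Equiv.prodAssoc A B C).symm (Equiv.prodAssoc A B C).symm

def embBC (X : Matrix (B × C) (B × C) ℂ) : Matrix (A × B × C) (A × B × C) ℂ :=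
  (1 : Matrix A A ℂ) ⊗ₖ X

def embB (X : Matrix B B ℂ) : Matrix (A × B × C) (A × B × C) ℂ :=
  embBC (X ⊗ₖ (1 : Matrix C C ℂ))

theorem trace_embAB (ρ : Matrix (A × B × C) (A × B × C) ℂ) (X : Matrix (A × B) (A × B) ℂ) :
    (ρ * embAB X).trace = (trC ρ * X).trace := by
  simp only [Matrix.trace, Matrix.diag, Matrix.mul_apply, trC, embAB, Matrix.sum_apply,
    Fintype.sum_prod_type, Matrix.submatrix_apply, Matrix.kroneckerMap_apply, Matrix.one_apply,
    Equiv.prodAssoc_symm_apply, mul_ite, mul_one, mul_zero, Finset.sum_ite_eq', Finset.mem_univ,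
    if_true, Finset.sum_mul]
  refine Finset.sum_congr rfl fun a _ => Finset.sum_congr rfl fun b _ => ?_
  rw [Finset.sum_comm]
  refine Finset.sum_congr rfl fun a' _ => ?_
  rw [Finset.sum_comm]

theorem trace_embBC {A D : Type*} [Fintype A] [DecidableEq A] [Fintype D]
    (ρ : Matrix (A × D) (A × D) ℂ) (X : Matrix D D ℂ) :
    (ρ * ((1 : Matrix A A ℂ) ⊗ₖ X)).trace = (trA ρ * X).trace := by
  simp only [Matrix.trace, Matrix.diag, Matrix.mul_apply, trA, Matrix.sum_apply,
    Fintype.sum_prod_type, Matrix.submatrix_apply, Matrix.kroneckerMap_apply, Matrix.one_apply,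
    ite_mul, one_mul, zero_mul, mul_ite, mul_zero, Finset.sum_mul]
  rw [Finset.sum_comm]
  refine Finset.sum_congr rfl fun d _ => ?_
  rw [Finset.sum_comm]
  simp only [Finset.sum_comm (s := (Finset.univ : Finset A)) (t := (Finset.univ : Finset D))]
  refine Finset.sum_congr rfl fun d' _ => ?_
  rw [Finset.sum_comm]
  simp

/-- Partial trace over the second factor of a pair. -/
def ptC (X : Matrix (B × C) (B × C) ℂ) : Matrix B B ℂ :=
  Matrix.of fun b b' => ∑ c, X (b, c) (b', c)

theorem trC_embBC (X : Matrix (B × C) (B × C) ℂ) :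
    trC (embBC (A := A) X) = (1 : Matrix A A ℂ) ⊗ₖ ptC X := by
  ext ⟨a, b⟩ ⟨a', b'⟩
  simp [trC, embBC, ptC, Matrix.sum_apply, Finset.mul_sum]

theorem trA_trC (ρ : Matrix (A × B × C) (A × B × C) ℂ) (b b' : B) :
    trA (trC ρ) b b' = ∑ c, trA ρ (b, c) (b', c) := by
  simp only [trA, trC, Matrix.sum_apply, Matrix.submatrix_apply]
  rw [Finset.sum_comm]

theorem ptrace_sandwich (X : Matrix (B × C) (B × C) ℂ) (y y' : Matrix B B ℂ) :
    ptC ((y ⊗ₖ (1 : Matrix C C ℂ)) * X * (y' ⊗ₖ (1 : Matrix C C ℂ))) = y * ptC X * y' := by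
  ext b b'
  simp only [ptC, Matrix.of_apply, Matrix.mul_apply, Fintype.sum_prod_type, Matrix.kroneckerMap_apply, Matrix.one_apply,
    mul_ite, mul_one, mul_zero, ite_mul, zero_mul, Finset.sum_ite_eq, Finset.sum_ite_eq',
    Finset.mem_univ, if_true, Finset.sum_mul, Finset.mul_sum]
  rw [Finset.sum_comm]
  refine Finset.sum_congr rfl fun x _ => ?_
  rw [Finset.sum_comm]

theorem ssa_posDef {ρ : Matrix (A × B × C) (A × B × C) ℂ} (h0 : ρ.PosDef)
    (h1 : (trC ρ).PosDef) (h3 : (trA ρ).PosDef) (h2 : (trA (trC ρ)).PosDef)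
    (ht : 0 < ρ.trace) :
    vnEntropy (trA (trC ρ)) + vnEntropy ρ ≤ vnEntropy (trC ρ) + vnEntropy (trA ρ) := by
  obtain ⟨p0, L0, f0, e0, s0⟩ := exists_pow h0
  obtain ⟨p1, L1, f1, e1, s1⟩ := exists_pow h1
  obtain ⟨p2, L2, f2, e2, s2⟩ := exists_pow h2
  obtain ⟨p3, L3, f3, e3, s3⟩ := exists_pow h3
  have g1 : PowFam (fun z => embAB (C := C) (p1 z)) (embAB L1) := f1.kron_one.submatrix _
  have g2 : PowFam (fun z => embB (A := A) (C := C) (p2 z)) (embB L2) := f2.kron_one.one_kron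
  have g3 : PowFam (fun z => embBC (A := A) (p3 z)) (embBC L3) := f3.one_kron
  obtain ⟨htr, hti⟩ := Complex.pos_iff.1 ht
  have htt : ρ.trace = ((ρ.trace).re : ℂ) := by
    apply Complex.ext <;> simp [← hti]
  have trAB : (trC ρ).trace = ρ.trace := by
    have := trace_embAB ρ 1
    simpa [embAB] using this.symm
  have hB : ptC (trA ρ) = trA (trC ρ) := by
    ext b b'; exact (trA_trC ρ b b').symm
  have key := core f0 g1 g2 g3 htr (by rw [e0]; exact htt) (by
    intro z hz
    simp only [e1, e3, embB]
    have : embBC (A := A) (p2 (-z) ⊗ₖ (1 : Matrix C C ℂ)) * embBC (trA ρ) *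
        embBC (p2 (-star z) ⊗ₖ (1 : Matrix C C ℂ)) =
        embBC (p2 (-z) ⊗ₖ (1 : Matrix C C ℂ) * trA ρ * p2 (-star z) ⊗ₖ (1 : Matrix C C ℂ)) := by
      simp only [embBC, ← Matrix.mul_kronecker_mul, mul_one]
    rw [this, Matrix.trace_mul_comm, trace_embAB, trC_embBC, ptrace_sandwich, hB]
    conv_lhs => rw [← e2]
    rw [f2.add, f2.add]
    have : -z + 1 + -star z = 0 := by linear_combination -hz
    rw [this, f2.zero, Matrix.one_kronecker_one, one_mul, trAB]
    exact htt)
  have k1 : (ρ * embB L2).trace = (trA (trC ρ) * L2).trace := by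
    have : embB (A := A) (C := C) L2 = embAB ((1 : Matrix A A ℂ) ⊗ₖ L2) := by
      ext ⟨a, b, c⟩ ⟨a', b', c'⟩
      simp [embB, embAB, embBC, mul_assoc]
    rw [this, trace_embAB, trace_embBC]
  rw [e0, mul_add, mul_sub, mul_add, mul_neg, Matrix.trace_add, Matrix.trace_sub, Matrix.trace_add,
    Matrix.trace_neg, trace_embAB, k1, embBC, trace_embBC] at key
  simp only [Complex.add_re, Complex.sub_re, Complex.neg_re, s0, s1, s2, s3] at key
  linarith

theorem trC_psd {ρ : Matrix (A × B × C) (A × B × C) ℂ} (h : ρ.PosSemidef) :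
    (trC ρ).PosSemidef := Matrix.posSemidef_sum _ fun c _ => h.submatrix _

theorem trA_psd {A D : Type*} [Fintype A] {ρ : Matrix (A × D) (A × D) ℂ} (h : ρ.PosSemidef) :
    (trA ρ).PosSemidef := Matrix.posSemidef_sum _ fun c _ => h.submatrix _

theorem trC_add_smul (ρ : Matrix (A × B × C) (A × B × C) ℂ) (c : ℝ) :
    trC (ρ + (c : ℂ) • (1 : Matrix _ _ ℂ)) = trC ρ + ((c * Fintype.card C : ℝ) : ℂ) • 1 := by
  ext ⟨a, b⟩ ⟨a', b'⟩
  simp only [trC, Matrix.sum_apply, Matrix.add_apply, Matrix.smul_apply, Matrix.submatrix_apply,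
    Matrix.one_apply, Finset.sum_add_distrib, Prod.mk.injEq, and_true]
  by_cases h : a = a' ∧ b = b' <;> simp [h, mul_comm]

theorem trA_add_smul {A D : Type*} [Fintype A] [DecidableEq A] [DecidableEq D]
    (ρ : Matrix (A × D) (A × D) ℂ) (c : ℝ) :
    trA (ρ + (c : ℂ) • (1 : Matrix _ _ ℂ)) = trA ρ + ((c * Fintype.card A : ℝ) : ℂ) • 1 := by
  ext d d'
  simp only [trA, Matrix.sum_apply, Matrix.add_apply, Matrix.smul_apply, Matrix.submatrix_apply,
    Matrix.one_apply, Finset.sum_add_distrib, Prod.mk.injEq, true_and]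
  by_cases h : d = d' <;> simp [h, mul_comm]

theorem psd_add_smul {n : Type*} [Fintype n] [DecidableEq n] {M : Matrix n n ℂ}
    (h : M.PosSemidef) {c : ℝ} (hc : 0 < c) : (M + (c : ℂ) • (1 : Matrix n n ℂ)).PosDef :=
  Matrix.PosDef.posSemidef_add h (Matrix.PosDef.one.smul (by exact_mod_cast hc))

theorem ssa [Nonempty A] [Nonempty B] [Nonempty C]
    {ρ : Matrix (A × B × C) (A × B × C) ℂ} (h : ρ.PosSemidef) :
    vnEntropy (trA (trC ρ)) + vnEntropy ρ ≤ vnEntropy (trC ρ) + vnEntropy (trA ρ) := by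
  have hA : (0 : ℝ) < Fintype.card A := by exact_mod_cast Fintype.card_pos
  have hC : (0 : ℝ) < Fintype.card C := by exact_mod_cast Fintype.card_pos
  have t0 := tendsto_entropy h.isHermitian 1
  have t1 := tendsto_entropy (trC_psd h).isHermitian (Fintype.card C)
  have t2 := tendsto_entropy (trA_psd (trC_psd h)).isHermitian (Fintype.card C * Fintype.card A)
  have t3 := tendsto_entropy (trA_psd h).isHermitian (Fintype.card A)
  refine le_of_tendsto_of_tendsto (t2.add t0) (t1.add t3) ?_
  filter_upwards [self_mem_nhdsWithin] with ε hε
  have hε : 0 < ε := hε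
  have e1 := trC_add_smul ρ ε
  have e3 := trA_add_smul ρ ε
  have e2 := trA_add_smul (trC ρ) (ε * Fintype.card C)
  rw [← e1] at e2
  have d0 := psd_add_smul h hε
  have := ssa_posDef d0 (by rw [e1]; exact psd_add_smul (trC_psd h) (by positivity))
    (by rw [e3]; exact psd_add_smul (trA_psd h) (by positivity))
    (by rw [e2]; exact psd_add_smul (trA_psd (trC_psd h)) (by positivity)) d0.trace_pos
  rw [e2, e1, e3] at this
  simpa [mul_assoc] using this

end
end CohInfo

namespace CohInfo
section
variable {A B C D : Type*} [Fintype A] [Fintype B] [Fintype C] [Fintype D]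
  [DecidableEq A] [DecidableEq B] [DecidableEq C] [DecidableEq D]

def rAB (v : A → B → C → D → ℂ) : Matrix (A × B) (A × B) ℂ :=
  Matrix.of fun p q => ∑ c, ∑ d, v p.1 p.2 c d * star (v q.1 q.2 c d)

def rAC (v : A → B → C → D → ℂ) : Matrix (A × C) (A × C) ℂ :=
  Matrix.of fun p q => ∑ b, ∑ d, v p.1 b p.2 d * star (v q.1 b q.2 d)

theorem weak_mono [Nonempty A] [Nonempty B] [Nonempty D] (v : A → B → C → D → ℂ) :
    vnEntropy (redSnd (rAB v)) + vnEntropy (redSnd (rAC v)) ≤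
      vnEntropy (rAB v) + vnEntropy (rAC v) := by
  let W : Matrix C (A × B × D) ℂ := Matrix.of fun c x => v x.1 x.2.1 c x.2.2
  let W' : Matrix (A × C) (B × D) ℂ := Matrix.of fun p x => v p.1 x.1 p.2 x.2
  have h := ssa (Matrix.posSemidef_self_mul_conjTranspose Wᵀ)
  rw [← vnEntropy_mul_conjTranspose W] at h
  have e1 : trC (Wᵀ * (Wᵀ)ᴴ) = rAB v := by
    ext ⟨a, b⟩ ⟨a', b'⟩
    simp only [trC, rAB, W, Matrix.sum_apply, Matrix.submatrix_apply, Matrix.mul_apply,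
      Matrix.transpose_apply, Matrix.conjTranspose_apply, Matrix.of_apply]
    rw [Finset.sum_comm]
  have e2 : trA (Wᵀ * (Wᵀ)ᴴ) = W'ᵀ * (W'ᵀ)ᴴ := by
    ext ⟨b, d⟩ ⟨b', d'⟩
    simp only [trA, W, W', Matrix.sum_apply, Matrix.submatrix_apply, Matrix.mul_apply,
      Matrix.transpose_apply, Matrix.conjTranspose_apply, Matrix.of_apply, Fintype.sum_prod_type]
  have e3 : W' * W'ᴴ = rAC v := by
    ext ⟨a, c⟩ ⟨a', c'⟩
    simp only [rAC, W', Matrix.mul_apply,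
      Matrix.conjTranspose_apply, Matrix.of_apply, Fintype.sum_prod_type]
  have e4 : W * Wᴴ = redSnd (rAC v) := by
    ext c c'
    simp only [rAC, redSnd, W, Matrix.mul_apply,
      Matrix.conjTranspose_apply, Matrix.of_apply, Fintype.sum_prod_type]
  have e5 : trA (rAB v) = redSnd (rAB v) := by
    ext b b'
    simp only [trA, redSnd, Matrix.sum_apply, Matrix.submatrix_apply]
  rw [e1, e2, ← vnEntropy_mul_conjTranspose W', e3, e4, e5] at h
  exact h

end

section
variable {a b f a' b' : Type*} [Fintype a] [Fintype b] [Fintype f] [Fintype a'] [Fintype b']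
  [DecidableEq a] [DecidableEq b] [DecidableEq f] [DecidableEq a'] [DecidableEq b']
  {n m : ℕ}

/-- Stinespring-dilated global vector. -/
def dil (K : Fin n → Matrix a' a ℂ) (L : Fin m → Matrix b' b ℂ) (w : a × b × b × f → ℂ) :
    a' → b' → b' → (Fin n × Fin m × Fin m × f) → ℂ :=
  fun x y y' d => ∑ c, L d.2.2.1 y' c *
    ∑ p : a × b, K d.1 x p.1 * L d.2.1 y p.2 * w (p.1, p.2, c, d.2.2.2)

theorem isom (L : Fin m → Matrix b' b ℂ) (hL : ∑ j, (L j)ᴴ * L j = 1) (x y : b → ℂ) :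
    ∑ j, ∑ c', (∑ c, L j c' c * x c) * star (∑ c, L j c' c * y c) = ∑ c, x c * star (y c) := by
  have h : ∀ c1 c2, ∑ j, ∑ c', star (L j c' c2) * L j c' c1 = if c2 = c1 then 1 else 0 := by
    intro c1 c2
    have := congrFun (congrFun hL c2) c1
    simpa [Matrix.sum_apply, Matrix.mul_apply, Matrix.one_apply] using this
  calc _ = ∑ j, ∑ c', ∑ c1, ∑ c2, (star (L j c' c2) * L j c' c1) * (x c1 * star (y c2)) := by
        refine Finset.sum_congr rfl fun j _ => Finset.sum_congr rfl fun c' _ => ?_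
        rw [star_sum, Finset.sum_mul_sum]
        refine Finset.sum_congr rfl fun c1 _ => Finset.sum_congr rfl fun c2 _ => ?_
        rw [star_mul']; ring
    _ = ∑ c1, ∑ c2, (∑ j, ∑ c', star (L j c' c2) * L j c' c1) * (x c1 * star (y c2)) := by
        simp only [Finset.sum_mul]
        simp only [Finset.sum_comm (s := (Finset.univ : Finset b')) (t := (Finset.univ : Finset b))]
        simp only [Finset.sum_comm (s := (Finset.univ : Finset (Fin m)))
          (t := (Finset.univ : Finset b))]
    _ = _ := by
        simp only [h]
        simp

theorem rAB_dil (K : Fin n → Matrix a' a ℂ) (L : Fin m → Matrix b' b ℂ)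
    (hL : ∑ j, (L j)ᴴ * L j = 1) (w : a × b × b × f → ℂ) :
    rAB (dil K L w) = channelOut K L (redAB (Matrix.vecMulVec w (star w))) := by
  let Wm : Matrix (a × b) (b × f) ℂ := Matrix.of fun p s => w (p.1, p.2, s.1, s.2)
  have hW : redAB (Matrix.vecMulVec w (star w)) = Wm * Wmᴴ := by
    ext p q
    simp [redAB, Wm, Matrix.mul_apply, Matrix.vecMulVec_apply, Fintype.sum_prod_type]
  have hc : channelOut K L (redAB (Matrix.vecMulVec w (star w))) =
      ∑ i, ∑ j, ((K i ⊗ₖ L j) * Wm) * ((K i ⊗ₖ L j) * Wm)ᴴ := by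
    rw [hW, channelOut]
    simp only [Matrix.conjTranspose_mul, Matrix.mul_assoc]
  rw [hc]
  ext ⟨x, y⟩ ⟨x', y'⟩
  simp only [rAB, dil, Matrix.of_apply, Matrix.sum_apply, Fintype.sum_prod_type (α₁ := Fin n),
    Fintype.sum_prod_type (α₁ := Fin m)]
  rw [Finset.sum_comm]
  refine Finset.sum_congr rfl fun i _ => ?_
  rw [Finset.sum_comm]
  refine Finset.sum_congr rfl fun j _ => ?_
  rw [Finset.sum_comm]
  have hM : ∀ (x : a') (y : b') (c : b) (g : f), ((K i ⊗ₖ L j) * Wm) (x, y) (c, g) =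
      ∑ p : a × b, K i x p.1 * L j y p.2 * w (p.1, p.2, c, g) := by
    intro x y c g
    simp [Matrix.mul_apply, Wm]
  simp only [← hM]
  rw [Matrix.mul_apply, Fintype.sum_prod_type]
  conv_rhs => rw [Finset.sum_comm]
  simp only [Matrix.conjTranspose_apply]
  have := fun g : f => isom L hL (fun c => ((K i ⊗ₖ L j) * Wm) (x, y) (c, g))
    (fun c => ((K i ⊗ₖ L j) * Wm) (x', y') (c, g))
  refine Eq.trans ?_ (Finset.sum_congr rfl fun g _ => this g)
  rw [Finset.sum_comm (s := (Finset.univ : Finset f))]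
  refine Finset.sum_congr rfl fun k _ => ?_
  rw [Finset.sum_comm]

theorem rAC_dil (K : Fin n → Matrix a' a ℂ) (L : Fin m → Matrix b' b ℂ)
    (hL : ∑ j, (L j)ᴴ * L j = 1) (w : a × b × b × f → ℂ) :
    rAC (dil K L w) = channelOut K L (redAE0 (Matrix.vecMulVec w (star w))) := by
  let w' : a × b × b × f → ℂ := fun p => w (p.1, p.2.2.1, p.2.1, p.2.2.2)
  have h1 : redAE0 (Matrix.vecMulVec w (star w)) = redAB (Matrix.vecMulVec w' (star w')) := by
    ext p q
    simp [redAE0, redAB, w', Matrix.vecMulVec_apply]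
  have h2 : ∀ x y y' i j k g, dil K L w x y y' (i, j, k, g) = dil K L w' x y' y (i, k, j, g) := by
    intro x y y' i j k g
    simp only [dil, w', Fintype.sum_prod_type, Finset.mul_sum]
    rw [Finset.sum_comm]
    conv_rhs => rw [Finset.sum_comm]
    refine Finset.sum_congr rfl fun p _ => ?_
    rw [Finset.sum_comm]
    refine Finset.sum_congr rfl fun q _ => Finset.sum_congr rfl fun r _ => ?_
    ring
  rw [h1, ← rAB_dil K L hL]
  ext ⟨x, y⟩ ⟨x', y'⟩
  simp only [rAB, rAC, Matrix.of_apply, Fintype.sum_prod_type, h2]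
  refine Finset.sum_congr rfl fun c _ => Finset.sum_congr rfl fun i _ => ?_
  rw [Finset.sum_comm]

theorem kraus_nonempty [Nonempty a] (K : Fin n → Matrix a' a ℂ) (hK : ∑ i, (K i)ᴴ * K i = 1) :
    Nonempty (Fin n) := by
  by_contra h
  rw [not_nonempty_iff] at h
  rw [Finset.univ_eq_empty, Finset.sum_empty] at hK
  exact zero_ne_one hK

end
end CohInfo

/-- **Theorem 1 of the paper.** For a pure density matrix `ρ` on `a × b × e0 × f` whose
environment subsystem `e0` shares correlations with `a` exactly as `b` does
(`ρ^{a b} = ρ^{a e0}`), any local operations — a quantum channel `M` (Kraus operators `K`)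
at `A` and a quantum channel `N` (Kraus operators `L`) at `B`, with no classical
communication — produce a state `σ = (M ⊗ N)(ρ^{a b})` with nonpositive coherent
information toward `B`: `S(σ^{b'}) ≤ S(σ)`. -/
theorem coherent_info_nonpos_after_local_ops
    {ιa ιb ιf ιa' ιb' : Type*}
    [Fintype ιa] [Fintype ιb] [Fintype ιf] [Fintype ιa'] [Fintype ιb']
    [DecidableEq ιa] [DecidableEq ιb] [DecidableEq ιf] [DecidableEq ιa'] [DecidableEq ιb']
    [Nonempty ιa] [Nonempty ιb] [Nonempty ιf] [Nonempty ιa'] [Nonempty ιb']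
    (ρ : Matrix (ιa × ιb × ιb × ιf) (ιa × ιb × ιb × ιf) ℂ)
    (hpure : IsPureDensityMatrix ρ)
    (hmirror : redAB ρ = redAE0 ρ)
    {n m : ℕ} (K : Fin n → Matrix ιa' ιa ℂ) (L : Fin m → Matrix ιb' ιb ℂ)
    (hK : ∑ i : Fin n, (K i)ᴴ * K i = 1)
    (hL : ∑ j : Fin m, (L j)ᴴ * L j = 1) :
    vnEntropy (redSnd (channelOut K L (redAB ρ)))
      ≤ vnEntropy (channelOut K L (redAB ρ)) := by
  classical
  obtain ⟨-, w, -, rfl⟩ := hpure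
  have := CohInfo.kraus_nonempty K hK
  have := CohInfo.kraus_nonempty L hL
  have h := CohInfo.weak_mono (CohInfo.dil K L w)
  rw [CohInfo.rAB_dil K L hL, CohInfo.rAC_dil K L hL, ← hmirror] at h
  linarith
end

section
/- Let ι_a, ι_b, ι_{e0}, ι_f, ι_{a'}, ι_{b'} be nonempty finite types with ι_b = ι_{e0}, and let ρ be a pure density matrix on ι_a × ι_b × ι_{e0} × ι_f with ρ^{a b} = ρ^{a e0} as matrices indexed by ι_a × ι_b. Consider, over all quantum channels M from ι_a to ι_{a'} (given in Kraus form by K_i : Matrix ι_{a'} ι_a ℂ, ∑_i K_iᴴ K_i = 1) and all quantum channels N from ι_b to ι_{b'} (given in Kraus form by L_j : Matrix ι_{b'} ι_b ℂ, ∑_j L_jᴴ L_j = 1), the quantity I(M, N) := S(σ^{b'}) − S(σ) where σ := ∑_{i,j} (K_i ⊗ L_j) ρ^{a b} (K_i ⊗ L_j)ᴴ. Then: (1) I(M, N) ≤ 0 for every such pair of channels, and (2) there exists a pair of channels with I(M, N) = 0 (e.g. channels that discard the input and prepare fixed pure states). Hence the supremum of I(M, N) over all pairs of local channels equals 0. 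-/
open Matrix ComplexOrder

open Kronecker

/-- The coherent information toward `B'` of the output of the local channels with Kraus
families `K` and `L` applied to the bipartite state `ρab`. -/
noncomputable def coherentInfoOut {ιa ιb ιa' ιb' : Type*}
    [Fintype ιa] [Fintype ιb] [Fintype ιa'] [Fintype ιb']
    [DecidableEq ιa'] [DecidableEq ιb']
    {n m : ℕ} (K : Fin n → Matrix ιa' ιa ℂ) (L : Fin m → Matrix ιb' ιb ℂ)
    (ρab : Matrix (ιa × ιb) (ιa × ιb) ℂ) : ℝ :=
  vnEntropy (redSnd (channelOut K L ρab)) - vnEntropy (channelOut K L ρab)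


lemma scalar_cont {κ : Type*} [Fintype κ] (c p q : κ → ℝ) (hp : ∀ k, 0 ≤ p k)
    (hq : ∀ k, 0 ≤ q k) (hs : ∀ k, q k = 0 → c k * p k = 0) :
    ContinuousOn (fun s : ℝ => ∑ k, c k * p k * Real.log ((1 - s) * q k + s * p k))
      (Set.Icc 0 1) := by
  refine continuousOn_finsetSum _ fun k _ => ?_
  by_cases h : c k * p k = 0
  · simp only [h, zero_mul]; exact continuousOn_const
  · refine continuousOn_const.mul (ContinuousOn.log (by fun_prop) ?_)
    intro s hs1
    have hq0 : 0 < q k := lt_of_le_of_ne (hq k) fun h0 => h (hs k h0.symm)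
    have hp0 : 0 < p k := lt_of_le_of_ne (hp k) fun h0 => h (by rw [← h0, mul_zero])
    rcases eq_or_lt_of_le hs1.1 with h0 | h0
    · subst h0; simpa using hq0.ne'
    · have := mul_pos h0 hp0
      have := mul_nonneg (sub_nonneg.2 hs1.2) hq0.le
      positivity

lemma scalar_der {κ : Type*} [Fintype κ] (c p q : κ → ℝ) (hp : ∀ k, 0 ≤ p k)
    (hq : ∀ k, 0 ≤ q k) (hs : ∀ k, q k = 0 → c k * p k = 0) (s : ℝ) (h0 : 0 < s) (h1 : s < 1) :
    HasDerivAt (fun s : ℝ => ∑ k, c k * p k * Real.log ((1 - s) * q k + s * p k))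
      ((∑ k, c k * p k ^ 2 / ((1 - s) * q k + s * p k) - ∑ k, c k * p k) / (1 - s)) s := by
  rw [← Finset.sum_sub_distrib, Finset.sum_div]
  refine HasDerivAt.fun_sum fun k _ => ?_
  by_cases h : c k * p k = 0
  · have : c k * p k ^ 2 = 0 := by rw [pow_two, ← mul_assoc, h, zero_mul]
    simp only [h, this, zero_mul, zero_div, sub_zero]; exact hasDerivAt_const _ _
  · have hq0 : 0 < q k := lt_of_le_of_ne (hq k) fun h0 => h (hs k h0.symm)
    have hp0 : 0 < p k := lt_of_le_of_ne (hp k) fun h0 => h (by rw [← h0, mul_zero])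
    have h2 : 0 < 1 - s := by linarith
    have hm : 0 < (1 - s) * q k + s * p k := by positivity
    have d : HasDerivAt (fun s : ℝ => (1 - s) * q k + s * p k) (-1 * q k + 1 * p k) s :=
      (((hasDerivAt_id s).const_sub 1).mul_const _).add ((hasDerivAt_id s).mul_const _)
    have := (d.log hm.ne').const_mul (c k * p k)
    refine this.congr_deriv ?_
    generalize hM : (1 - s) * q k + s * p k = M at hm
    rw [eq_comm, div_eq_iff h2.ne', sub_eq_iff_eq_add, div_eq_iff hm.ne']
    have e : c k * p k * ((-1 * q k + 1 * p k) / M) * M = c k * p k * (-1 * q k + 1 * p k) := by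
      field_simp
    have e2 : (c k * p k * ((-1 * q k + 1 * p k) / M) * (1 - s) + c k * p k) * M
      = c k * p k * ((-1 * q k + 1 * p k) / M) * M * (1 - s) + c k * p k * M := by ring
    rw [e2, e, ← hM]
    ring

lemma scalar_mono {κ κ' : Type*} [Fintype κ] [Fintype κ']
    (c p q : κ → ℝ) (c' p' q' : κ' → ℝ)
    (hp : ∀ k, 0 ≤ p k) (hq : ∀ k, 0 ≤ q k) (hs : ∀ k, q k = 0 → c k * p k = 0)
    (hp' : ∀ k, 0 ≤ p' k) (hq' : ∀ k, 0 ≤ q' k) (hs' : ∀ k, q' k = 0 → c' k * p' k = 0)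
    (htr : ∑ k, c k * p k = ∑ k, c' k * p' k)
    (hG : ∀ s : ℝ, 0 < s → s < 1 →
      ∑ k, c' k * p' k ^ 2 / ((1 - s) * q' k + s * p' k)
        ≤ ∑ k, c k * p k ^ 2 / ((1 - s) * q k + s * p k)) :
    ∑ k, c' k * p' k * Real.log (p' k) - ∑ k, c' k * p' k * Real.log (q' k)
      ≤ ∑ k, c k * p k * Real.log (p k) - ∑ k, c k * p k * Real.log (q k) := by
  have mono : MonotoneOn (fun s : ℝ => ∑ k, c k * p k * Real.log ((1 - s) * q k + s * p k)
      - ∑ k, c' k * p' k * Real.log ((1 - s) * q' k + s * p' k)) (Set.Icc 0 1) := by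
    refine monotoneOn_of_deriv_nonneg (convex_Icc 0 1)
      ((scalar_cont c p q hp hq hs).sub (scalar_cont c' p' q' hp' hq' hs')) ?_ ?_
    · intro s hs1
      rw [interior_Icc] at hs1
      exact ((scalar_der c p q hp hq hs s hs1.1 hs1.2).sub
        (scalar_der c' p' q' hp' hq' hs' s hs1.1 hs1.2)).differentiableAt.differentiableWithinAt
    · intro s hs1
      rw [interior_Icc] at hs1
      have := ((scalar_der c p q hp hq hs s hs1.1 hs1.2).sub (scalar_der c' p' q' hp' hq' hs' s hs1.1 hs1.2)).deriv
      refine this.ge.trans' ?_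
      rw [← sub_div]
      refine div_nonneg ?_ (by linarith [hs1.2])
      have := hG s hs1.1 hs1.2
      linarith
  have := mono (Set.left_mem_Icc.2 zero_le_one) (Set.right_mem_Icc.2 zero_le_one) zero_le_one
  simp only [sub_zero, one_mul, zero_mul, add_zero, sub_self, zero_add] at this
  linarith

/-- The variational functional. -/
noncomputable def qf {ι : Type*} [Fintype ι] (s : ℝ) (P Q Y : Matrix ι ι ℂ) : ℝ :=
  2 * (P * Y).trace.re - (1 - s) * (Y * Q * Yᴴ).trace.re - s * (Yᴴ * P * Y).trace.re

lemma qf_eq {ι : Type*} [Fintype ι] [DecidableEq ι] (s : ℝ) (U V Z : Matrix ι ι ℂ)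
    (p q : ι → ℝ) (hU : Uᴴ * U = 1) (hV : Vᴴ * V = 1) :
    qf s (U * diagonal (fun i => (p i : ℂ)) * Uᴴ) (V * diagonal (fun i => (q i : ℂ)) * Vᴴ)
      (U * Z * Vᴴ) = ∑ k : ι × ι, (2 * (p k.1 * (Z k.1 k.2 * star ((Uᴴ * V) k.1 k.2)).re)
        - ((1 - s) * q k.2 + s * p k.1) * Complex.normSq (Z k.1 k.2)) := by
  have e1 : (U * diagonal (fun i => (p i : ℂ)) * Uᴴ * (U * Z * Vᴴ)).trace
      = (diagonal (fun i => (p i : ℂ)) * (Z * (Uᴴ * V)ᴴ)).trace := by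
    rw [conjTranspose_mul, conjTranspose_conjTranspose]
    calc _ = (U * (diagonal (fun i => (p i : ℂ)) * (Uᴴ * U) * Z * Vᴴ)).trace := by
          simp only [Matrix.mul_assoc]
      _ = _ := by rw [hU, trace_mul_comm]; simp only [Matrix.mul_assoc, Matrix.mul_one]
  have e2 : (U * Z * Vᴴ * (V * diagonal (fun i => (q i : ℂ)) * Vᴴ) * (U * Z * Vᴴ)ᴴ).trace
      = (Z * diagonal (fun i => (q i : ℂ)) * Zᴴ).trace := by
    simp only [conjTranspose_mul, conjTranspose_conjTranspose]
    calc _ = (U * (Z * (Vᴴ * V) * diagonal (fun i => (q i : ℂ)) * (Vᴴ * V) * Zᴴ * Uᴴ)).trace := by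
          simp only [Matrix.mul_assoc]
      _ = ((Z * (Vᴴ * V) * diagonal (fun i => (q i : ℂ)) * (Vᴴ * V) * Zᴴ) * (Uᴴ * U)).trace := by
          rw [trace_mul_comm]; simp only [Matrix.mul_assoc]
      _ = _ := by rw [hU, hV]; simp only [Matrix.mul_one]
  have e3 : ((U * Z * Vᴴ)ᴴ * (U * diagonal (fun i => (p i : ℂ)) * Uᴴ) * (U * Z * Vᴴ)).trace
      = (Zᴴ * diagonal (fun i => (p i : ℂ)) * Z).trace := by
    simp only [conjTranspose_mul, conjTranspose_conjTranspose]
    calc _ = (V * (Zᴴ * (Uᴴ * U) * diagonal (fun i => (p i : ℂ)) * (Uᴴ * U) * Z * Vᴴ)).trace := by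
          simp only [Matrix.mul_assoc]
      _ = ((Zᴴ * (Uᴴ * U) * diagonal (fun i => (p i : ℂ)) * (Uᴴ * U) * Z) * (Vᴴ * V)).trace := by
          rw [trace_mul_comm]; simp only [Matrix.mul_assoc]
      _ = _ := by rw [hU, hV]; simp only [Matrix.mul_one]
  rw [qf, e1, e2, e3]
  generalize Uᴴ * V = C
  have f1 : (diagonal (fun i => (p i : ℂ)) * (Z * Cᴴ)).trace.re
      = ∑ i, ∑ j, p i * (Z i j * star (C i j)).re := by
    simp only [trace, diag_apply, diagonal_mul, Complex.re_sum]
    refine Finset.sum_congr rfl fun i _ => ?_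
    rw [Complex.re_ofReal_mul, mul_apply, Complex.re_sum, Finset.mul_sum]
    rfl
  have f2 : (Z * diagonal (fun i => (q i : ℂ)) * Zᴴ).trace.re
      = ∑ i, ∑ j, q j * Complex.normSq (Z i j) := by
    simp only [trace, diag_apply, Complex.re_sum, Matrix.mul_apply (N := Zᴴ), mul_diagonal]
    refine Finset.sum_congr rfl fun i _ => Finset.sum_congr rfl fun j _ => ?_
    simp [Complex.normSq_apply]; ring
  have f3 : (Zᴴ * diagonal (fun i => (p i : ℂ)) * Z).trace.re
      = ∑ i, ∑ j, p i * Complex.normSq (Z i j) := by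
    rw [Finset.sum_comm]
    simp only [trace, diag_apply, Complex.re_sum, Matrix.mul_apply (N := Z), mul_diagonal]
    refine Finset.sum_congr rfl fun i _ => Finset.sum_congr rfl fun j _ => ?_
    simp [Complex.normSq_apply]; ring
  rw [f1, f2, f3, Fintype.sum_prod_type]
  simp only [Finset.mul_sum, ← Finset.sum_sub_distrib]
  refine Finset.sum_congr rfl fun i _ => Finset.sum_congr rfl fun j _ => ?_
  ring

lemma qf_le {ι : Type*} [Fintype ι] [DecidableEq ι] (s : ℝ) (h0 : 0 < s) (h1 : s < 1)
    (U V Y : Matrix ι ι ℂ)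
    (p q : ι → ℝ) (hU : Uᴴ * U = 1) (hV : Vᴴ * V = 1) (hp : ∀ i, 0 ≤ p i) (hq : ∀ i, 0 ≤ q i) :
    qf s (U * diagonal (fun i => (p i : ℂ)) * Uᴴ) (V * diagonal (fun i => (q i : ℂ)) * Vᴴ) Y
      ≤ ∑ k : ι × ι, Complex.normSq ((Uᴴ * V) k.1 k.2) * p k.1 ^ 2 /
        ((1 - s) * q k.2 + s * p k.1) := by
  have hU' : U * Uᴴ = 1 := mul_eq_one_comm.1 hU
  have hV' : V * Vᴴ = 1 := mul_eq_one_comm.1 hV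
  have hY : Y = U * (Uᴴ * Y * V) * Vᴴ := by
    calc Y = (U * Uᴴ) * Y * (V * Vᴴ) := by rw [hU', hV']; simp
      _ = _ := by simp only [Matrix.mul_assoc]
  rw [hY, qf_eq s U V _ p q hU hV]
  generalize Uᴴ * Y * V = Z
  generalize Uᴴ * V = C
  refine Finset.sum_le_sum fun k _ => ?_
  have hs : 0 < 1 - s := by linarith
  rcases eq_or_lt_of_le (hp k.1) with h | h
  · rw [← h]
    have := mul_nonneg (mul_nonneg hs.le (hq k.2)) (Complex.normSq_nonneg (Z k.1 k.2))
    simp; linarith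
  · have hm : 0 < (1 - s) * q k.2 + s * p k.1 := by
      have := mul_nonneg hs.le (hq k.2)
      have := mul_pos h0 h
      linarith
    rw [le_div_iff₀ hm]
    generalize (1 - s) * q k.2 + s * p k.1 = M at *
    simp only [Complex.normSq_apply, Complex.star_def, Complex.mul_re, Complex.conj_re,
      Complex.conj_im]
    nlinarith [sq_nonneg (M * (Z k.1 k.2).re - p k.1 * (C k.1 k.2).re),
      sq_nonneg (M * (Z k.1 k.2).im - p k.1 * (C k.1 k.2).im)]

lemma exists_qf_eq {ι : Type*} [Fintype ι] [DecidableEq ι] (s : ℝ) (h0 : 0 < s) (h1 : s < 1)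
    (U V : Matrix ι ι ℂ)
    (p q : ι → ℝ) (hU : Uᴴ * U = 1) (hV : Vᴴ * V = 1) (hp : ∀ i, 0 ≤ p i) (hq : ∀ i, 0 ≤ q i) :
    ∃ Y, qf s (U * diagonal (fun i => (p i : ℂ)) * Uᴴ) (V * diagonal (fun i => (q i : ℂ)) * Vᴴ) Y
      = ∑ k : ι × ι, Complex.normSq ((Uᴴ * V) k.1 k.2) * p k.1 ^ 2 /
        ((1 - s) * q k.2 + s * p k.1) := by
  refine ⟨U * (Matrix.of fun i j => ((p i / ((1 - s) * q j + s * p i) : ℝ) : ℂ) * (Uᴴ * V) i j)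
    * Vᴴ, ?_⟩
  rw [qf_eq s U V _ p q hU hV]
  generalize Uᴴ * V = C
  refine Finset.sum_congr rfl fun k _ => ?_
  have hs : 0 < 1 - s := by linarith
  rcases eq_or_lt_of_le (hp k.1) with h | h
  · simp [← h]
  · have hm : 0 < (1 - s) * q k.2 + s * p k.1 := by
      have := mul_nonneg hs.le (hq k.2)
      have := mul_pos h0 h
      linarith
    simp only [of_apply]
    generalize (1 - s) * q k.2 + s * p k.1 = M at *
    rw [mul_assoc, Complex.re_ofReal_mul, map_mul, Complex.normSq_ofReal, Complex.star_def,
      Complex.mul_conj, Complex.ofReal_re]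
    field_simp
    ring

lemma row_sum {ι : Type*} [Fintype ι] [DecidableEq ι] (U V : Matrix ι ι ℂ)
    (hU : Uᴴ * U = 1) (hV : Vᴴ * V = 1) (i : ι) :
    ∑ j, Complex.normSq ((Uᴴ * V) i j) = 1 := by
  have hV' : V * Vᴴ = 1 := mul_eq_one_comm.1 hV
  have h : (Uᴴ * V) * (Uᴴ * V)ᴴ = 1 := by
    rw [conjTranspose_mul, conjTranspose_conjTranspose, Matrix.mul_assoc, ← Matrix.mul_assoc V,
      hV', Matrix.one_mul, hU]
  have := congrFun (congrFun h i) i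
  rw [mul_apply, one_apply_eq] at this
  apply Complex.ofReal_injective
  push_cast
  rw [← this]
  exact Finset.sum_congr rfl fun j _ => by
    rw [conjTranspose_apply, Complex.star_def, Complex.mul_conj]

/-- Abstract monotonicity of relative entropy. -/
lemma rel_mono {ι ι' : Type*} [Fintype ι] [DecidableEq ι] [Fintype ι'] [DecidableEq ι']
    (U V : Matrix ι ι ℂ) (p q : ι → ℝ) (hU : Uᴴ * U = 1) (hV : Vᴴ * V = 1)
    (hp : ∀ i, 0 ≤ p i) (hq : ∀ i, 0 ≤ q i)
    (hs : ∀ i j, q j = 0 → Complex.normSq ((Uᴴ * V) i j) * p i = 0)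
    (U' V' : Matrix ι' ι' ℂ) (p' q' : ι' → ℝ) (hU' : U'ᴴ * U' = 1) (hV' : V'ᴴ * V' = 1)
    (hp' : ∀ i, 0 ≤ p' i) (hq' : ∀ i, 0 ≤ q' i)
    (hs' : ∀ i j, q' j = 0 → Complex.normSq ((U'ᴴ * V') i j) * p' i = 0)
    (P Q : Matrix ι ι ℂ) (P' Q' : Matrix ι' ι' ℂ)
    (hP : P = U * diagonal (fun i => (p i : ℂ)) * Uᴴ)
    (hQ : Q = V * diagonal (fun i => (q i : ℂ)) * Vᴴ)
    (hP' : P' = U' * diagonal (fun i => (p' i : ℂ)) * U'ᴴ)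
    (hQ' : Q' = V' * diagonal (fun i => (q' i : ℂ)) * V'ᴴ)
    (htr : ∑ i, p i = ∑ i, p' i)
    (hY : ∀ s Y', ∃ Y, qf s P Q Y = qf s P' Q' Y') :
    ∑ i, p' i * Real.log (p' i)
        - ∑ j, (∑ i, Complex.normSq ((U'ᴴ * V') i j) * p' i) * Real.log (q' j)
      ≤ ∑ i, p i * Real.log (p i)
        - ∑ j, (∑ i, Complex.normSq ((Uᴴ * V) i j) * p i) * Real.log (q j) := by
  have key := scalar_mono (κ := ι × ι) (κ' := ι' × ι')
    (fun k => Complex.normSq ((Uᴴ * V) k.1 k.2)) (fun k => p k.1) (fun k => q k.2)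
    (fun k => Complex.normSq ((U'ᴴ * V') k.1 k.2)) (fun k => p' k.1) (fun k => q' k.2)
    (fun k => hp _) (fun k => hq _) (fun k => hs _ _)
    (fun k => hp' _) (fun k => hq' _) (fun k => hs' _ _) ?_ ?_
  · simp only [Fintype.sum_prod_type, mul_assoc, ← Finset.sum_mul,
      row_sum U V hU hV, row_sum U' V' hU' hV', one_mul] at key
    rw [Finset.sum_comm (γ := ι), Finset.sum_comm (γ := ι')] at key
    simpa only [Finset.sum_mul, mul_assoc] using key
  · simp only [Fintype.sum_prod_type, ← Finset.sum_mul,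
      row_sum U V hU hV, row_sum U' V' hU' hV', one_mul]
    exact htr
  · intro s h0 h1
    obtain ⟨Y', hY'⟩ := exists_qf_eq s h0 h1 U' V' p' q' hU' hV' hp' hq'
    obtain ⟨Y, hYY⟩ := hY s Y'
    rw [← hP', ← hQ', ← hYY] at hY'
    have := qf_le s h0 h1 U V Y p q hU hV hp hq
    rw [← hP, ← hQ, hY'] at this
    exact this

lemma vnEntropy_eq_roots {ι : Type*} [Fintype ι] [DecidableEq ι] {M : Matrix ι ι ℂ}
    (h : M.IsHermitian) :
    vnEntropy M = (M.charpoly.roots.map (fun z => Real.negMulLog z.re)).sum := by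
  rw [vnEntropy, dif_pos h, h.roots_charpoly_eq_eigenvalues, Multiset.map_map]
  simp

lemma vnEntropy_transpose {ι : Type*} [Fintype ι] [DecidableEq ι] {M : Matrix ι ι ℂ}
    (h : M.IsHermitian) : vnEntropy Mᵀ = vnEntropy M := by
  rw [vnEntropy_eq_roots h, vnEntropy_eq_roots h.transpose, charpoly_transpose]

lemma vnEntropy_mul_comm {ι κ : Type*} [Fintype ι] [DecidableEq ι] [Fintype κ] [DecidableEq κ]
    (M : Matrix ι κ ℂ) : vnEntropy (M * Mᴴ) = vnEntropy (Mᴴ * M) := by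
  rw [vnEntropy_eq_roots (isHermitian_mul_conjTranspose_self M),
    vnEntropy_eq_roots (isHermitian_conjTranspose_mul_self M)]
  have h := congrArg (fun P : Polynomial ℂ => (P.roots.map (fun z => Real.negMulLog z.re)).sum)
    (charpoly_mul_comm' M Mᴴ)
  rw [Polynomial.roots_mul ((Polynomial.monic_X_pow _).mul (charpoly_monic _)).ne_zero,
    Polynomial.roots_mul ((Polynomial.monic_X_pow _).mul (charpoly_monic _)).ne_zero] at h
  simpa [Multiset.map_nsmul, Multiset.sum_nsmul] using h

lemma exists_spectral {ι : Type*} [Fintype ι] [DecidableEq ι] {M : Matrix ι ι ℂ}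
    (h : M.PosSemidef) : ∃ (U : Matrix ι ι ℂ) (p : ι → ℝ), Uᴴ * U = 1 ∧ (∀ i, 0 ≤ p i) ∧
      M = U * diagonal (fun i => (p i : ℂ)) * Uᴴ ∧
      ∑ i, p i * Real.log (p i) = - vnEntropy M := by
  refine ⟨h.1.eigenvectorUnitary, h.1.eigenvalues, ?_, h.eigenvalues_nonneg, ?_, ?_⟩
  · exact Unitary.coe_star_mul_self _
  · exact h.1.spectral_theorem
  · rw [vnEntropy, dif_pos h.1, ← Finset.sum_neg_distrib]
    simp [Real.negMulLog]

section
variable {A E G : Type*} [Fintype A] [Fintype E] [Fintype G]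

/-- Partial trace over the last factor. -/
noncomputable def trG (M : Matrix (A × E × G) (A × E × G) ℂ) : Matrix (A × E) (A × E) ℂ :=
  fun x y => ∑ g, M (x.1, x.2, g) (y.1, y.2, g)

lemma posSemidef_redSnd {M : Matrix (A × E) (A × E) ℂ} (h : M.PosSemidef) :
    (redSnd M).PosSemidef := by
  have : redSnd M = ∑ x : A, M.submatrix (fun p => (x, p)) (fun p => (x, p)) := by
    ext p q
    simp [redSnd, Matrix.sum_apply]
  rw [this]
  exact posSemidef_sum _ fun x _ => h.submatrix _

lemma posSemidef_trG {M : Matrix (A × E × G) (A × E × G) ℂ} (h : M.PosSemidef) :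
    (trG M).PosSemidef := by
  have : trG M = ∑ g : G, M.submatrix (fun p => (p.1, p.2, g)) (fun p => (p.1, p.2, g)) := by
    ext p q
    simp [trG, Matrix.sum_apply]
  rw [this]
  exact posSemidef_sum _ fun x _ => h.submatrix _

variable [DecidableEq A] [DecidableEq E] [DecidableEq G]

/-- `Y ⊗ 1_G`. -/
noncomputable def extG (Y : Matrix (A × E) (A × E) ℂ) : Matrix (A × E × G) (A × E × G) ℂ :=
  (Y ⊗ₖ (1 : Matrix G G ℂ)).submatrix (Equiv.prodAssoc A E G).symm (Equiv.prodAssoc A E G).symm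

lemma trace_mul_extG (M : Matrix (A × E × G) (A × E × G) ℂ) (Y : Matrix (A × E) (A × E) ℂ) :
    (M * extG Y).trace = (trG M * Y).trace := by
  simp only [trace, diag_apply, mul_apply, extG, submatrix_apply, kronecker_apply, trG,
    Equiv.prodAssoc_symm_apply, Fintype.sum_prod_type, one_apply, Finset.sum_mul]
  simp only [mul_ite, mul_one, mul_zero, Finset.sum_ite_eq', Finset.mem_univ, if_true]
  refine Finset.sum_congr rfl fun a _ => Finset.sum_congr rfl fun e _ => ?_
  rw [Finset.sum_comm]
  exact Finset.sum_congr rfl fun a' _ => Finset.sum_comm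

lemma extG_mul (Y Z : Matrix (A × E) (A × E) ℂ) :
    (extG (Y * Z) : Matrix (A × E × G) (A × E × G) ℂ) = extG Y * extG Z := by
  rw [extG, extG, extG, submatrix_mul_equiv, ← mul_kronecker_mul, Matrix.one_mul]

lemma extG_conjTranspose (Y : Matrix (A × E) (A × E) ℂ) :
    (extG Yᴴ : Matrix (A × E × G) (A × E × G) ℂ) = (extG Y)ᴴ := by
  rw [extG, extG, conjTranspose_submatrix, conjTranspose_kronecker, conjTranspose_one]

lemma redSnd_conj (P : Matrix (A × E) (A × E) ℂ) (W : Matrix E E ℂ) :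
    redSnd (((1 : Matrix A A ℂ) ⊗ₖ W)ᴴ * P * ((1 : Matrix A A ℂ) ⊗ₖ W)) = Wᴴ * redSnd P * W := by
  ext k l
  simp only [redSnd, mul_apply, conjTranspose_apply, kronecker_apply, Fintype.sum_prod_type,
    one_apply, Finset.sum_mul, Finset.mul_sum, ite_mul, mul_ite, one_mul, zero_mul, mul_zero,
    star_zero, apply_ite star, Finset.sum_ite_eq, Finset.sum_ite_eq', Finset.mem_univ, if_true,
    Finset.sum_ite_irrel, Finset.sum_const_zero]
  rw [Finset.sum_comm]
  exact Finset.sum_congr rfl fun a' _ => Finset.sum_comm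

lemma cond_sum (P U : Matrix (A × E) (A × E) ℂ) (W : Matrix E E ℂ) (p : A × E → ℝ) (r : E → ℝ)
    (hP : P = U * diagonal (fun i => (p i : ℂ)) * Uᴴ) (hW : Wᴴ * W = 1)
    (hR : redSnd P = W * diagonal (fun i => (r i : ℂ)) * Wᴴ) (k : E) :
    ∑ a, ∑ i, Complex.normSq ((Uᴴ * ((1 : Matrix A A ℂ) ⊗ₖ W)) i (a, k)) * p i = r k := by
  have h := congrFun (congrFun (redSnd_conj P W) k) k
  have h2 : Wᴴ * redSnd P * W = diagonal (fun i => (r i : ℂ)) := by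
    rw [hR]
    calc _ = (Wᴴ * W) * diagonal (fun i => (r i : ℂ)) * (Wᴴ * W) := by
          simp only [Matrix.mul_assoc]
      _ = _ := by rw [hW]; simp
  rw [h2, diagonal_apply_eq] at h
  apply Complex.ofReal_injective
  rw [← h]
  push_cast
  refine Finset.sum_congr rfl fun a _ => ?_
  have : ((1 : Matrix A A ℂ) ⊗ₖ W)ᴴ * P * ((1 : Matrix A A ℂ) ⊗ₖ W)
      = (Uᴴ * ((1 : Matrix A A ℂ) ⊗ₖ W))ᴴ * diagonal (fun i => (p i : ℂ)) *
        (Uᴴ * ((1 : Matrix A A ℂ) ⊗ₖ W)) := by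
    rw [hP, conjTranspose_mul Uᴴ, conjTranspose_conjTranspose]
    simp only [Matrix.mul_assoc]
  rw [this]
  generalize Uᴴ * ((1 : Matrix A A ℂ) ⊗ₖ W) = C
  rw [mul_apply]
  refine Finset.sum_congr rfl fun i _ => ?_
  rw [mul_diagonal, conjTranspose_apply, Complex.star_def, Complex.normSq_eq_conj_mul_self]
  ring

lemma trG_one_kronecker (M : Matrix (A × E × G) (A × E × G) ℂ) :
    trG ((1 : Matrix A A ℂ) ⊗ₖ redSnd M) = (1 : Matrix A A ℂ) ⊗ₖ redSnd (trG M) := by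
  ext x y
  simp only [trG, redSnd, kronecker_apply, ← Finset.mul_sum]
  rw [Finset.sum_comm]
  rfl

lemma one_kron_spec {A E : Type*} [Fintype A] [Fintype E] [DecidableEq A] [DecidableEq E]
    (W : Matrix E E ℂ) (r : E → ℝ) :
    (1 : Matrix A A ℂ) ⊗ₖ (W * diagonal (fun i => (r i : ℂ)) * Wᴴ)
      = ((1 : Matrix A A ℂ) ⊗ₖ W) * diagonal (fun i : A × E => (r i.2 : ℂ))
        * ((1 : Matrix A A ℂ) ⊗ₖ W)ᴴ := by
  have : diagonal (fun i : A × E => (r i.2 : ℂ))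
      = (1 : Matrix A A ℂ) ⊗ₖ diagonal (fun i => (r i : ℂ)) := by
    rw [← diagonal_one, diagonal_kronecker_diagonal]; simp
  rw [this, conjTranspose_kronecker, ← mul_kronecker_mul, ← mul_kronecker_mul]
  simp

/-- Strong subadditivity of the von Neumann entropy. -/
lemma ssa (M : Matrix (A × E × G) (A × E × G) ℂ) (h : M.PosSemidef) :
    vnEntropy M + vnEntropy (redSnd (trG M)) ≤ vnEntropy (redSnd M) + vnEntropy (trG M) := by
  obtain ⟨U, p, hU, hp, hM, hS⟩ := exists_spectral h
  obtain ⟨W, r, hW, hr, hR, hSR⟩ := exists_spectral (posSemidef_redSnd h)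
  obtain ⟨U', p', hU', hp', hM', hS'⟩ := exists_spectral (posSemidef_trG h)
  obtain ⟨W', r', hW', hr', hR', hSR'⟩ := exists_spectral (posSemidef_redSnd (posSemidef_trG h))
  have c := cond_sum M U W p r hM hW hR
  have c' := cond_sum (trG M) U' W' p' r' hM' hW' hR'
  have htr : ∑ i, p i = ∑ i, p' i := by
    have t : M.trace = (trG M).trace := by
      simp only [trace, diag_apply, trG, Fintype.sum_prod_type]
    have e1 : M.trace = ((∑ i, p i : ℝ) : ℂ) := by
      rw [hM, trace_mul_comm, ← Matrix.mul_assoc, hU, Matrix.one_mul, trace_diagonal]; simp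
    have e2 : (trG M).trace = ((∑ i, p' i : ℝ) : ℂ) := by
      rw [hM', trace_mul_comm, ← Matrix.mul_assoc, hU', Matrix.one_mul, trace_diagonal]; simp
    exact Complex.ofReal_injective (by rw [← e1, ← e2, t])
  have key := rel_mono U ((1 : Matrix A A ℂ) ⊗ₖ W) p (fun i => r i.2) hU
    (by rw [conjTranspose_kronecker, ← mul_kronecker_mul, hW]; simp) hp (fun i => hr _)
    (by
      intro i j hj
      have h1 := c j.2
      rw [hj] at h1
      have h2 := (Finset.sum_eq_zero_iff_of_nonneg (fun a _ => Finset.sum_nonneg fun i _ =>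
        mul_nonneg (Complex.normSq_nonneg _) (hp i))).1 h1 j.1 (Finset.mem_univ _)
      exact (Finset.sum_eq_zero_iff_of_nonneg (fun i _ =>
        mul_nonneg (Complex.normSq_nonneg _) (hp i))).1 h2 i (Finset.mem_univ _))
    U' ((1 : Matrix A A ℂ) ⊗ₖ W') p' (fun i => r' i.2) hU'
    (by rw [conjTranspose_kronecker, ← mul_kronecker_mul, hW']; simp) hp' (fun i => hr' _)
    (by
      intro i j hj
      have h1 := c' j.2
      rw [hj] at h1
      have h2 := (Finset.sum_eq_zero_iff_of_nonneg (fun a _ => Finset.sum_nonneg fun i _ =>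
        mul_nonneg (Complex.normSq_nonneg _) (hp' i))).1 h1 j.1 (Finset.mem_univ _)
      exact (Finset.sum_eq_zero_iff_of_nonneg (fun i _ =>
        mul_nonneg (Complex.normSq_nonneg _) (hp' i))).1 h2 i (Finset.mem_univ _))
    M ((1 : Matrix A A ℂ) ⊗ₖ redSnd M) (trG M) ((1 : Matrix A A ℂ) ⊗ₖ redSnd (trG M))
    hM (by conv_lhs => rw [hR, one_kron_spec]) hM' (by conv_lhs => rw [hR', one_kron_spec]) htr
    (by
      intro s Y
      refine ⟨extG Y, ?_⟩
      rw [qf, qf, trace_mul_extG]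
      have e : ∀ Q : Matrix (A × E × G) (A × E × G) ℂ,
          (extG Y * Q * (extG Y)ᴴ).trace = (Y * trG Q * Yᴴ).trace := by
        intro Q
        rw [trace_mul_cycle, trace_mul_comm, ← extG_conjTranspose, ← extG_mul, trace_mul_extG,
          trace_mul_comm, ← trace_mul_cycle]
      have e' : ((extG Y)ᴴ * M * extG Y).trace = (Yᴴ * trG M * Y).trace := by
        rw [trace_mul_cycle, trace_mul_comm, ← extG_conjTranspose, ← extG_mul, trace_mul_extG,
          trace_mul_comm, ← trace_mul_cycle]
      rw [e, e', trG_one_kronecker])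
  have s1 : ∑ j : A × E × G, (∑ i, Complex.normSq ((Uᴴ * ((1 : Matrix A A ℂ) ⊗ₖ W)) i j) * p i)
      * Real.log (r j.2) = ∑ k, r k * Real.log (r k) := by
    rw [Fintype.sum_prod_type, Finset.sum_comm]
    refine Finset.sum_congr rfl fun k _ => ?_
    exact (Finset.sum_mul _ _ _).symm.trans (congrArg (· * Real.log (r k)) (c k))
  have s2 : ∑ j : A × E, (∑ i, Complex.normSq ((U'ᴴ * ((1 : Matrix A A ℂ) ⊗ₖ W')) i j) * p' i)
      * Real.log (r' j.2) = ∑ k, r' k * Real.log (r' k) := by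
    rw [Fintype.sum_prod_type, Finset.sum_comm]
    refine Finset.sum_congr rfl fun k _ => ?_
    exact (Finset.sum_mul _ _ _).symm.trans (congrArg (· * Real.log (r' k)) (c' k))
  rw [s1, s2, hS, hSR, hS', hSR'] at key
  linarith

/-- A vector on `A × B × E × G` with equal `AB` and `AE` marginals (`E = B`) has
nonnegative conditional entropy. -/
lemma pure_sym (ψ : A → E → E → G → ℂ) (σ : Matrix (A × E) (A × E) ℂ)
    (h1 : ∀ x y, σ x y = ∑ e, ∑ g, ψ x.1 x.2 e g * star (ψ y.1 y.2 e g))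
    (h2 : ∀ x y, σ x y = ∑ b, ∑ g, ψ x.1 b x.2 g * star (ψ y.1 b y.2 g)) :
    vnEntropy (redSnd σ) ≤ vnEntropy σ := by
  let X : Matrix (A × E) (E × G) ℂ := fun x y => ψ x.1 x.2 y.1 y.2
  let Z : Matrix E (A × E × G) ℂ := fun b y => ψ y.1 b y.2.1 y.2.2
  have hX : σ = X * Xᴴ := by
    ext x y; rw [h1, mul_apply, Fintype.sum_prod_type]; rfl
  have hZ : redSnd σ = Z * Zᴴ := by
    ext x y
    simp only [redSnd, h1, mul_apply, Fintype.sum_prod_type]; rfl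
  have hP : ((Zᴴ * Z)ᵀ).PosSemidef := (posSemidef_conjTranspose_mul_self Z).transpose
  have k := ssa _ hP
  have a1 : vnEntropy ((Zᴴ * Z)ᵀ) = vnEntropy (redSnd σ) := by
    rw [hZ, vnEntropy_transpose (isHermitian_conjTranspose_mul_self Z), vnEntropy_mul_comm]
  have a2 : trG ((Zᴴ * Z)ᵀ) = σ := by
    ext x y
    rw [h2, Finset.sum_comm]
    simp only [trG, transpose_apply, mul_apply, conjTranspose_apply]
    exact Finset.sum_congr rfl fun g _ => Finset.sum_congr rfl fun b _ => mul_comm _ _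
  have a3 : redSnd ((Zᴴ * Z)ᵀ) = (Xᴴ * X)ᵀ := by
    ext x y
    simp only [redSnd, transpose_apply, mul_apply, conjTranspose_apply, Fintype.sum_prod_type]
    rfl
  rw [a1, a2, a3, vnEntropy_transpose (isHermitian_conjTranspose_mul_self X),
    ← vnEntropy_mul_comm, ← hX] at k
  linarith

end

lemma kraus_iso {ι κ : Type*} [Fintype ι] [DecidableEq ι] [Fintype κ] {m : ℕ}
    (L : Fin m → Matrix κ ι ℂ) (hL : ∑ j, (L j)ᴴ * L j = 1) (u v : ι → ℂ) :
    ∑ z, ∑ k, (∑ e, L k z e * u e) * star (∑ e, L k z e * v e) = ∑ e, u e * star (v e) := by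
  rw [Finset.sum_comm]
  have h : ∀ k, ∑ z, (∑ e, L k z e * u e) * star (∑ e, L k z e * v e)
      = star v ⬝ᵥ (((L k)ᴴ * L k) *ᵥ u) := by
    intro k
    rw [← mulVec_mulVec, dotProduct_mulVec, ← star_mulVec, dotProduct_comm]
    rfl
  simp only [h]
  rw [← dotProduct_sum, ← sum_mulVec, hL, one_mulVec, dotProduct_comm]
  rfl

/-- Stinespring-type vector. -/
noncomputable def stin {ιa ιb ιf ιa' ιb' : Type*} [Fintype ιa] [Fintype ιb] {n m : ℕ}
    (K : Fin n → Matrix ιa' ιa ℂ) (L : Fin m → Matrix ιb' ιb ℂ) (w : ιa × ιb × ιb × ιf → ℂ)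
    (x : ιa') (y z : ιb') (g : ιf × Fin n × Fin m × Fin m) : ℂ :=
  ∑ e, L g.2.2.2 z e * ∑ a, ∑ b, K g.2.1 x a * L g.2.2.1 y b * w (a, b, e, g.1)

lemma stin_red {ιa ιb ιf ιa' ιb' : Type*} [Fintype ιa] [Fintype ιb] [Fintype ιf]
    [Fintype ιa'] [Fintype ιb'] [DecidableEq ιb] {n m : ℕ}
    (K : Fin n → Matrix ιa' ιa ℂ) (L : Fin m → Matrix ιb' ιb ℂ)
    (hL : ∑ j : Fin m, (L j)ᴴ * L j = 1) (w : ιa × ιb × ιb × ιf → ℂ) (x y : ιa' × ιb') :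
    channelOut K L (redAB (vecMulVec w (star w))) x y
      = ∑ z, ∑ g, stin K L w x.1 x.2 z g * star (stin K L w y.1 y.2 z g) := by
  have r : ∑ z, ∑ g, stin K L w x.1 x.2 z g * star (stin K L w y.1 y.2 z g)
      = ∑ i, ∑ j, ∑ f, ∑ e, (∑ a, ∑ b, K i x.1 a * L j x.2 b * w (a, b, e, f)) *
        star (∑ a, ∑ b, K i y.1 a * L j y.2 b * w (a, b, e, f)) := by
    rw [Finset.sum_comm]
    simp only [Fintype.sum_prod_type]
    rw [Finset.sum_comm]
    refine Finset.sum_congr rfl fun i _ => ?_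
    rw [Finset.sum_comm]
    refine Finset.sum_congr rfl fun j _ => Finset.sum_congr rfl fun f _ => ?_
    rw [Finset.sum_comm]
    exact kraus_iso L hL (fun e => ∑ a, ∑ b, K i x.1 a * L j x.2 b * w (a, b, e, f))
      (fun e => ∑ a, ∑ b, K i y.1 a * L j y.2 b * w (a, b, e, f))
  have hr : redAB (vecMulVec w (star w)) = ∑ f, ∑ e,
      vecMulVec (fun p : ιa × ιb => w (p.1, p.2, e, f))
        (star (fun p : ιa × ιb => w (p.1, p.2, e, f))) := by
    ext p q
    simp only [redAB, Matrix.sum_apply]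
    rw [Finset.sum_comm]
    rfl
  rw [r, channelOut, Matrix.sum_apply]
  refine Finset.sum_congr rfl fun i _ => ?_
  rw [Matrix.sum_apply]
  refine Finset.sum_congr rfl fun j _ => ?_
  rw [hr, Matrix.mul_sum, Matrix.sum_mul, Matrix.sum_apply]
  refine Finset.sum_congr rfl fun f _ => ?_
  rw [Matrix.mul_sum, Matrix.sum_mul, Matrix.sum_apply]
  refine Finset.sum_congr rfl fun e _ => ?_
  rw [mul_vecMulVec, vecMulVec_mul, ← star_mulVec, vecMulVec_apply]
  simp only [← Fintype.sum_prod_type']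
  rfl

lemma stin_red' {ιa ιb ιf ιa' ιb' : Type*} [Fintype ιa] [Fintype ιb] [Fintype ιf]
    [Fintype ιa'] [Fintype ιb'] [DecidableEq ιb] {n m : ℕ}
    (K : Fin n → Matrix ιa' ιa ℂ) (L : Fin m → Matrix ιb' ιb ℂ)
    (hL : ∑ j : Fin m, (L j)ᴴ * L j = 1) (w : ιa × ιb × ιb × ιf → ℂ) (x y : ιa' × ιb') :
    channelOut K L (redAE0 (vecMulVec w (star w))) x y
      = ∑ z, ∑ g, stin K L w x.1 z x.2 g * star (stin K L w y.1 z y.2 g) := by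
  have h := stin_red K L hL (fun t => w (t.1, t.2.2.1, t.2.1, t.2.2.2)) x y
  have hr : redAB (vecMulVec (fun t : ιa × ιb × ιb × ιf => w (t.1, t.2.2.1, t.2.1, t.2.2.2))
      (star (fun t : ιa × ιb × ιb × ιf => w (t.1, t.2.2.1, t.2.1, t.2.2.2))))
      = redAE0 (vecMulVec w (star w)) := rfl
  have hst : ∀ x y z f i j k,
      stin K L (fun t : ιa × ιb × ιb × ιf => w (t.1, t.2.2.1, t.2.1, t.2.2.2)) x y z (f, i, j, k)
      = stin K L w x z y (f, i, k, j) := by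
    intro x y z f i j k
    simp only [stin, Finset.mul_sum]
    rw [Finset.sum_comm]
    conv_rhs => rw [Finset.sum_comm]
    refine Finset.sum_congr rfl fun a _ => ?_
    rw [Finset.sum_comm]
    refine Finset.sum_congr rfl fun e _ => Finset.sum_congr rfl fun b _ => ?_
    ring
  rw [hr] at h
  rw [h]
  refine Finset.sum_congr rfl fun z _ => ?_
  simp only [Fintype.sum_prod_type, hst]
  refine Finset.sum_congr rfl fun f _ => Finset.sum_congr rfl fun i _ => ?_
  rw [Finset.sum_comm]

lemma vnEntropy_single {ι : Type*} [Fintype ι] [DecidableEq ι] (x : ι) :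
    vnEntropy (Matrix.single x x (1 : ℂ)) = 0 := by
  rw [← diagonal_single]
  have hH : (diagonal (Pi.single x (1 : ℂ))).IsHermitian := by
    rw [IsHermitian, diagonal_conjTranspose]
    congr 1
    ext i
    by_cases h : i = x
    · subst h; simp
    · simp [h]
  rw [vnEntropy_eq_roots hH, charpoly_diagonal]
  apply Multiset.sum_eq_zero
  intro r hr
  obtain ⟨z, hz, rfl⟩ := Multiset.mem_map.1 hr
  have hz' := (Polynomial.mem_roots'.1 hz).2
  rw [Polynomial.IsRoot, Polynomial.eval_prod, Finset.prod_eq_zero_iff] at hz'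
  obtain ⟨i, -, hi⟩ := hz'
  rw [Polynomial.eval_sub, Polynomial.eval_X, Polynomial.eval_C, sub_eq_zero] at hi
  rw [hi]
  by_cases h : i = x
  · subst h; simp
  · simp [h]

lemma reset_kraus {ι κ : Type*} [Fintype ι] [DecidableEq ι] [Fintype κ] [DecidableEq κ] (k : κ) :
    ∑ i, (Matrix.single k ((Fintype.equivFin ι).symm i) (1 : ℂ))ᴴ
      * Matrix.single k ((Fintype.equivFin ι).symm i) (1 : ℂ) = 1 := by
  simp only [conjTranspose_single, star_one, single_mul_single_same, mul_one]
  rw [Equiv.sum_comp (Fintype.equivFin ι).symm (fun a => Matrix.single a a (1 : ℂ))]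
  exact sum_single_one

lemma reset_out {ιa ιb ιa' ιb' : Type*}
    [Fintype ιa] [Fintype ιb] [Fintype ιa'] [Fintype ιb']
    [DecidableEq ιa] [DecidableEq ιb] [DecidableEq ιa'] [DecidableEq ιb'] (x : ιa') (y : ιb')
    (ρ : Matrix (ιa × ιb) (ιa × ιb) ℂ) (h : ρ.trace = 1) :
    channelOut (fun i => Matrix.single x ((Fintype.equivFin ιa).symm i) (1 : ℂ))
      (fun i => Matrix.single y ((Fintype.equivFin ιb).symm i) (1 : ℂ)) ρ
      = Matrix.single (x, y) (x, y) 1 := by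
  rw [channelOut]
  rw [Equiv.sum_comp (Fintype.equivFin ιa).symm (fun a => ∑ j,
    (Matrix.single x a (1 : ℂ) ⊗ₖ Matrix.single y ((Fintype.equivFin ιb).symm j) (1 : ℂ)) * ρ *
    (Matrix.single x a (1 : ℂ) ⊗ₖ Matrix.single y ((Fintype.equivFin ιb).symm j) (1 : ℂ))ᴴ)]
  have : ∀ a, ∑ j,
    (Matrix.single x a (1 : ℂ) ⊗ₖ Matrix.single y ((Fintype.equivFin ιb).symm j) (1 : ℂ)) * ρ *
    (Matrix.single x a (1 : ℂ) ⊗ₖ Matrix.single y ((Fintype.equivFin ιb).symm j) (1 : ℂ))ᴴ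
    = ∑ b, Matrix.single (x, y) (x, y) (ρ (a, b) (a, b)) := by
    intro a
    rw [Equiv.sum_comp (Fintype.equivFin ιb).symm (fun b =>
      (Matrix.single x a (1 : ℂ) ⊗ₖ Matrix.single y b (1 : ℂ)) * ρ *
      (Matrix.single x a (1 : ℂ) ⊗ₖ Matrix.single y b (1 : ℂ))ᴴ)]
    refine Finset.sum_congr rfl fun b _ => ?_
    rw [single_kronecker_single, conjTranspose_single, single_mul_mul_single]
    simp
  simp only [this]
  rw [← h, trace, Fintype.sum_prod_type]
  ext p q
  simp only [Matrix.sum_apply, single_apply, diag_apply]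
  split_ifs <;> simp

/-- **Theorem 1 of the paper, full form.** For a pure density matrix `ρ` on `a × b × e0 × f`
with `ρ^{a b} = ρ^{a e0}`: (1) every pair of local channels `M : a → a'`, `N : b → b'`
(Kraus families `K`, `L`) yields nonpositive coherent information toward `B`;
(2) some pair of local channels yields coherent information exactly `0`;
hence (3) the supremum over all pairs of local channels — the LO-optimized coherent
information `I^B_LO(W^{AB})` — equals `0`. -/
theorem lo_optimized_coherent_info_eq_zero
    {ιa ιb ιf ιa' ιb' : Type*}
    [Fintype ιa] [Fintype ιb] [Fintype ιf] [Fintype ιa'] [Fintype ιb']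
    [DecidableEq ιa] [DecidableEq ιb] [DecidableEq ιf] [DecidableEq ιa'] [DecidableEq ιb']
    [Nonempty ιa] [Nonempty ιb] [Nonempty ιf] [Nonempty ιa'] [Nonempty ιb']
    (ρ : Matrix (ιa × ιb × ιb × ιf) (ιa × ιb × ιb × ιf) ℂ)
    (hpure : IsPureDensityMatrix ρ)
    (hmirror : redAB ρ = redAE0 ρ) :
    (∀ (n m : ℕ) (K : Fin n → Matrix ιa' ιa ℂ) (L : Fin m → Matrix ιb' ιb ℂ),
        (∑ i : Fin n, (K i)ᴴ * K i = 1) → (∑ j : Fin m, (L j)ᴴ * L j = 1) →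
        coherentInfoOut K L (redAB ρ) ≤ 0)
    ∧ (∃ (n m : ℕ) (K : Fin n → Matrix ιa' ιa ℂ) (L : Fin m → Matrix ιb' ιb ℂ),
        (∑ i : Fin n, (K i)ᴴ * K i = 1) ∧ (∑ j : Fin m, (L j)ᴴ * L j = 1) ∧
        coherentInfoOut K L (redAB ρ) = 0)
    ∧ sSup {x : ℝ | ∃ (n m : ℕ) (K : Fin n → Matrix ιa' ιa ℂ) (L : Fin m → Matrix ιb' ιb ℂ),
        (∑ i : Fin n, (K i)ᴴ * K i = 1) ∧ (∑ j : Fin m, (L j)ᴴ * L j = 1) ∧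
        x = coherentInfoOut K L (redAB ρ)} = 0 := by
  have hup : ∀ (n m : ℕ) (K : Fin n → Matrix ιa' ιa ℂ) (L : Fin m → Matrix ιb' ιb ℂ),
        (∑ i : Fin n, (K i)ᴴ * K i = 1) → (∑ j : Fin m, (L j)ᴴ * L j = 1) →
        coherentInfoOut K L (redAB ρ) ≤ 0 := by
    intro n m K L _ hL
    obtain ⟨-, w, -, rfl⟩ := hpure
    refine sub_nonpos.2 (pure_sym (stin K L w) _ (stin_red K L hL w) ?_)
    intro x y
    rw [hmirror]
    exact stin_red' K L hL w x y
  have hex : ∃ (n m : ℕ) (K : Fin n → Matrix ιa' ιa ℂ) (L : Fin m → Matrix ιb' ιb ℂ),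
        (∑ i : Fin n, (K i)ᴴ * K i = 1) ∧ (∑ j : Fin m, (L j)ᴴ * L j = 1) ∧
        coherentInfoOut K L (redAB ρ) = 0 := by
    obtain ⟨x⟩ := ‹Nonempty ιa'›
    obtain ⟨y⟩ := ‹Nonempty ιb'›
    refine ⟨_, _, _, _, reset_kraus (ι := ιa) x, reset_kraus (ι := ιb) y, ?_⟩
    have ht : (redAB ρ).trace = 1 := by
      rw [← hpure.1.2]
      simp only [trace, diag_apply, redAB, Fintype.sum_prod_type]
    have hr : redSnd (Matrix.single (x, y) (x, y) (1 : ℂ)) = Matrix.single y y 1 := by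
      ext p q
      simp [redSnd, single_apply, Prod.ext_iff, ite_and]
    rw [coherentInfoOut, reset_out x y _ ht, hr, vnEntropy_single, vnEntropy_single, sub_zero]
  refine ⟨hup, hex, ?_⟩
  refine IsGreatest.csSup_eq ⟨?_, ?_⟩
  · obtain ⟨n, m, K, L, hK, hL, h⟩ := hex
    exact ⟨n, m, K, L, hK, hL, h.symm⟩
  · rintro z ⟨n, m, K, L, hK, hL, rfl⟩
    exact hup n m K L hK hL
end
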